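/- Let G be an s-bridgeless signed graph with |E_N(G)| = ε_N(G). Then G has a pair of subgraphs {G₁, G₂} such that: (1) E(G₁) ∪ E(G₂) = E(G); (2) G₁ contains no negative edge and is bridgeless; and (3) G₂ − E_N(G) is acyclic and G₂ has a signed circuit {1, 2, …, k}-cover, where k = 2 if G is g-bridgeless with even negativeness, and k = 3 otherwise. -/

import Mathlib

open scoped Classical

noncomputable section

/-- A signed (multi)graph: a finite multigraph (loops and multiple edges allowed)
together with a sign on each edge (`neg e = true` means `e` is negative). -/
structure SignedMultigraph where
  V : Type
  E : Type
  [fintypeV : Fintype V]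
  [fintypeE : Fintype E]
  ends : E → Sym2 V
  neg : E → Bool

attribute [instance] SignedMultigraph.fintypeV SignedMultigraph.fintypeE

namespace SignedMultigraph

variable (G : SignedMultigraph)

/-- The vertices incident with at least one edge of `S`. -/
def support (S : Finset G.E) : Finset G.V :=
  Finset.univ.filter fun v => ∃ e ∈ S, v ∈ G.ends e

/-- Degree of `v` in the edge set `S`; loops count twice. -/
def degIn (S : Finset G.E) (v : G.V) : ℕ :=
  ∑ e ∈ S, (if G.ends e = Sym2.diag v then 2 else if v ∈ G.ends e then 1 else 0)

/-- `u` and `v` are joined by an edge of `S`. -/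
def Adj (S : Finset G.E) (u v : G.V) : Prop := ∃ e ∈ S, G.ends e = s(u, v)

/-- Reachability using only edges of `S`. -/
def Reach (S : Finset G.E) : G.V → G.V → Prop := Relation.ReflTransGen (G.Adj S)

/-- The subgraph with edge set `S` (and vertex set its support) is connected. -/
def ConnOn (S : Finset G.E) : Prop :=
  ∀ u ∈ G.support S, ∀ v ∈ G.support S, G.Reach S u v

/-- The whole signed graph is connected. -/
def Connected : Prop := Nonempty G.V ∧ ∀ u v : G.V, G.Reach Finset.univ u v

/-- The negative edges among `S`. -/
def negEdges (S : Finset G.E) : Finset G.E := S.filter fun e => G.neg e = true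

/-- A circuit: a (nonempty) connected 2-regular subgraph, given by its edge set. -/
def IsCircuit (S : Finset G.E) : Prop :=
  S.Nonempty ∧ G.ConnOn S ∧ ∀ v ∈ G.support S, G.degIn S v = 2

/-- A balanced circuit: a circuit with an even number of negative edges. -/
def IsBalancedCircuit (S : Finset G.E) : Prop :=
  G.IsCircuit S ∧ Even (G.negEdges S).card

/-- An unbalanced circuit: a circuit with an odd number of negative edges. -/
def IsUnbalancedCircuit (S : Finset G.E) : Prop :=
  G.IsCircuit S ∧ ¬ Even (G.negEdges S).card

/-- A short barbell: two unbalanced circuits meeting at exactly one vertex. -/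
def IsShortBarbell (S : Finset G.E) : Prop :=
  ∃ C₁ C₂ : Finset G.E, G.IsUnbalancedCircuit C₁ ∧ G.IsUnbalancedCircuit C₂ ∧
    Disjoint C₁ C₂ ∧ (G.support C₁ ∩ G.support C₂).card = 1 ∧ S = C₁ ∪ C₂

/-- A path with (distinct) ends `u` and `v`, given by its edge set. -/
def IsPath (P : Finset G.E) (u v : G.V) : Prop :=
  P.Nonempty ∧ G.ConnOn P ∧ u ≠ v ∧ u ∈ G.support P ∧ v ∈ G.support P ∧
    G.degIn P u = 1 ∧ G.degIn P v = 1 ∧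
    ∀ w ∈ G.support P, w ≠ u → w ≠ v → G.degIn P w = 2

/-- A long barbell: two vertex-disjoint unbalanced circuits joined by a path
meeting the circuits only at its ends. -/
def IsLongBarbell (S : Finset G.E) : Prop :=
  ∃ (C₁ C₂ P : Finset G.E) (u v : G.V),
    G.IsUnbalancedCircuit C₁ ∧ G.IsUnbalancedCircuit C₂ ∧
    Disjoint (G.support C₁) (G.support C₂) ∧
    G.IsPath P u v ∧
    G.support P ∩ G.support C₁ = {u} ∧ G.support P ∩ G.support C₂ = {v} ∧
    Disjoint P C₁ ∧ Disjoint P C₂ ∧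
    S = C₁ ∪ C₂ ∪ P

/-- A signed circuit: a balanced circuit, a short barbell, or a long barbell. -/
def IsSignedCircuit (S : Finset G.E) : Prop :=
  G.IsBalancedCircuit S ∨ G.IsShortBarbell S ∨ G.IsLongBarbell S

/-- The number of members of the family `F` containing the edge `e`. -/
def coverCount (F : Multiset (Finset G.E)) (e : G.E) : ℕ :=
  (F.filter fun S => e ∈ S).card

/-- The total length of the family `F`. -/
def coverLength (F : Multiset (Finset G.E)) : ℕ := (F.map Finset.card).sum

/-- A signed circuit cover: every edge is in at least one member. -/
def IsSignedCircuitCover (F : Multiset (Finset G.E)) : Prop :=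
  (∀ S ∈ F, G.IsSignedCircuit S) ∧ ∀ e : G.E, 1 ≤ G.coverCount F e

/-- The length of a shortest signed circuit cover. -/
def SCC : ℕ := sInf { n | ∃ F, G.IsSignedCircuitCover F ∧ G.coverLength F = n }

/-- Whether edge `e` has exactly one endpoint in the vertex set `A`. -/
def crossesB (A : Finset G.V) (e : G.E) : Bool :=
  Sym2.lift ⟨fun x y => Bool.xor (decide (x ∈ A)) (decide (y ∈ A)),
    fun x y => Bool.xor_comm _ _⟩ (G.ends e)

/-- Sign of `e` (`true` = negative) after switching at every vertex of `A`. -/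
def negAfter (A : Finset G.V) (e : G.E) : Bool :=
  Bool.xor (G.neg e) (G.crossesB A e)

/-- Minimum number of negative edges in `S` over all switchings. -/
def negOf (S : Finset G.E) : ℕ :=
  sInf { n | ∃ A : Finset G.V, (S.filter fun e => G.negAfter A e = true).card = n }

/-- The negativeness of `G`. -/
def negativeness : ℕ := G.negOf Finset.univ

/-- The edges of `S` with exactly one endpoint in `U`: the edge boundary `δ(U)` inside `S`. -/
def boundary (S : Finset G.E) (U : Finset G.V) : Finset G.E :=
  S.filter fun e => G.crossesB U e = true

/-- `b` is a bridge of the subgraph with edge set `S`. -/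
def IsBridge (S : Finset G.E) (b : G.E) : Prop :=
  ∃ U : Finset G.V, G.boundary S U = {b}

/-- The subgraph with edge set `S` is bridgeless. -/
def Bridgeless (S : Finset G.E) : Prop := ∀ b ∈ S, ¬ G.IsBridge S b

/-- `G` is 2-edge-connected. -/
def TwoEdgeConnected : Prop :=
  G.Connected ∧ ∀ b : G.E, ¬ G.IsBridge Finset.univ b

/-- Edges of `S` lying in the same component (of the subgraph with edge set `S`)
as the vertex `x`. -/
def compEdges (S : Finset G.E) (x : G.V) : Finset G.E :=
  S.filter fun e => ∃ u, u ∈ G.ends e ∧ G.Reach S x u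

/-- A g-bridge: a bridge such that both components of `G - b` have even negativeness. -/
def IsGBridge (b : G.E) : Prop :=
  G.IsBridge Finset.univ b ∧
    ∃ x y : G.V, G.ends b = s(x, y) ∧
      Even (G.negOf (G.compEdges (Finset.univ.erase b) x)) ∧
      Even (G.negOf (G.compEdges (Finset.univ.erase b) y))

/-- `G` has no g-bridge (in any of its components). -/
def GBridgeless : Prop := ∀ b : G.E, ¬ G.IsGBridge b

/-- Member of `B_g(G)`: a bridge such that at least one component of `G - b`
contains an odd number of negative edges. -/
def IsBgBridge (b : G.E) : Prop :=
  G.IsBridge Finset.univ b ∧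
    ∃ x : G.V, x ∈ G.ends b ∧
      ¬ Even (G.negEdges (G.compEdges (Finset.univ.erase b) x)).card

/-- Member of `B_s(G)`: a bridge such that each of the two components of `G - b`
contains a negative edge. -/
def IsSBridge (b : G.E) : Prop :=
  G.IsBridge Finset.univ b ∧
    ∃ x y : G.V, G.ends b = s(x, y) ∧
      (G.negEdges (G.compEdges (Finset.univ.erase b) x)).Nonempty ∧
      (G.negEdges (G.compEdges (Finset.univ.erase b) y)).Nonempty

/-- `G` is s-bridgeless: every edge lies in some signed circuit. -/
def SBridgeless : Prop := ∀ e : G.E, ∃ S : Finset G.E, G.IsSignedCircuit S ∧ e ∈ S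

/-- `{e, f}` is a 2-edge-cut of `G`. -/
def IsTwoEdgeCut (e f : G.E) : Prop :=
  e ≠ f ∧ ∃ U : Finset G.V, G.boundary Finset.univ U = {e, f}

/-- `S_G(e) = {e} ∪ {f : {e,f} is a 2-edge-cut of G}`. -/
def SSet (e : G.E) : Finset G.E :=
  insert e (Finset.univ.filter fun f => G.IsTwoEdgeCut e f)

/-- The edge set `R` spans an acyclic subgraph (every nonempty subset has a
vertex of degree one). -/
def AcyclicSet (R : Finset G.E) : Prop :=
  ∀ F ⊆ R, F.Nonempty → ∃ v : G.V, G.degIn F v = 1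

/-- `T` is the edge set of a spanning tree of `G`. -/
def IsSpanningTree (T : Finset G.E) : Prop :=
  G.AcyclicSet T ∧ Nonempty G.V ∧ ∀ u v : G.V, G.Reach T u v

/-- `G` is eulerian: connected with all degrees even. -/
def Eulerian : Prop :=
  G.Connected ∧ ∀ v : G.V, Even (G.degIn Finset.univ v)

/-- The edge set `S` spans an eulerian subgraph. -/
def IsEulerianSub (S : Finset G.E) : Prop :=
  S.Nonempty ∧ G.ConnOn S ∧ ∀ v ∈ G.support S, Even (G.degIn S v)

/-- The vertex class of `v` after contracting each member of `ℬ`. -/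
def classOf (ℬ : Finset (Finset G.E)) (v : G.V) : Finset G.V :=
  Finset.univ.filter fun u => u = v ∨ ∃ B ∈ ℬ, v ∈ G.support B ∧ u ∈ G.support B

/-- Degree, in edge set `F`, of the contracted class of `v`. -/
def classDeg (ℬ : Finset (Finset G.E)) (F : Finset G.E) (v : G.V) : ℕ :=
  ∑ u ∈ G.classOf ℬ v, G.degIn F u

/-- `ℬ` witnesses that the subgraph with edge set `S` is a generalized barbell:
`ℬ` is a family of vertex-disjoint eulerian subgraphs of `S`, the contraction
`S/(∪ℬ)` is acyclic, and for every vertex `x` of the contracted graph,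
`|E_N(B_x)| ≡ |δ(V(B_x))| (mod 2)`. -/
def GenBarbellWitness (S : Finset G.E) (ℬ : Finset (Finset G.E)) : Prop :=
  (∀ B ∈ ℬ, B ⊆ S ∧ G.IsEulerianSub B) ∧
  (∀ B₁ ∈ ℬ, ∀ B₂ ∈ ℬ, B₁ ≠ B₂ → Disjoint (G.support B₁) (G.support B₂)) ∧
  (∀ F ⊆ S \ ℬ.sup id, F.Nonempty → ∃ v : G.V, G.classDeg ℬ F v = 1) ∧
  (∀ B ∈ ℬ, (G.negEdges B).card ≡ (G.boundary S (G.support B)).card [MOD 2]) ∧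
  (∀ v ∈ G.support S, (∀ B ∈ ℬ, v ∉ G.support B) → Even (G.boundary S {v}).card)

/-- The subgraph with edge set `S` is a generalized barbell. -/
def IsGenBarbell (S : Finset G.E) : Prop := ∃ ℬ, G.GenBarbellWitness S ℬ

end SignedMultigraph

namespace SignedMultigraph

section Basics

variable {G : SignedMultigraph}

theorem zmod_two_cases (a : ZMod 2) : a = 0 ∨ a = 1 := by
  revert a; decide

theorem pi_add_self {α : Type*} (a : α → ZMod 2) : a + a = 0 := by
  ext; exact CharTwo.add_self_eq_zero _

theorem sum_symmDiff_zmod {α M : Type*} [AddCommGroup M] (hM : ∀ a : M, a + a = 0)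
    (S T : Finset α) (f : α → M) :
    ∑ e ∈ symmDiff S T, f e = ∑ e ∈ S, f e + ∑ e ∈ T, f e := by
  have h1 : symmDiff S T = (S \ T) ∪ (T \ S) := rfl
  have hd : Disjoint (S \ T) (T \ S) := by
    rw [Finset.disjoint_left]; intro a; simp; tauto
  rw [h1, Finset.sum_union hd, ← Finset.sum_inter_add_sum_sdiff S T,
    ← Finset.sum_inter_add_sum_sdiff T S, Finset.inter_comm T S]
  have := hM (∑ e ∈ S ∩ T, f e)
  calc _ = (∑ e ∈ S ∩ T, f e + ∑ e ∈ S ∩ T, f e) + (∑ e ∈ S \ T, f e + ∑ e ∈ T \ S, f e) := by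
        rw [this, zero_add]
    _ = _ := by abel

/-- The multiplicity with which the edge `e` is incident with `v`. -/
def inc (G : SignedMultigraph) (e : G.E) (v : G.V) : ℕ :=
  if G.ends e = Sym2.diag v then 2 else if v ∈ G.ends e then 1 else 0

theorem degIn_eq_sum (S : Finset G.E) (v : G.V) : G.degIn S v = ∑ e ∈ S, G.inc e v := rfl

/-- The indicator of a vertex, with values in `ZMod 2`. -/
def pt (G : SignedMultigraph) (x : G.V) : G.V → ZMod 2 := fun v => if v = x then 1 else 0

/-- The boundary modulo two of an edge set. -/
def bd (G : SignedMultigraph) (S : Finset G.E) : G.V → ZMod 2 := fun v => (G.degIn S v : ZMod 2)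

/-- The sign of an edge in `ZMod 2`. -/
def sgn (G : SignedMultigraph) (e : G.E) : ZMod 2 := if G.neg e = true then 1 else 0

/-- The parity of the number of negative edges. -/
def par (G : SignedMultigraph) (S : Finset G.E) : ZMod 2 := ∑ e ∈ S, G.sgn e

theorem inc_eq {e : G.E} {x y : G.V} (h : G.ends e = s(x, y)) (v : G.V) :
    G.inc e v = (if v = x then 1 else 0) + (if v = y then 1 else 0) := by
  unfold inc
  rw [h]
  by_cases hx : v = x <;> by_cases hy : v = y
  · subst hx; subst hy; simp [Sym2.diag]
  · subst hx
    simp [Sym2.diag, hy, Ne.symm hy]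
  · subst hy
    have : ¬ x = v := fun h => hx h.symm
    simp [Sym2.diag, hx, this]
  · simp [Sym2.diag, hx, hy]
    intro h1; exact absurd h1.symm hx

theorem exists_ends (e : G.E) : ∃ x y, G.ends e = s(x, y) := by
  induction h : G.ends e using Sym2.ind with
  | _ x y => exact ⟨x, y, rfl⟩

theorem inc_pos {e : G.E} {v : G.V} : 0 < G.inc e v ↔ v ∈ G.ends e := by
  obtain ⟨x, y, h⟩ := exists_ends e
  rw [inc_eq h, h, Sym2.mem_iff]
  by_cases hx : v = x <;> by_cases hy : v = y <;> simp [hx, hy]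

theorem bd_eq_sum (S : Finset G.E) : G.bd S = ∑ e ∈ S, fun v => (G.inc e v : ZMod 2) := by
  ext v; simp [bd, degIn_eq_sum, Finset.sum_apply]

theorem bd_singleton {e : G.E} {x y : G.V} (h : G.ends e = s(x, y)) :
    G.bd {e} = G.pt x + G.pt y := by
  ext v
  simp only [bd, degIn_eq_sum, Finset.sum_singleton, inc_eq h, pt, Pi.add_apply]
  push_cast; rfl

@[simp] theorem bd_empty : G.bd ∅ = 0 := by ext; simp [bd, degIn_eq_sum]
@[simp] theorem par_empty : G.par ∅ = 0 := by simp [par]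

theorem bd_symmDiff (S T : Finset G.E) : G.bd (symmDiff S T) = G.bd S + G.bd T := by
  rw [bd_eq_sum, bd_eq_sum, bd_eq_sum]; exact sum_symmDiff_zmod pi_add_self _ _ _

theorem par_symmDiff (S T : Finset G.E) : G.par (symmDiff S T) = G.par S + G.par T :=
  sum_symmDiff_zmod CharTwo.add_self_eq_zero _ _ _

theorem degIn_union {S T : Finset G.E} (h : Disjoint S T) (v : G.V) :
    G.degIn (S ∪ T) v = G.degIn S v + G.degIn T v := Finset.sum_union h

theorem bd_union {S T : Finset G.E} (h : Disjoint S T) : G.bd (S ∪ T) = G.bd S + G.bd T := by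
  ext v; simp [bd, degIn_union h]

theorem par_union {S T : Finset G.E} (h : Disjoint S T) : G.par (S ∪ T) = G.par S + G.par T :=
  Finset.sum_union h

theorem bd_sdiff {S T : Finset G.E} (h : T ⊆ S) : G.bd (S \ T) = G.bd S + G.bd T := by
  rw [← symmDiff_of_ge h, bd_symmDiff]

theorem par_sdiff {S T : Finset G.E} (h : T ⊆ S) : G.par (S \ T) = G.par S + G.par T := by
  rw [← symmDiff_of_ge h, par_symmDiff]

theorem symmDiff_subset_of {A B C : Finset G.E} (h1 : A ⊆ C) (h2 : B ⊆ C) : symmDiff A B ⊆ C := by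
  intro x hx
  rcases Finset.mem_symmDiff.1 hx with h | h
  · exact h1 h.1
  · exact h2 h.1

@[simp] theorem pt_self (x : G.V) : G.pt x x = 1 := by simp [pt]
theorem pt_ne {x y : G.V} (h : y ≠ x) : G.pt x y = 0 := by simp [pt, h]

theorem par_eq_card (S : Finset G.E) : G.par S = ((G.negEdges S).card : ZMod 2) := by
  simp [par, sgn, negEdges]

theorem even_iff_par {S : Finset G.E} : Even (G.negEdges S).card ↔ G.par S = 0 := by
  rw [par_eq_card, ZMod.natCast_eq_zero_iff_even]

theorem mem_support {S : Finset G.E} {v : G.V} : v ∈ G.support S ↔ ∃ e ∈ S, v ∈ G.ends e := by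
  simp [support]

theorem support_mono {S T : Finset G.E} (h : S ⊆ T) : G.support S ⊆ G.support T := by
  intro v; simp only [mem_support]; rintro ⟨e, he, hv⟩; exact ⟨e, h he, hv⟩

theorem support_union (S T : Finset G.E) : G.support (S ∪ T) = G.support S ∪ G.support T := by
  ext v; simp only [mem_support, Finset.mem_union]
  constructor
  · rintro ⟨e, he | he, hv⟩
    exacts [Or.inl ⟨e, he, hv⟩, Or.inr ⟨e, he, hv⟩]
  · rintro (⟨e, he, hv⟩ | ⟨e, he, hv⟩)
    exacts [⟨e, Or.inl he, hv⟩, ⟨e, Or.inr he, hv⟩]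

@[simp] theorem support_empty : G.support ∅ = ∅ := by ext; simp [mem_support]

theorem support_singleton {e : G.E} {x y : G.V} (h : G.ends e = s(x, y)) :
    G.support {e} = {x, y} := by
  ext v; simp [mem_support, h]

theorem degIn_pos {S : Finset G.E} {v : G.V} : 0 < G.degIn S v ↔ v ∈ G.support S := by
  rw [degIn_eq_sum, Finset.sum_pos_iff, mem_support]
  simp only [inc_pos]

theorem degIn_eq_zero {S : Finset G.E} {v : G.V} : G.degIn S v = 0 ↔ v ∉ G.support S := by
  rw [← degIn_pos]; omega

theorem degIn_mono {S T : Finset G.E} (h : S ⊆ T) (v : G.V) : G.degIn S v ≤ G.degIn T v :=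
  Finset.sum_le_sum_of_subset h

theorem bd_ne_zero_mem {S : Finset G.E} {v : G.V} (h : G.bd S v ≠ 0) : v ∈ G.support S := by
  rw [← degIn_pos]; by_contra hc
  apply h; simp [bd, Nat.eq_zero_of_not_pos hc]

theorem Reach.mono {S T : Finset G.E} (h : S ⊆ T) {u v : G.V} (hr : G.Reach S u v) :
    G.Reach T u v := by
  induction hr with
  | refl => exact Relation.ReflTransGen.refl
  | tail _ h' ih =>
    obtain ⟨e, he, h'⟩ := h'
    exact ih.tail ⟨e, h he, h'⟩

theorem Reach.refl' (S : Finset G.E) (u : G.V) : G.Reach S u u := Relation.ReflTransGen.refl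

theorem Reach.trans' {S : Finset G.E} {u v w : G.V} (h : G.Reach S u v) (h' : G.Reach S v w) :
    G.Reach S u w := Relation.ReflTransGen.trans h h'

theorem Reach.symm' {S : Finset G.E} {u v : G.V} (h : G.Reach S u v) : G.Reach S v u := by
  induction h with
  | refl => exact Relation.ReflTransGen.refl
  | tail _ h' ih =>
    obtain ⟨e, he, h'⟩ := h'
    exact Relation.ReflTransGen.head ⟨e, he, by rw [h', Sym2.eq_swap]⟩ ih

theorem reach_edge {S : Finset G.E} {e : G.E} (he : e ∈ S) {x y : G.V} (h : G.ends e = s(x, y)) :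
    G.Reach S x y := Relation.ReflTransGen.single ⟨e, he, h⟩

theorem reach_ends {S : Finset G.E} {e : G.E} (he : e ∈ S) {x y : G.V} (hx : x ∈ G.ends e)
    (hy : y ∈ G.ends e) : G.Reach S x y := by
  obtain ⟨a, b, h⟩ := exists_ends e
  rw [h, Sym2.mem_iff] at hx hy
  have := reach_edge he h
  rcases hx with rfl | rfl <;> rcases hy with rfl | rfl
  · exact Reach.refl' _ _
  · exact this
  · exact this.symm'
  · exact Reach.refl' _ _

theorem exists_bd_of_reach {W : Finset G.E} {u v : G.V} (h : G.Reach W u v) :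
    ∃ P ⊆ W, G.bd P = G.pt u + G.pt v := by
  induction h with
  | refl => exact ⟨∅, by simp, by rw [pi_add_self]; simp⟩
  | tail _ h ih =>
    obtain ⟨P, hP, hb⟩ := ih
    obtain ⟨e, he, hee⟩ := h
    refine ⟨symmDiff P {e}, symmDiff_subset_of hP (by simpa using he), ?_⟩
    rw [bd_symmDiff, hb, bd_singleton hee, add_assoc, ← add_assoc (G.pt _) (G.pt _) (G.pt _),
      pi_add_self, zero_add]

theorem crossesB_eq {e : G.E} {x y : G.V} (h : G.ends e = s(x, y)) (U : Finset G.V) :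
    G.crossesB U e = true ↔ ¬ (x ∈ U ↔ y ∈ U) := by
  unfold crossesB; rw [h]; simp only [Sym2.lift_mk]
  by_cases hx : x ∈ U <;> by_cases hy : y ∈ U <;> simp [hx, hy]

theorem mem_boundary {S : Finset G.E} {U : Finset G.V} {e : G.E} {x y : G.V}
    (h : G.ends e = s(x, y)) : e ∈ G.boundary S U ↔ e ∈ S ∧ ¬ (x ∈ U ↔ y ∈ U) := by
  simp [boundary, crossesB_eq h]

theorem sum_pt (U : Finset G.V) (x : G.V) : ∑ v ∈ U, G.pt x v = if x ∈ U then 1 else 0 := by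
  simp [pt]

theorem sum_bd (S : Finset G.E) (U : Finset G.V) :
    ∑ v ∈ U, G.bd S v = ((G.boundary S U).card : ZMod 2) := by
  induction S using Finset.induction_on with
  | empty => simp [boundary]
  | insert e S he ih =>
    obtain ⟨x, y, h⟩ := exists_ends e
    have hd : Disjoint {e} S := by simpa using he
    rw [Finset.insert_eq, bd_union hd]
    simp only [Pi.add_apply, Finset.sum_add_distrib, ih, bd_singleton h, sum_pt]
    have : G.boundary ({e} ∪ S) U = G.boundary {e} U ∪ G.boundary S U := by
      rw [boundary, Finset.filter_union]; rfl
    rw [this, Finset.card_union_of_disjoint]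
    · push_cast; congr 1
      by_cases hc : e ∈ G.boundary {e} U
      · have h1 : G.boundary {e} U = {e} := by
          apply Finset.Subset.antisymm (Finset.filter_subset _ _)
          exact Finset.singleton_subset_iff.2 hc
        rw [h1]
        have := ((mem_boundary h).1 hc).2
        by_cases hx : x ∈ U <;> by_cases hy : y ∈ U <;> simp_all
      · have h1 : G.boundary {e} U = ∅ := by
          rw [Finset.eq_empty_iff_forall_notMem]; intro a ha
          have := (Finset.mem_filter.1 ha).1
          rw [Finset.mem_singleton] at this; subst this; exact hc ha
        rw [h1]
        rw [mem_boundary h] at hc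
        by_cases hx : x ∈ U <;> by_cases hy : y ∈ U <;> simp_all
        decide
    · exact Finset.disjoint_filter_filter hd

theorem reach_of_bd {P : Finset G.E} {u v : G.V} (h : G.bd P = G.pt u + G.pt v) :
    G.Reach P u v := by
  by_contra hc
  have huv : u ≠ v := by rintro rfl; exact hc (Reach.refl' _ _)
  set U : Finset G.V := Finset.univ.filter fun w => G.Reach P u w
  have hb : G.boundary P U = ∅ := by
    rw [Finset.eq_empty_iff_forall_notMem]; intro e he
    obtain ⟨x, y, hxy⟩ := exists_ends e
    obtain ⟨heP, hn⟩ := (mem_boundary hxy).1 he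
    apply hn
    have := reach_edge heP hxy
    simp only [U, Finset.mem_filter, Finset.mem_univ, true_and]
    exact ⟨fun h => h.trans' this, fun h => h.trans' this.symm'⟩
  have h1 := sum_bd P U
  rw [hb, h] at h1
  simp only [Pi.add_apply, Finset.sum_add_distrib, sum_pt] at h1
  have hu : u ∈ U := by simp [U, Reach.refl']
  have hv : v ∉ U := by simp [U, hc]
  simp [hu, hv] at h1

/-- An edge set without nonempty even subset. -/
def Acyc (G : SignedMultigraph) (P : Finset G.E) : Prop := ∀ X ⊆ P, G.bd X = 0 → X = ∅

theorem Acyc.mono {P Q : Finset G.E} (h : G.Acyc Q) (hs : P ⊆ Q) : G.Acyc P :=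
  fun X hX => h X (hX.trans hs)

theorem exists_acyc {P : Finset G.E} : ∃ Q ⊆ P, G.bd Q = G.bd P ∧ G.Acyc Q := by
  induction P using Finset.strongInduction with
  | H P ih =>
    by_cases h : G.Acyc P
    · exact ⟨P, subset_rfl, rfl, h⟩
    · unfold Acyc at h; push Not at h
      obtain ⟨X, hX, hb, hne⟩ := h
      obtain ⟨Q, hQ, hQb, hQa⟩ := ih (P \ X) (Finset.sdiff_ssubset hX hne)
      exact ⟨Q, hQ.trans Finset.sdiff_subset, by rw [hQb, bd_sdiff hX, hb, add_zero], hQa⟩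

theorem connOn_singleton (e : G.E) : G.ConnOn {e} := by
  intro u hu v hv
  rw [mem_support] at hu hv
  obtain ⟨a, ha, hu⟩ := hu
  obtain ⟨b, hb, hv⟩ := hv
  rw [Finset.mem_singleton] at ha hb; subst ha; subst hb
  exact reach_ends (by simp) hu hv

theorem ConnOn.union {A B : Finset G.E} (hA : G.ConnOn A) (hB : G.ConnOn B) {x : G.V}
    (hxA : x ∈ G.support A) (hxB : x ∈ G.support B) : G.ConnOn (A ∪ B) := by
  have key : ∀ u ∈ G.support (A ∪ B), G.Reach (A ∪ B) u x := by
    intro u hu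
    rw [support_union, Finset.mem_union] at hu
    rcases hu with hu | hu
    · exact (hA u hu x hxA).mono Finset.subset_union_left
    · exact (hB u hu x hxB).mono Finset.subset_union_right
  intro u hu v hv
  exact (key u hu).trans' (key v hv).symm'

theorem degIn_singleton {e : G.E} {x y : G.V} (h : G.ends e = s(x, y)) (v : G.V) :
    G.degIn {e} v = (if v = x then 1 else 0) + (if v = y then 1 else 0) := by
  simp [degIn_eq_sum, inc_eq h]

theorem isPath_singleton {e : G.E} {x y : G.V} (h : G.ends e = s(x, y)) (hxy : x ≠ y) :
    G.IsPath {e} x y := by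
  refine ⟨by simp, connOn_singleton e, hxy, ?_, ?_, ?_, ?_, ?_⟩
  · simp [support_singleton h]
  · simp [support_singleton h]
  · rw [degIn_singleton h]; simp [hxy]
  · rw [degIn_singleton h]; simp [hxy.symm]
  · intro w hw; rw [support_singleton h] at hw; simp at hw; tauto

theorem IsPath.symm {P : Finset G.E} {u v : G.V} (h : G.IsPath P u v) : G.IsPath P v u := by
  obtain ⟨h1, h2, h3, h4, h5, h6, h7, h8⟩ := h
  exact ⟨h1, h2, h3.symm, h5, h4, h7, h6, fun w hw a b => h8 w hw b a⟩

/-- Prepending an edge to a path. -/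
theorem IsPath.cons {P : Finset G.E} {u v w : G.V} {e : G.E} (hP : G.IsPath P w v)
    (he : G.ends e = s(u, w)) (hu : u ∉ G.support P) : G.IsPath (insert e P) u v := by
  obtain ⟨h1, h2, h3, h4, h5, h6, h7, h8⟩ := hP
  have heP : e ∉ P := fun h => hu (mem_support.2 ⟨e, h, by simp [he]⟩)
  have hd : Disjoint {e} P := by simpa using heP
  have huw : u ≠ w := by rintro rfl; exact hu h4
  have huv : u ≠ v := by rintro rfl; exact hu h5
  have hs : G.support (insert e P) = insert u (G.support P) := by
    rw [Finset.insert_eq, support_union, support_singleton he]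
    ext x; simp only [Finset.mem_union, Finset.mem_insert, Finset.mem_singleton]
    constructor
    · rintro ((rfl | rfl) | h)
      exacts [Or.inl rfl, Or.inr h4, Or.inr h]
    · tauto
  have hdeg : ∀ x, G.degIn (insert e P) x =
      (if x = u then 1 else 0) + (if x = w then 1 else 0) + G.degIn P x := by
    intro x; rw [Finset.insert_eq, degIn_union hd, degIn_singleton he]
  refine ⟨by simp, ?_, huv, by simp [hs], by simp [hs, h5], ?_, ?_, ?_⟩
  · rw [Finset.insert_eq]
    exact (connOn_singleton e).union h2 (x := w) (by simp [support_singleton he]) h4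
  · rw [hdeg, degIn_eq_zero.2 hu]; simp [huw]
  · rw [hdeg, h7]; simp [huv.symm, h3.symm]
  · intro x hx hxu hxv
    rw [hs, Finset.mem_insert] at hx
    have hx := hx.resolve_left hxu
    rw [hdeg]
    by_cases hxw : x = w
    · subst hxw; simp [hxu, h6]
    · simp [hxu, hxw, h8 x hx hxw hxv]

theorem exists_edge_at {P : Finset G.E} {u : G.V} (h : u ∈ G.support P) :
    ∃ e ∈ P, ∃ w, G.ends e = s(u, w) := by
  obtain ⟨e, he, hu⟩ := mem_support.1 h
  obtain ⟨w, hw⟩ := Sym2.mem_iff_exists.1 hu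
  exact ⟨e, he, w, hw⟩

theorem pt_add_cancel (u v w : G.V) : G.pt u + G.pt v + (G.pt u + G.pt w) = G.pt w + G.pt v := by
  have := pi_add_self (G.pt u)
  calc _ = (G.pt u + G.pt u) + (G.pt w + G.pt v) := by abel
    _ = _ := by rw [this, zero_add]

/-- Core induction: an acyclic set with boundary `u + v` is a path. -/
theorem Acyc.isPath {P : Finset G.E} {u v : G.V} (ha : G.Acyc P)
    (hb : G.bd P = G.pt u + G.pt v) (huv : u ≠ v) : G.IsPath P u v := by
  induction P using Finset.strongInduction generalizing u with
  | H P ih =>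
    have hu : u ∈ G.support P := bd_ne_zero_mem (by rw [hb]; simp [pt_ne huv])
    obtain ⟨e, he, w, hw⟩ := exists_edge_at hu
    have hsub : P.erase e ⊆ P := Finset.erase_subset _ _
    have hPe : P = insert e (P.erase e) := (Finset.insert_erase he).symm
    have hb' : G.bd (P.erase e) = G.pt w + G.pt v := by
      rw [← Finset.sdiff_singleton_eq_erase, bd_sdiff (by simpa using he), hb, bd_singleton hw,
        pt_add_cancel]
    by_cases hwv : w = v
    · subst hwv
      have := ha _ hsub (by rw [hb', pi_add_self])
      rw [hPe, this]; exact isPath_singleton hw huv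
    · have hP' := ih _ (Finset.erase_ssubset he) (ha.mono hsub) hb' hwv
      rw [hPe]
      refine hP'.cons hw ?_
      intro hu'
      obtain ⟨X, hX, hXb⟩ := exists_bd_of_reach (hP'.2.1 u hu' v hP'.2.2.2.2.1)
      have hXP : X ⊆ P := hX.trans hsub
      have h0 := ha (P \ X) Finset.sdiff_subset (by rw [bd_sdiff hXP, hb, hXb, pi_add_self])
      have : e ∈ P \ X := by
        simp only [Finset.mem_sdiff, he, true_and]
        intro h; exact (Finset.mem_erase.1 (hX h)).1 rfl
      rw [h0] at this; simp at this

theorem IsPath.bd {P : Finset G.E} {u v : G.V} (h : G.IsPath P u v) :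
    G.bd P = G.pt u + G.pt v := by
  obtain ⟨h1, h2, h3, h4, h5, h6, h7, h8⟩ := h
  ext x
  simp only [SignedMultigraph.bd, pt, Pi.add_apply]
  by_cases hxu : x = u
  · subst hxu; simp [h6, h3]
  by_cases hxv : x = v
  · subst hxv; simp [h7, hxu]
  by_cases hx : x ∈ G.support P
  · rw [h8 x hx hxu hxv]; simp [hxu, hxv]; decide
  · rw [degIn_eq_zero.2 hx]; simp [hxu, hxv]

theorem two_le_degIn_of_bd {X : Finset G.E} (hX : G.bd X = 0) {x : G.V} (hx : x ∈ G.support X) :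
    2 ≤ G.degIn X x := by
  have h1 := degIn_pos.2 hx
  have h2 : ((G.degIn X x : ℕ) : ZMod 2) = 0 := congrFun hX x
  rw [ZMod.natCast_eq_zero_iff_even] at h2
  obtain ⟨k, hk⟩ := h2; omega

/-- A subset attaining the full degree at `x` contains all edges at `x`. -/
theorem mem_of_degIn_eq {X S : Finset G.E} (h : X ⊆ S) {x : G.V}
    (hd : G.degIn S x ≤ G.degIn X x) {e : G.E} (he : e ∈ S) (hx : x ∈ G.ends e) : e ∈ X := by
  by_contra hc
  have h1 : G.degIn (insert e X) x = G.inc e x + G.degIn X x := Finset.sum_insert hc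
  have h2 : G.degIn (insert e X) x ≤ G.degIn S x :=
    degIn_mono (Finset.insert_subset he h) x
  have := inc_pos.2 hx
  omega

/-- If at each vertex of `X` the set `X` contains all edges of `S`, the vertices reachable
from `X` in `S` are vertices of `X`. -/
theorem mem_support_of_reach {X S : Finset G.E}
    (h : ∀ x ∈ G.support X, ∀ e ∈ S, x ∈ G.ends e → e ∈ X) {x y : G.V}
    (hx : x ∈ G.support X) (hr : G.Reach S x y) : y ∈ G.support X := by
  induction hr with
  | refl => exact hx
  | tail _ h' ih =>
    obtain ⟨e, he, hee⟩ := h'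
    exact mem_support.2 ⟨e, h _ ih e he (by simp [hee]), by simp [hee]⟩

theorem support_nonempty {X : Finset G.E} (h : X ≠ ∅) : ∃ x, x ∈ G.support X := by
  obtain ⟨e, he⟩ := Finset.nonempty_iff_ne_empty.2 h
  obtain ⟨x, y, hxy⟩ := exists_ends e
  exact ⟨x, mem_support.2 ⟨e, he, by simp [hxy]⟩⟩

theorem IsPath.acyc {P : Finset G.E} {u v : G.V} (h : G.IsPath P u v) : G.Acyc P := by
  obtain ⟨h1, h2, h3, h4, h5, h6, h7, h8⟩ := h
  intro X hX hb
  by_contra hne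
  obtain ⟨x, hx⟩ := support_nonempty hne
  have hle : ∀ y ∈ G.support P, G.degIn P y ≤ 2 := by
    intro y hy
    by_cases hyu : y = u
    · subst hyu; omega
    by_cases hyv : y = v
    · subst hyv; omega
    exact (h8 y hy hyu hyv).le
  have hu : u ∈ G.support X := by
    refine mem_support_of_reach (S := P) ?_ hx (h2 x (support_mono hX hx) u h4)
    intro y hy e he hye
    refine mem_of_degIn_eq hX ?_ he hye
    exact (hle y (support_mono hX hy)).trans (two_le_degIn_of_bd hb hy)
  have := two_le_degIn_of_bd hb hu
  have := degIn_mono hX u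
  omega

theorem IsCircuit.bd {C : Finset G.E} (h : G.IsCircuit C) : G.bd C = 0 := by
  ext x
  by_cases hx : x ∈ G.support C
  · simp only [SignedMultigraph.bd, h.2.2 x hx, Pi.zero_apply]; decide
  · simp [SignedMultigraph.bd, degIn_eq_zero.2 hx]

theorem IsCircuit.eq_of_subset {C X : Finset G.E} (h : G.IsCircuit C) (hX : X ⊆ C)
    (hb : G.bd X = 0) (hne : X ≠ ∅) : X = C := by
  obtain ⟨x, hx⟩ := support_nonempty hne
  have hall : ∀ y ∈ G.support X, ∀ e ∈ C, y ∈ G.ends e → e ∈ X := by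
    intro y hy e he hye
    refine mem_of_degIn_eq hX ?_ he hye
    rw [h.2.2 y (support_mono hX hy)]; exact two_le_degIn_of_bd hb hy
  refine Finset.Subset.antisymm hX fun e he => ?_
  obtain ⟨a, b, hab⟩ := exists_ends e
  have ha : a ∈ G.support C := mem_support.2 ⟨e, he, by simp [hab]⟩
  exact hall a (mem_support_of_reach hall hx (h.2.1 x (support_mono hX hx) a ha)) e he
    (by simp [hab])

/-- Two internally disjoint paths with the same ends form a circuit. -/
theorem IsPath.join {P Q : Finset G.E} {u v : G.V} (hP : G.IsPath P u v) (hQ : G.IsPath Q u v)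
    (hd : Disjoint P Q) (hs : G.support P ∩ G.support Q ⊆ {u, v}) : G.IsCircuit (P ∪ Q) := by
  obtain ⟨h1, h2, h3, h4, h5, h6, h7, h8⟩ := hP
  obtain ⟨k1, k2, k3, k4, k5, k6, k7, k8⟩ := hQ
  refine ⟨h1.mono Finset.subset_union_left, h2.union k2 h4 k4, fun x hx => ?_⟩
  rw [degIn_union hd]
  by_cases hxu : x = u
  · subst hxu; omega
  by_cases hxv : x = v
  · subst hxv; omega
  rw [support_union, Finset.mem_union] at hx
  have hn : ¬ (x ∈ G.support P ∧ x ∈ G.support Q) := by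
    intro h; have := hs (Finset.mem_inter.2 h); simp [hxu, hxv] at this
  rcases hx with hx | hx
  · rw [h8 x hx hxu hxv, degIn_eq_zero.2 fun h => hn ⟨hx, h⟩]
  · rw [k8 x hx hxu hxv, degIn_eq_zero.2 fun h => hn ⟨h, hx⟩]

theorem isCircuit_loop {e : G.E} {x : G.V} (h : G.ends e = s(x, x)) : G.IsCircuit {e} := by
  refine ⟨by simp, connOn_singleton e, fun v hv => ?_⟩
  rw [support_singleton h] at hv
  have : v = x := by simpa using hv
  subst this
  rw [degIn_singleton h]; simp

/-- A minimal nonempty even set is a circuit. -/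
theorem isCircuit_of_minimal {C : Finset G.E} (hne : C ≠ ∅) (hb : G.bd C = 0)
    (hmin : ∀ X ⊆ C, G.bd X = 0 → X ≠ ∅ → X = C) : G.IsCircuit C := by
  obtain ⟨e, he⟩ := Finset.nonempty_iff_ne_empty.2 hne
  obtain ⟨x, y, hxy⟩ := exists_ends e
  have hsub : {e} ⊆ C := by simpa using he
  by_cases hl : x = y
  · subst hl
    rw [← hmin {e} hsub (by rw [bd_singleton hxy, pi_add_self]) (by simp)]
    exact isCircuit_loop hxy
  · have hbP : G.bd (C \ {e}) = G.pt x + G.pt y := by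
      rw [bd_sdiff hsub, hb, zero_add, bd_singleton hxy]
    have haP : G.Acyc (C \ {e}) := by
      intro X hX hXb
      by_contra hXn
      have := hmin X (hX.trans Finset.sdiff_subset) hXb hXn
      subst this
      have := hX he; simp at this
    have hP := haP.isPath hbP hl
    have h := hP.join (isPath_singleton hxy hl) (by simp) (by
      rw [support_singleton hxy]; exact Finset.inter_subset_right)
    rwa [Finset.sdiff_union_of_subset hsub] at h

/-- Every edge of an even set lies in a circuit of that set. -/
theorem exists_circuit {S : Finset G.E} (hS : G.bd S = 0) {e : G.E} (he : e ∈ S) :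
    ∃ C ⊆ S, e ∈ C ∧ G.IsCircuit C := by
  induction S using Finset.strongInduction with
  | H S ih =>
    by_cases h : ∀ X ⊆ S, G.bd X = 0 → X ≠ ∅ → X = S
    · exact ⟨S, subset_rfl, he, isCircuit_of_minimal (Finset.ne_empty_of_mem he) hS h⟩
    · push Not at h
      obtain ⟨X, hX, hb, hne, hXS⟩ := h
      by_cases heX : e ∈ X
      · obtain ⟨C, hC, h'⟩ := ih X (hX.ssubset_of_ne hXS) hb heX
        exact ⟨C, hC.trans hX, h'⟩
      · obtain ⟨C, hC, h'⟩ := ih (S \ X) (Finset.sdiff_ssubset hX hne)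
          (by rw [bd_sdiff hX, hS, hb, add_zero]) (by simp [he, heX])
        exact ⟨C, hC.trans Finset.sdiff_subset, h'⟩

end Basics

section Circuits

variable {G : SignedMultigraph}

theorem unbalanced_iff {C : Finset G.E} :
    G.IsUnbalancedCircuit C ↔ G.IsCircuit C ∧ G.par C = 1 := by
  rw [IsUnbalancedCircuit, even_iff_par]
  rcases zmod_two_cases (G.par C) with h | h <;> simp [h]

theorem balanced_iff {C : Finset G.E} :
    G.IsBalancedCircuit C ↔ G.IsCircuit C ∧ G.par C = 0 := by
  rw [IsBalancedCircuit, even_iff_par]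

theorem exists_path {W : Finset G.E} {u v : G.V} (h : G.Reach W u v) (huv : u ≠ v) :
    ∃ P ⊆ W, G.IsPath P u v := by
  obtain ⟨P, hP, hb⟩ := exists_bd_of_reach h
  obtain ⟨Q, hQ, hQb, hQa⟩ := exists_acyc (P := P)
  exact ⟨Q, hQ.trans hP, hQa.isPath (hQb.trans hb) huv⟩

theorem IsPath.left_mem {P : Finset G.E} {u v : G.V} (h : G.IsPath P u v) : u ∈ G.support P :=
  h.2.2.2.1
theorem IsPath.right_mem {P : Finset G.E} {u v : G.V} (h : G.IsPath P u v) : v ∈ G.support P :=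
  h.2.2.2.2.1
theorem IsPath.ne {P : Finset G.E} {u v : G.V} (h : G.IsPath P u v) : u ≠ v := h.2.2.1

theorem IsPath.degIn_le {P : Finset G.E} {u v : G.V} (h : G.IsPath P u v) (x : G.V) :
    G.degIn P x ≤ 2 := by
  obtain ⟨h1, h2, h3, h4, h5, h6, h7, h8⟩ := h
  by_cases hx : x ∈ G.support P
  · by_cases hyu : x = u
    · subst hyu; omega
    by_cases hyv : x = v
    · subst hyv; omega
    exact (h8 x hx hyu hyv).le
  · rw [degIn_eq_zero.2 hx]; omega

theorem IsCircuit.degIn_le {C : Finset G.E} (h : G.IsCircuit C) (x : G.V) :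
    G.degIn C x ≤ 2 := by
  by_cases hx : x ∈ G.support C
  · exact (h.2.2 x hx).le
  · rw [degIn_eq_zero.2 hx]; omega

theorem bd_eq_one_of_split {S X : Finset G.E} (hX : X ⊆ S) {x : G.V} (hd : G.degIn S x ≤ 2)
    (h1 : x ∈ G.support X) (h2 : x ∈ G.support (S \ X)) :
    G.bd X x = 1 ∧ G.bd (S \ X) x = 1 := by
  have hu : G.degIn S x = G.degIn X x + G.degIn (S \ X) x := by
    rw [← degIn_union Finset.disjoint_sdiff, Finset.union_sdiff_of_subset hX]
  have h1 := degIn_pos.2 h1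
  have h2 := degIn_pos.2 h2
  have e1 : G.degIn X x = 1 := by omega
  have e2 : G.degIn (S \ X) x = 1 := by omega
  simp [bd, e1, e2]

theorem eq_or_of_pt_add {p q x : G.V} (h : (G.pt p + G.pt q) x = 1) : x = p ∨ x = q := by
  by_contra hc; push Not at hc
  simp [pt, hc.1, hc.2] at h

/-- Two distinct vertices split a circuit into two paths. -/
theorem IsCircuit.split {C : Finset G.E} (h : G.IsCircuit C) {p q : G.V}
    (hp : p ∈ G.support C) (hq : q ∈ G.support C) (hpq : p ≠ q) :
    ∃ A ⊆ C, G.IsPath A p q ∧ G.IsPath (C \ A) p q ∧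
      G.support A ∩ G.support (C \ A) ⊆ {p, q} := by
  obtain ⟨A, hA, hP⟩ := exists_path (h.2.1 p hp q hq) hpq
  have hb : G.bd (C \ A) = G.pt p + G.pt q := by rw [bd_sdiff hA, h.bd, hP.bd, zero_add]
  refine ⟨A, hA, hP, ?_, ?_⟩
  · refine Acyc.isPath ?_ hb hpq
    intro X hX hXb
    by_contra hne
    have := h.eq_of_subset (hX.trans Finset.sdiff_subset) hXb hne
    subst this
    obtain ⟨e, he⟩ := hP.1
    have := hX (hA he); simp [he] at this
  · intro x hx
    rw [Finset.mem_inter] at hx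
    have := (bd_eq_one_of_split hA (h.degIn_le x) hx.1 hx.2).1
    rw [hP.bd] at this
    simpa using eq_or_of_pt_add this

/-- An interior vertex splits a path into two paths. -/
theorem IsPath.split {P : Finset G.E} {u v w : G.V} (h : G.IsPath P u v)
    (hw : w ∈ G.support P) (hwu : w ≠ u) (hwv : w ≠ v) :
    ∃ A ⊆ P, G.IsPath A u w ∧ G.IsPath (P \ A) w v ∧
      G.support A ∩ G.support (P \ A) = {w} := by
  obtain ⟨A, hA, hP⟩ := exists_path (h.2.1 u h.left_mem w hw) hwu.symm
  have hb : G.bd (P \ A) = G.pt w + G.pt v := by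
    rw [bd_sdiff hA, h.bd, hP.bd, add_comm (G.pt u + G.pt v), pt_add_cancel, add_comm]
  have hP2 : G.IsPath (P \ A) w v := (h.acyc.mono Finset.sdiff_subset).isPath hb hwv
  refine ⟨A, hA, hP, hP2, ?_⟩
  apply Finset.Subset.antisymm
  · intro x hx
    rw [Finset.mem_inter] at hx
    obtain ⟨h1, h2⟩ := bd_eq_one_of_split hA (h.degIn_le x) hx.1 hx.2
    rw [hP.bd] at h1; rw [hb] at h2
    have h1 := eq_or_of_pt_add h1
    have h2 := eq_or_of_pt_add h2
    have := h.ne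
    rw [Finset.mem_singleton]
    rcases h1 with rfl | rfl
    · rcases h2 with rfl | rfl
      · rfl
      · exact absurd rfl this
    · rfl
  · simp [hP.right_mem, hP2.left_mem]

theorem not_mem_of_support_inter {A B : Finset G.E} {u : G.V}
    (hA : ∀ e ∈ A, G.ends e ≠ s(u, u)) (h : G.support A ∩ G.support B ⊆ {u}) : Disjoint A B := by
  rw [Finset.disjoint_left]
  intro e he he'
  obtain ⟨x, y, hxy⟩ := exists_ends e
  have key : ∀ z, z ∈ G.ends e → z = u := fun z hz => by
    have := h (Finset.mem_inter.2 ⟨mem_support.2 ⟨e, he, hz⟩, mem_support.2 ⟨e, he', hz⟩⟩)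
    simpa using this
  have h1 := key x (by simp [hxy])
  have h2 := key y (by simp [hxy])
  subst h1; rw [h2] at hxy
  exact hA e he hxy

theorem Acyc.not_loop {P : Finset G.E} (h : G.Acyc P) {e : G.E} (he : e ∈ P) (x : G.V) :
    G.ends e ≠ s(x, x) := by
  intro hx
  have := h {e} (by simpa using he) (by rw [bd_singleton hx, pi_add_self])
  simp at this

/-- Two unbalanced circuits which are edge-disjoint and share at most one vertex. -/
def Compat (G : SignedMultigraph) (A B : Finset G.E) : Prop :=
  Disjoint A B ∧ (G.support A ∩ G.support B).card ≤ 1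

theorem Compat.symm {A B : Finset G.E} (h : G.Compat A B) : G.Compat B A :=
  ⟨h.1.symm, by rw [Finset.inter_comm]; exact h.2⟩

theorem isSignedCircuit_barbell {A B P : Finset G.E} {u v : G.V}
    (hA : G.IsUnbalancedCircuit A) (hB : G.IsUnbalancedCircuit B)
    (hAB : Disjoint (G.support A) (G.support B)) (hP : G.IsPath P u v)
    (h1 : G.support P ∩ G.support A = {u}) (h2 : G.support P ∩ G.support B = {v}) :
    G.IsSignedCircuit (A ∪ B ∪ P) :=
  Or.inr <| Or.inr ⟨A, B, P, u, v, hA, hB, hAB, hP, h1, h2,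
    not_mem_of_support_inter (fun _ he => hP.acyc.not_loop he _) h1.subset,
    not_mem_of_support_inter (fun _ he => hP.acyc.not_loop he _) h2.subset, rfl⟩

/-- Two compatible unbalanced circuits joined by a connecting set give a barbell. -/
theorem exists_barbell {A B W : Finset G.E} (hA : G.IsUnbalancedCircuit A)
    (hB : G.IsUnbalancedCircuit B) (hAB : G.Compat A B) {x y : G.V}
    (hx : x ∈ G.support A) (hy : y ∈ G.support B) (hr : G.Reach W x y) :
    ∃ S, G.IsSignedCircuit S ∧ A ⊆ S ∧ B ⊆ S ∧ S ⊆ A ∪ B ∪ W := by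
  by_cases hc : (G.support A ∩ G.support B).card = 1
  · exact ⟨A ∪ B, Or.inr (Or.inl ⟨A, B, hA, hB, hAB.1, hc, rfl⟩), Finset.subset_union_left,
      Finset.subset_union_right, Finset.subset_union_left⟩
  have hdis : Disjoint (G.support A) (G.support B) := by
    rw [Finset.disjoint_iff_inter_eq_empty, ← Finset.card_eq_zero]
    have := hAB.2; omega
  have hne : ∀ a ∈ G.support A, ∀ b ∈ G.support B, a ≠ b := fun a ha b hb hab =>
    Finset.disjoint_left.1 hdis ha (hab ▸ hb)
  have hex : ∃ n, ∃ P ⊆ W, ∃ a ∈ G.support A, ∃ b ∈ G.support B, G.IsPath P a b ∧ P.card = n := by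
    obtain ⟨P, hP, h⟩ := exists_path hr (hne x hx y hy)
    exact ⟨_, P, hP, x, hx, y, hy, h, rfl⟩
  obtain ⟨P, hPW, a, ha, b, hb, hP, hcard⟩ := Nat.find_spec hex
  have hmin : ∀ Q ⊆ W, ∀ a' ∈ G.support A, ∀ b' ∈ G.support B, G.IsPath Q a' b' →
      P.card ≤ Q.card := fun Q hQ a' ha' b' hb' h =>
    hcard ▸ Nat.find_min' hex ⟨Q, hQ, a', ha', b', hb', h, rfl⟩
  refine ⟨A ∪ B ∪ P, isSignedCircuit_barbell hA hB hdis hP ?_ ?_, ?_, ?_, ?_⟩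
  · apply Finset.Subset.antisymm
    · intro z hz
      rw [Finset.mem_inter] at hz
      rw [Finset.mem_singleton]
      by_contra hza
      obtain ⟨Q, hQ, hQ1, hQ2, -⟩ := hP.split hz.1 hza (hne z hz.2 b hb)
      have := hmin _ (Finset.sdiff_subset.trans hPW) z hz.2 b hb hQ2
      have := Finset.card_lt_card (Finset.sdiff_ssubset hQ hQ1.1)
      omega
    · simp [hP.left_mem, ha]
  · apply Finset.Subset.antisymm
    · intro z hz
      rw [Finset.mem_inter] at hz
      rw [Finset.mem_singleton]
      by_contra hza
      obtain ⟨Q, hQ, hQ1, hQ2, -⟩ := hP.split hz.1 (hne a ha z hz.2).symm hza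
      have := hmin _ (hQ.trans hPW) a ha z hz.2 hQ1
      have h3 := Finset.card_lt_card (hQ.ssubset_of_ne (by
        rintro rfl
        have := hQ2.1; simp at this))
      omega
    · simp [hP.right_mem, hb]
  · exact Finset.subset_union_left.trans Finset.subset_union_left
  · exact Finset.subset_union_right.trans Finset.subset_union_left
  · exact Finset.union_subset_union_right hPW

/-- Two edge-disjoint unbalanced circuits sharing two vertices contain a balanced circuit. -/
theorem exists_balanced_of_not_compat {A B : Finset G.E} (hA : G.IsUnbalancedCircuit A)
    (hB : G.IsUnbalancedCircuit B) (hd : Disjoint A B) (hc : ¬ G.Compat A B) :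
    ∃ C ⊆ A ∪ B, G.IsBalancedCircuit C := by
  rw [unbalanced_iff] at hA hB
  have hc : 1 < (G.support A ∩ G.support B).card := by
    by_contra h; exact hc ⟨hd, by omega⟩
  obtain ⟨p, hp, q, hq, hpq⟩ := Finset.one_lt_card.1 hc
  rw [Finset.mem_inter] at hp hq
  have hex : ∃ n, ∃ P ⊆ B, ∃ a ∈ G.support A, ∃ b ∈ G.support A, G.IsPath P a b ∧ P.card = n := by
    obtain ⟨P, hP, h⟩ := exists_path (hB.1.2.1 p hp.2 q hq.2) hpq
    exact ⟨_, P, hP, p, hp.1, q, hq.1, h, rfl⟩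
  obtain ⟨P, hPW, a, ha, b, hb, hP, hcard⟩ := Nat.find_spec hex
  have hmin : ∀ Q ⊆ B, ∀ a' ∈ G.support A, ∀ b' ∈ G.support A, G.IsPath Q a' b' →
      P.card ≤ Q.card := fun Q hQ a' ha' b' hb' h =>
    hcard ▸ Nat.find_min' hex ⟨Q, hQ, a', ha', b', hb', h, rfl⟩
  have hsupp : G.support A ∩ G.support P ⊆ {a, b} := by
    intro z hz
    rw [Finset.mem_inter] at hz
    by_contra hn
    simp only [Finset.mem_insert, Finset.mem_singleton, not_or] at hn
    obtain ⟨Q, hQ, hQ1, hQ2, -⟩ := hP.split hz.2 hn.1 hn.2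
    have := hmin _ (Finset.sdiff_subset.trans hPW) z hz.1 b hb hQ2
    have := Finset.card_lt_card (Finset.sdiff_ssubset hQ hQ1.1)
    omega
  obtain ⟨α, hα, hα1, hα2, -⟩ := hA.1.split ha hb hP.ne
  have hpar : G.par α + G.par (A \ α) = 1 := by
    rw [← hA.2, ← par_union Finset.disjoint_sdiff, Finset.union_sdiff_of_subset hα]
  have key : ∀ β ⊆ A, G.IsPath β a b → G.par β = G.par P →
      ∃ C ⊆ A ∪ B, G.IsBalancedCircuit C := by
    intro β hβ hβP hpp
    have hdis : Disjoint β P := Finset.disjoint_of_subset_left hβ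
      (Finset.disjoint_of_subset_right hPW hd)
    refine ⟨β ∪ P, Finset.union_subset_union hβ hPW, balanced_iff.2 ⟨hβP.join hP hdis ?_, ?_⟩⟩
    · exact (Finset.inter_subset_inter_right (support_mono hβ)).trans hsupp
    · rw [par_union hdis, hpp, CharTwo.add_self_eq_zero]
  by_cases h : G.par α = G.par P
  · exact key α hα hα1 h
  · refine key _ Finset.sdiff_subset hα2 ?_
    rcases zmod_two_cases (G.par α) with h1 | h1 <;>
    rcases zmod_two_cases (G.par P) with h2 | h2 <;>
    rcases zmod_two_cases (G.par (A \ α)) with h3 | h3 <;> simp_all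

@[simp] theorem coverCount_zero (e : G.E) : G.coverCount 0 e = 0 := rfl

@[simp] theorem coverCount_cons (S : Finset G.E) (F : Multiset (Finset G.E)) (e : G.E) :
    G.coverCount (S ::ₘ F) e = (if e ∈ S then 1 else 0) + G.coverCount F e := by
  unfold coverCount
  by_cases h : e ∈ S <;> simp [h]; omega

@[simp] theorem coverCount_add (F F' : Multiset (Finset G.E)) (e : G.E) :
    G.coverCount (F + F') e = G.coverCount F e + G.coverCount F' e := by
  simp [coverCount]

theorem coverCount_filter_add (F : Multiset (Finset G.E)) (p : Finset G.E → Prop) (e : G.E) :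
    G.coverCount (F.filter p) e + G.coverCount (F.filter fun S => ¬ p S) e = G.coverCount F e := by
  rw [← coverCount_add, Multiset.filter_add_not]

theorem coverCount_pos {F : Multiset (Finset G.E)} {e : G.E} :
    0 < G.coverCount F e ↔ ∃ S ∈ F, e ∈ S := by
  rw [coverCount, Multiset.card_pos_iff_exists_mem]; simp [Multiset.mem_filter]

theorem card_le_sum_coverCount {F : Multiset (Finset G.E)} (h : ∀ S ∈ F, S.Nonempty) :
    F.card ≤ ∑ e, G.coverCount F e := by
  induction F using Multiset.induction with
  | empty => simp
  | cons S F ih =>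
    simp only [coverCount_cons, Finset.sum_add_distrib, Multiset.card_cons]
    have h1 := ih fun T hT => h T (Multiset.mem_cons_of_mem hT)
    have h2 := (h S (Multiset.mem_cons_self _ _)).card_pos
    simp only [Finset.sum_ite_mem, Finset.univ_inter, Finset.sum_const, smul_eq_mul, mul_one]
    omega

/-- `F` is a decomposition of the edge set `S` into circuits. -/
def IsDecomp (G : SignedMultigraph) (F : Multiset (Finset G.E)) (S : Finset G.E) : Prop :=
  (∀ C ∈ F, G.IsCircuit C) ∧ ∀ e, G.coverCount F e = if e ∈ S then 1 else 0

theorem IsDecomp.subset {F : Multiset (Finset G.E)} {S : Finset G.E} (h : G.IsDecomp F S)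
    {C : Finset G.E} (hC : C ∈ F) : C ⊆ S := by
  intro e he
  have := coverCount_pos.2 ⟨C, hC, he⟩
  rw [h.2] at this; by_contra hc; simp [hc] at this

theorem IsDecomp.add {F F' : Multiset (Finset G.E)} {S T : Finset G.E} (h : G.IsDecomp F S)
    (h' : G.IsDecomp F' T) (hd : Disjoint S T) : G.IsDecomp (F + F') (S ∪ T) := by
  refine ⟨fun C hC => ?_, fun e => ?_⟩
  · rcases Multiset.mem_add.1 hC with hC | hC
    exacts [h.1 C hC, h'.1 C hC]
  · rw [coverCount_add, h.2, h'.2]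
    by_cases h1 : e ∈ S <;> by_cases h2 : e ∈ T <;> simp [h1, h2]
    exact Finset.disjoint_left.1 hd h1 h2

theorem isDecomp_singleton {C : Finset G.E} (h : G.IsCircuit C) : G.IsDecomp {C} C := by
  refine ⟨by simpa using h, fun e => ?_⟩
  change G.coverCount (C ::ₘ 0) e = _
  simp only [coverCount_cons, coverCount_zero, add_zero]

theorem exists_decomp {S : Finset G.E} (hS : G.bd S = 0) : ∃ F, G.IsDecomp F S := by
  induction S using Finset.strongInduction with
  | H S ih =>
    rcases Finset.eq_empty_or_nonempty S with rfl | ⟨e, he⟩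
    · exact ⟨0, by simp, by simp⟩
    · obtain ⟨C, hC, heC, hcirc⟩ := exists_circuit hS he
      obtain ⟨F, hF⟩ := ih (S \ C) (Finset.sdiff_ssubset hC ⟨e, heC⟩)
        (by rw [bd_sdiff hC, hS, hcirc.bd, add_zero])
      refine ⟨_, Finset.union_sdiff_of_subset hC ▸ (isDecomp_singleton hcirc).add hF
        Finset.disjoint_sdiff⟩

/-- The members with an odd number of negative edges. -/
def odds (G : SignedMultigraph) (F : Multiset (Finset G.E)) : Multiset (Finset G.E) :=
  F.filter fun C => G.par C = 1

/-- The members with an even number of negative edges. -/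
def evens (G : SignedMultigraph) (F : Multiset (Finset G.E)) : Multiset (Finset G.E) :=
  F.filter fun C => ¬ G.par C = 1

theorem coverCount_odds_add_evens (F : Multiset (Finset G.E)) (e : G.E) :
    G.coverCount (G.odds F) e + G.coverCount (G.evens F) e = G.coverCount F e := by
  unfold odds evens
  convert coverCount_filter_add F (fun C => G.par C = 1) e

theorem IsDecomp.odd_mem {F : Multiset (Finset G.E)} {S C : Finset G.E} (h : G.IsDecomp F S)
    (hC : C ∈ G.odds F) : G.IsUnbalancedCircuit C ∧ C ⊆ S :=
  have h' := Multiset.mem_filter.1 hC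
  ⟨unbalanced_iff.2 ⟨h.1 C h'.1, h'.2⟩, h.subset h'.1⟩

theorem IsDecomp.even_mem {F : Multiset (Finset G.E)} {S C : Finset G.E} (h : G.IsDecomp F S)
    (hC : C ∈ G.evens F) : G.IsSignedCircuit C ∧ C ⊆ S := by
  have h' := Multiset.mem_filter.1 hC
  exact ⟨Or.inl (balanced_iff.2 ⟨h.1 C h'.1, (zmod_two_cases _).resolve_right h'.2⟩),
    h.subset h'.1⟩

theorem card_odds (F : Multiset (Finset G.E)) :
    ((G.odds F).card : ZMod 2) = (F.map G.par).sum := by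
  induction F using Multiset.induction with
  | empty => simp [odds]
  | cons S F ih =>
    unfold odds at *
    rcases zmod_two_cases (G.par S) with h | h
    · rw [Multiset.filter_cons_of_neg _ (by simp [h])]; simp [h, ih]
    · rw [Multiset.filter_cons_of_pos (p := fun C => G.par C = 1) F h]; simp [h, ih]; ring

theorem sum_par (F : Multiset (Finset G.E)) :
    (F.map G.par).sum = ∑ e, (G.coverCount F e : ZMod 2) * G.sgn e := by
  induction F using Multiset.induction with
  | empty => simp
  | cons S F ih =>
    rw [Multiset.map_cons, Multiset.sum_cons, ih]
    simp only [coverCount_cons, Nat.cast_add, add_mul, Finset.sum_add_distrib]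
    congr 1
    simp [par]

theorem IsDecomp.card_odds {F : Multiset (Finset G.E)} {S : Finset G.E} (h : G.IsDecomp F S) :
    ((G.odds F).card : ZMod 2) = G.par S := by
  rw [SignedMultigraph.card_odds, sum_par, par]; simp [h.2]

theorem IsDecomp.of_cons {F : Multiset (Finset G.E)} {C S : Finset G.E}
    (h : G.IsDecomp (C ::ₘ F) S) : G.IsDecomp F (S \ C) := by
  refine ⟨fun D hD => h.1 D (Multiset.mem_cons_of_mem hD), fun e => ?_⟩
  have h1 := h.2 e
  have h2 : e ∈ C → e ∈ S := fun he => h.subset (Multiset.mem_cons_self _ _) he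
  rw [coverCount_cons] at h1
  by_cases he : e ∈ C
  · simp [he, h2 he] at h1 ⊢; exact h1
  · simpa [he] using h1

theorem IsDecomp.disjoint {F : Multiset (Finset G.E)} {C C' S : Finset G.E}
    (h : G.IsDecomp (C ::ₘ C' ::ₘ F) S) : Disjoint C C' := by
  have := h.of_cons.subset (Multiset.mem_cons_self _ _)
  exact (Finset.disjoint_of_subset_left this Finset.sdiff_disjoint).symm

/-- Any two members of `F` (at different positions) are compatible. -/
def PairCompat (G : SignedMultigraph) (F : Multiset (Finset G.E)) : Prop :=
  ∀ a b r, F = a ::ₘ b ::ₘ r → G.Compat a b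

theorem PairCompat.mono {F F' : Multiset (Finset G.E)} (h : G.PairCompat F') (hle : F ≤ F') :
    G.PairCompat F := by
  obtain ⟨R, rfl⟩ := Multiset.le_iff_exists_add.1 hle
  rintro a b r rfl
  exact h a b (r + R) (by simp)

/-- A decomposition maximizing the number of balanced members, among those with at least `m`
unbalanced ones, has compatible unbalanced members, except possibly when there are few. -/
theorem exists_max_decomp {S : Finset G.E} (m : ℕ) (h : ∃ F, G.IsDecomp F S ∧ m ≤ (G.odds F).card) :
    ∃ F, G.IsDecomp F S ∧ m ≤ (G.odds F).card ∧
      (m + 2 ≤ (G.odds F).card → G.PairCompat (G.odds F)) := by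
  set Q : Multiset (Finset G.E) → Prop := fun F => G.IsDecomp F S ∧ m ≤ (G.odds F).card
  have hbd : ∀ F, Q F → (G.evens F).card ≤ ∑ e : G.E, 1 := by
    intro F hF
    refine (Multiset.card_le_card (Multiset.filter_le _ _)).trans
      ((card_le_sum_coverCount fun C hC => (hF.1.1 C hC).1).trans ?_)
    exact Finset.sum_le_sum fun e _ => by rw [hF.1.2]; split_ifs <;> omega
  obtain ⟨F, hF, hmax⟩ : ∃ F, Q F ∧ ∀ F', Q F' → (G.evens F').card ≤ (G.evens F).card := by
    have hex : ∃ n, ∃ F, Q F ∧ ∑ e : G.E, 1 - (G.evens F).card = n := by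
      obtain ⟨F, hF⟩ := h; exact ⟨_, F, hF, rfl⟩
    obtain ⟨F, hF, hn⟩ := Nat.find_spec hex
    refine ⟨F, hF, fun F' hF' => ?_⟩
    have := Nat.find_min' hex ⟨F', hF', rfl⟩
    have := hbd F hF
    have := hbd F' hF'
    omega
  refine ⟨F, hF.1, hF.2, fun hm a b r hab => ?_⟩
  have hFab : F = a ::ₘ b ::ₘ (r + G.evens F) := by
    rw [← Multiset.cons_add, ← Multiset.cons_add, ← hab]
    exact (Multiset.filter_add_not _ F).symm
  have ha : a ∈ G.odds F := by simp [hab]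
  have hb : b ∈ G.odds F := by simp [hab]
  have hD : G.IsDecomp (a ::ₘ b ::ₘ (r + G.evens F)) S := hFab ▸ hF.1
  have hdis := hD.disjoint
  by_contra hc
  obtain ⟨C, hC, hbal⟩ := exists_balanced_of_not_compat (hF.1.odd_mem ha).1 (hF.1.odd_mem hb).1
    hdis hc
  rw [balanced_iff] at hbal
  obtain ⟨R, hR⟩ := exists_decomp (S := (a ∪ b) \ C) (by
    rw [bd_sdiff hC, bd_union hdis, (hF.1.odd_mem ha).1.1.bd, (hF.1.odd_mem hb).1.1.bd,
      hbal.1.bd]; simp)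
  have hDr := hD.of_cons.of_cons
  have haS := (hF.1.odd_mem ha).2
  have hbS := (hF.1.odd_mem hb).2
  have h1 := (isDecomp_singleton hbal.1).add hR Finset.disjoint_sdiff
  rw [Finset.union_sdiff_of_subset hC] at h1
  have h2 := h1.add hDr (by
    rw [sdiff_sdiff_left]; exact Finset.disjoint_sdiff)
  rw [sdiff_sdiff_left, Finset.sup_eq_union,
    Finset.union_sdiff_of_subset (Finset.union_subset haS hbS)] at h2
  have he : (G.evens (G.evens F)) = G.evens F := by simp [evens]
  have ho : G.odds r = r := by
    have : G.odds (G.odds F) = G.odds F := by simp [odds]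
    rw [hab] at this
    rw [odds, Multiset.filter_eq_self] at this ⊢
    exact fun x hx => this x (by simp [hx])
  have hQ : Q ({C} + R + (r + G.evens F)) := by
    refine ⟨h2, ?_⟩
    have h3 : (G.odds r).card ≤ (G.odds ({C} + R + (r + G.evens F))).card := by
      simp only [odds, Multiset.filter_add, Multiset.card_add]; omega
    rw [ho] at h3
    rw [hab] at hm
    simp only [Multiset.card_cons] at hm
    omega
  have := hmax _ hQ
  have h4 : G.evens ({C} : Multiset (Finset G.E)) = {C} := by simp [evens, hbal.2]
  have h5 : G.evens ({C} + R + (r + G.evens F)) = {C} + G.evens R + (G.evens r + G.evens F) := by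
    rw [← h4]; conv_rhs => rw [← he]
    simp [evens, Multiset.filter_add]
  rw [h5] at this
  simp only [Multiset.card_add, Multiset.card_singleton] at this
  omega

end Circuits

section Walks

variable {G : SignedMultigraph}

/-- The characteristic function of a proposition, with values in `ℕ`. -/
def ind (p : Prop) : ℕ := if p then 1 else 0

theorem ind_le_one (p : Prop) : ind p ≤ 1 := by unfold ind; split_ifs <;> omega

theorem ind_pos {p : Prop} : 0 < ind p ↔ p := by unfold ind; split_ifs <;> simp [*]

theorem ind_true {p : Prop} (h : p) : ind p = 1 := by simp [ind, h]

theorem ind_false {p : Prop} (h : ¬ p) : ind p = 0 := by simp [ind, h]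

theorem ind_eq (p : Prop) [Decidable p] : ind p = if p then 1 else 0 := by
  unfold ind; congr

theorem coverCount_cons' (S : Finset G.E) (F : Multiset (Finset G.E)) (e : G.E) :
    G.coverCount (S ::ₘ F) e = ind (e ∈ S) + G.coverCount F e := by
  rw [coverCount_cons, ind_eq]

theorem coverCount_singleton (S : Finset G.E) (e : G.E) :
    G.coverCount {S} e = ind (e ∈ S) := by
  rw [← Multiset.cons_zero, coverCount_cons', coverCount_zero, add_zero]

theorem IsDecomp.count {F : Multiset (Finset G.E)} {S : Finset G.E} (h : G.IsDecomp F S)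
    (e : G.E) : G.coverCount F e = ind (e ∈ S) := by
  rw [h.2, ind_eq]

theorem count_val (S : Finset G.E) (e : G.E) : S.val.count e = ind (e ∈ S) := by
  by_cases h : e ∈ S
  · rw [ind_true h]; exact Multiset.count_eq_one_of_mem S.nodup h
  · rw [ind_false h]; exact Multiset.count_eq_zero_of_notMem h

theorem ind_le_of_subset {S T : Finset G.E} (h : S ⊆ T) (e : G.E) : ind (e ∈ S) ≤ ind (e ∈ T) := by
  by_cases hs : e ∈ S
  · rw [ind_true hs, ind_true (h hs)]
  · rw [ind_false hs]; omega

theorem ind_union_le (S T : Finset G.E) (e : G.E) :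
    ind (e ∈ S ∪ T) ≤ ind (e ∈ S) + ind (e ∈ T) := by
  unfold ind
  by_cases hs : e ∈ S <;> by_cases ht : e ∈ T <;> simp [hs, ht]

theorem ind_union {S T : Finset G.E} (h : Disjoint S T) (e : G.E) :
    ind (e ∈ S ∪ T) = ind (e ∈ S) + ind (e ∈ T) := by
  have : e ∈ S → e ∉ T := fun hs => Finset.disjoint_left.1 h hs
  unfold ind
  by_cases hs : e ∈ S <;> by_cases ht : e ∈ T <;> simp_all

/-- `l` is the edge list of a walk from `u` to `v`. -/
def IsWalk (G : SignedMultigraph) : G.V → List G.E → G.V → Prop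
  | u, [], v => u = v
  | u, e :: l, v => ∃ w, G.ends e = s(u, w) ∧ IsWalk G w l v

/-- The vertex `x` is visited by the walk `l` starting at `u`. -/
def Visits (G : SignedMultigraph) (u : G.V) (l : List G.E) (x : G.V) : Prop :=
  ∃ l₁ l₂, l = l₁ ++ l₂ ∧ G.IsWalk u l₁ x

theorem isWalk_append {u v : G.V} {l₁ l₂ : List G.E} :
    G.IsWalk u (l₁ ++ l₂) v ↔ ∃ w, G.IsWalk u l₁ w ∧ G.IsWalk w l₂ v := by
  induction l₁ generalizing u with
  | nil => simp [IsWalk]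
  | cons e l ih =>
    simp only [List.cons_append, IsWalk, ih]
    constructor
    · rintro ⟨w, hw, x, h1, h2⟩; exact ⟨x, ⟨w, hw, h1⟩, h2⟩
    · rintro ⟨x, ⟨w, hw, h1⟩, h2⟩; exact ⟨w, hw, x, h1, h2⟩

theorem IsWalk.unique {u v w : G.V} {l : List G.E} (h : G.IsWalk u l v) (h' : G.IsWalk u l w) :
    v = w := by
  induction l generalizing u with
  | nil => simp only [IsWalk] at h h'; exact h.symm.trans h'
  | cons e l ih =>
    obtain ⟨a, ha, h1⟩ := h
    obtain ⟨b, hb, h2⟩ := h'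
    rw [ha, Sym2.congr_right] at hb
    subst hb; exact ih h1 h2

theorem Visits.split {u v x : G.V} {l : List G.E} (h : G.Visits u l x) (hl : G.IsWalk u l v) :
    ∃ l₁ l₂, l = l₁ ++ l₂ ∧ G.IsWalk u l₁ x ∧ G.IsWalk x l₂ v := by
  obtain ⟨l₁, l₂, rfl, h1⟩ := h
  obtain ⟨w, hw, h2⟩ := isWalk_append.1 hl
  obtain rfl := hw.unique h1
  exact ⟨l₁, l₂, rfl, h1, h2⟩

theorem visits_start (u : G.V) (l : List G.E) : G.Visits u l u := ⟨[], l, rfl, rfl⟩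

theorem visits_cons {u w x : G.V} {e : G.E} {l : List G.E} (he : G.ends e = s(u, w)) :
    G.Visits u (e :: l) x ↔ x = u ∨ G.Visits w l x := by
  constructor
  · rintro ⟨l₁, l₂, h, hw⟩
    cases l₁ with
    | nil => exact Or.inl hw.symm
    | cons a l₁ =>
      simp only [List.cons_append, List.cons.injEq] at h
      obtain ⟨rfl, rfl⟩ := h
      obtain ⟨b, hb, h2⟩ := hw
      rw [he, Sym2.congr_right] at hb
      subst hb
      exact Or.inr ⟨l₁, l₂, rfl, h2⟩
  · rintro (rfl | ⟨l₁, l₂, rfl, h⟩)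
    · exact visits_start _ _
    · exact ⟨e :: l₁, l₂, rfl, w, he, h⟩

theorem IsWalk.reach {u v : G.V} {l : List G.E} (h : G.IsWalk u l v) {S : Finset G.E}
    (hS : ∀ e ∈ l, e ∈ S) : G.Reach S u v := by
  induction l generalizing u with
  | nil => simp only [IsWalk] at h; subst h; exact Reach.refl' _ _
  | cons e l ih =>
    obtain ⟨w, hw, h⟩ := h
    exact (reach_edge (hS e (by simp)) hw).trans' (ih h fun a ha => hS a (by simp [ha]))

theorem IsWalk.visits_of_mem {u v : G.V} {l : List G.E} (h : G.IsWalk u l v) {e : G.E}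
    (he : e ∈ l) {x : G.V} (hx : x ∈ G.ends e) : G.Visits u l x := by
  induction l generalizing u with
  | nil => simp at he
  | cons a l ih =>
    obtain ⟨w, hw, h⟩ := h
    rw [visits_cons hw]
    rcases List.mem_cons.1 he with rfl | he
    · rw [hw, Sym2.mem_iff] at hx
      rcases hx with rfl | rfl
      · exact Or.inl rfl
      · exact Or.inr (visits_start _ _)
    · exact Or.inr (ih h he)

/-- The boundary modulo two of a multiset of edges. -/
def mbd (G : SignedMultigraph) (M : Multiset G.E) : G.V → ZMod 2 :=
  fun v => (M.map fun e => (G.inc e v : ZMod 2)).sum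

theorem mbd_add (M M' : Multiset G.E) : G.mbd (M + M') = G.mbd M + G.mbd M' := by
  ext v; simp [mbd]

theorem mbd_cons {e : G.E} {x y : G.V} (h : G.ends e = s(x, y)) (M : Multiset G.E) :
    G.mbd (e ::ₘ M) = G.pt x + G.pt y + G.mbd M := by
  ext v; simp [mbd, inc_eq h, pt]

theorem mbd_val (S : Finset G.E) : G.mbd S.val = G.bd S := by
  ext v; simp only [mbd, bd, degIn_eq_sum, Nat.cast_sum]; rfl

theorem mbd_two_nsmul (M : Multiset G.E) : G.mbd (2 • M) = 0 := by
  rw [two_nsmul, mbd_add, pi_add_self]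

theorem IsWalk.mbd {u v : G.V} {l : List G.E} (h : G.IsWalk u l v) :
    G.mbd (l : Multiset G.E) = G.pt u + G.pt v := by
  induction l generalizing u with
  | nil => simp only [IsWalk] at h; subst h; rw [pi_add_self]; ext; simp [SignedMultigraph.mbd]
  | cons e l ih =>
    obtain ⟨w, hw, h⟩ := h
    rw [← Multiset.cons_coe, mbd_cons hw, ih h]
    have := pi_add_self (G.pt w)
    calc _ = (G.pt w + G.pt w) + (G.pt u + G.pt v) := by abel
      _ = _ := by rw [this, zero_add]

theorem bd_odd_count (M : Multiset G.E) :
    G.bd (Finset.univ.filter fun e => Odd (M.count e)) = G.mbd M := by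
  ext v
  rw [mbd, Finset.sum_multiset_map_count]
  have hs := Finset.sum_subset (Finset.subset_univ M.toFinset) (f := fun e =>
    M.count e • (G.inc e v : ZMod 2)) (fun e _ he => by
      rw [Multiset.mem_toFinset] at he; simp [Multiset.count_eq_zero_of_notMem he])
  refine Eq.trans ?_ hs.symm
  simp only [bd, degIn_eq_sum, Nat.cast_sum, Finset.sum_filter]
  refine Finset.sum_congr rfl fun e _ => ?_
  by_cases h : Odd (M.count e)
  · have h' : ((M.count e : ℕ) : ZMod 2) = 1 := ZMod.natCast_eq_one_iff_odd.2 h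
    simp [h, h']
  · have h' : ((M.count e : ℕ) : ZMod 2) = 0 :=
      (ZMod.natCast_eq_zero_iff_even).2 (Nat.not_odd_iff_even.1 h)
    simp [h, h']

/-- An acyclic set with boundary `u + v` is the edge set of a walk from `u` to `v`. -/
theorem Acyc.exists_walk {P : Finset G.E} {u v : G.V} (ha : G.Acyc P)
    (hb : G.bd P = G.pt u + G.pt v) :
    ∃ l : List G.E, G.IsWalk u l v ∧ (l : Multiset G.E) = P.val := by
  induction P using Finset.strongInduction generalizing u with
  | H P ih =>
    by_cases huv : u = v
    · subst huv
      rw [pi_add_self] at hb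
      rw [ha P subset_rfl hb]
      exact ⟨[], rfl, rfl⟩
    · have hu : u ∈ G.support P := bd_ne_zero_mem (by rw [hb]; simp [pt_ne huv])
      obtain ⟨e, he, w, hw⟩ := exists_edge_at hu
      obtain ⟨l, hl, hlP⟩ := ih (P.erase e) (Finset.erase_ssubset he)
        (ha.mono (Finset.erase_subset _ _)) (u := w) (by
          rw [← Finset.sdiff_singleton_eq_erase, bd_sdiff (by simpa using he), hb,
            bd_singleton hw, pt_add_cancel])
      refine ⟨e :: l, ⟨w, hw, hl⟩, ?_⟩
      rw [← Multiset.cons_coe, hlP, Finset.erase_val, Multiset.cons_erase he]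

theorem IsCircuit.exists_walk {C : Finset G.E} (hC : G.IsCircuit C) {x : G.V}
    (hx : x ∈ G.support C) : ∃ l : List G.E, G.IsWalk x l x ∧ (l : Multiset G.E) = C.val := by
  obtain ⟨e, he, w, hw⟩ := exists_edge_at hx
  have ha : G.Acyc (C.erase e) := by
    intro X hX hb
    by_contra hne
    have := hC.eq_of_subset (hX.trans (Finset.erase_subset _ _)) hb hne
    subst this; exact (Finset.mem_erase.1 (hX he)).1 rfl
  obtain ⟨l, hl, hlP⟩ := ha.exists_walk (u := w) (v := x) (by
    rw [← Finset.sdiff_singleton_eq_erase, bd_sdiff (by simpa using he), hC.bd, bd_singleton hw,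
      zero_add, add_comm])
  refine ⟨e :: l, ⟨w, hw, hl⟩, ?_⟩
  rw [← Multiset.cons_coe, hlP, Finset.erase_val, Multiset.cons_erase he]

/-- A nonempty closed walk through a given edge of an even multiset. -/
theorem exists_closed_walk {M : Multiset G.E} (hM : G.mbd M = 0) {e : G.E} (he : e ∈ M) {x : G.V}
    (hx : x ∈ G.ends e) : ∃ l : List G.E, G.IsWalk x l x ∧ l ≠ [] ∧ (l : Multiset G.E) ≤ M := by
  obtain ⟨y, hy⟩ := Sym2.mem_iff_exists.1 hx
  by_cases h : Odd (M.count e)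
  · obtain ⟨C, hC, heC, hcirc⟩ := exists_circuit ((bd_odd_count M).trans hM) (e := e) (by simp [h])
    obtain ⟨l, hl, hlC⟩ := hcirc.exists_walk (x := x) (mem_support.2 ⟨e, heC, hx⟩)
    refine ⟨l, hl, ?_, ?_⟩
    · rintro rfl
      have : e ∈ C.val := heC
      rw [← hlC] at this; simp at this
    · rw [hlC, Multiset.le_iff_count]
      intro a
      by_cases ha : a ∈ C
      · have h1 := hC ha
        simp only [Finset.mem_filter, Finset.mem_univ, true_and] at h1
        rw [Multiset.count_eq_one_of_mem C.nodup ha]; exact h1.pos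
      · rw [Multiset.count_eq_zero_of_notMem ha]; omega
  · refine ⟨[e, e], ⟨y, hy, x, by rw [hy, Sym2.eq_swap], rfl⟩, by simp, ?_⟩
    have h1 := Multiset.count_pos.2 he
    rw [Nat.not_odd_iff_even] at h
    obtain ⟨k, hk⟩ := h
    rw [Multiset.le_iff_count]
    intro a
    by_cases ha : a = e
    · subst ha; simp; omega
    · simp [Ne.symm ha]

/-- Euler's theorem: an even multiset of edges contains a closed walk exhausting the component
of its starting vertex. -/
theorem exists_euler_walk {M : Multiset G.E} (hM : G.mbd M = 0) (z : G.V) :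
    ∃ l : List G.E, G.IsWalk z l z ∧ (l : Multiset G.E) ≤ M ∧
      ∀ x, G.Visits z l x → ∀ e, x ∈ G.ends e → l.count e = M.count e := by
  have hex : ∃ n, ∃ l : List G.E, G.IsWalk z l z ∧ (l : Multiset G.E) ≤ M ∧
      M.card - l.length = n := ⟨_, [], rfl, by simp, rfl⟩
  obtain ⟨l, hl, hle, hn⟩ := Nat.find_spec hex
  refine ⟨l, hl, hle, fun x hx e he => ?_⟩
  have hle' := Multiset.le_iff_count.1 hle e
  rw [Multiset.coe_count] at hle'
  by_contra hne
  have heM : e ∈ M - (l : Multiset G.E) := by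
    rw [← Multiset.count_pos, Multiset.count_sub, Multiset.coe_count]; omega
  have hb : G.mbd (M - (l : Multiset G.E)) = 0 := by
    have h1 := mbd_add (M - (l : Multiset G.E)) l
    rw [tsub_add_cancel_of_le hle, hM, hl.mbd, pi_add_self, add_zero] at h1
    exact h1.symm
  obtain ⟨m, hm, hm0, hmle⟩ := exists_closed_walk hb heM he
  obtain ⟨l₁, l₂, rfl, h1, h2⟩ := hx.split hl
  have hle2 : ((l₁ ++ m ++ l₂ : List G.E) : Multiset G.E) ≤ M := by
    have := add_le_add_left hmle (((l₁ ++ l₂ : List G.E) : Multiset G.E))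
    rw [tsub_add_cancel_of_le hle] at this
    refine le_trans (le_of_eq ?_) this
    simp only [← Multiset.coe_add]; abel
  have h3 := Nat.find_min' hex ⟨l₁ ++ m ++ l₂,
    isWalk_append.2 ⟨x, isWalk_append.2 ⟨x, h1, hm⟩, h2⟩, hle2, rfl⟩
  have h4 := Multiset.card_le_card hle2
  have h5 := List.length_pos_iff.2 hm0
  simp only [Multiset.coe_card, List.length_append] at h3 h4 hn
  omega

theorem euler_visits {M : Multiset G.E} {z : G.V} {l : List G.E} (hl : G.IsWalk z l z)
    (h : ∀ x, G.Visits z l x → ∀ e, x ∈ G.ends e → l.count e = M.count e)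
    {S : Finset G.E} (hS : ∀ e ∈ S, e ∈ M) {x : G.V} (hr : G.Reach S z x) : G.Visits z l x := by
  induction hr with
  | refl => exact visits_start _ _
  | tail _ h' ih =>
    obtain ⟨e, he, hee⟩ := h'
    have h1 := h _ ih e (by simp [hee])
    have h2 := Multiset.count_pos.2 (hS e he)
    exact hl.visits_of_mem (e := e) (List.count_pos_iff.1 (by omega)) (by simp [hee])

/-- The Euler walk attached to an even set and a doubled set. -/
theorem exists_euler_walk' {D J : Finset G.E} (hD : G.bd D = 0) (z : G.V) :
    ∃ l : List G.E, G.IsWalk z l z ∧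
      (∀ e, l.count e ≤ ind (e ∈ D) + 2 * ind (e ∈ J)) ∧
      (∀ x, G.Reach (D ∪ J) z x → G.Visits z l x) ∧
      ∀ x e, G.Visits z l x → x ∈ G.ends e →
        l.count e = ind (e ∈ D) + 2 * ind (e ∈ J) := by
  have hc : ∀ e, (D.val + 2 • J.val).count e =
      ind (e ∈ D) + 2 * ind (e ∈ J) := by
    intro e
    rw [Multiset.count_add, Multiset.count_nsmul, count_val, count_val]
  obtain ⟨l, hl, hle, h⟩ := exists_euler_walk (M := D.val + 2 • J.val)
    (by rw [mbd_add, mbd_val, hD, mbd_two_nsmul, add_zero]) z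
  refine ⟨l, hl, fun e => ?_, fun x hx => ?_, fun x e hx he => ?_⟩
  · have := Multiset.le_iff_count.1 hle e
    rwa [hc, Multiset.coe_count] at this
  · refine euler_visits hl h (S := D ∪ J) (fun e he => ?_) hx
    rw [← Multiset.count_pos, hc]
    rcases Finset.mem_union.1 he with he | he <;> rw [ind_true he] <;> omega
  · rw [h x hx e he, hc]

end Walks

section Pairing

variable {G : SignedMultigraph}

/-- The at most one circuit `pen` is connected to `u` through `W`. -/
def Pending (G : SignedMultigraph) (pen : Multiset (Finset G.E)) (W : Finset G.E) (u : G.V) :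
    Prop :=
  pen.card ≤ 1 ∧ (pen = 0 → W = ∅) ∧
    ∀ p ∈ pen, G.IsUnbalancedCircuit p ∧ ∃ x ∈ G.support p, G.Reach W x u

/-- Circuits through a common vertex are paired up into barbells. -/
theorem exists_pairing_at {u : G.V} (τ : Multiset (Finset G.E))
    (hτ : ∀ a ∈ τ, G.IsUnbalancedCircuit a ∧ u ∈ G.support a)
    {pen : Multiset (Finset G.E)} {W : Finset G.E} (hp : G.Pending pen W u)
    (hc : G.PairCompat (pen + τ)) :
    ∃ F pen' W', (∀ S ∈ F, G.IsSignedCircuit S) ∧ G.Pending pen' W' u ∧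
      (∀ e, G.coverCount F e + G.coverCount pen' e + ind (e ∈ W') ≤
        G.coverCount pen e + G.coverCount τ e + ind (e ∈ W)) ∧
      (∀ e, G.coverCount pen e + G.coverCount τ e ≤ G.coverCount F e + G.coverCount pen' e) ∧
      (pen'.card : ZMod 2) = pen.card + τ.card ∧
      (pen' ≤ τ ∨ τ = 0 ∧ pen' = pen) := by
  induction τ using Multiset.induction generalizing pen W with
  | empty =>
    exact ⟨0, pen, W, by simp, hp, by simp, by simp, by simp, Or.inr ⟨rfl, rfl⟩⟩
  | cons a τ ih =>
    have haa := hτ a (Multiset.mem_cons_self _ _)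
    have hτ' : ∀ b ∈ τ, G.IsUnbalancedCircuit b ∧ u ∈ G.support b :=
      fun b hb => hτ b (Multiset.mem_cons_of_mem hb)
    rcases Multiset.empty_or_exists_mem pen with rfl | ⟨p, hpp⟩
    · obtain rfl := hp.2.1 rfl
      obtain ⟨F, pen', W', h1, h2, h3, h4, h5, h6⟩ := ih hτ' (pen := {a}) (W := ∅)
        ⟨by simp, by simp, by
          intro p hp; rw [Multiset.mem_singleton] at hp; subst hp
          exact ⟨haa.1, u, haa.2, Reach.refl' _ _⟩⟩ (by
          rw [Multiset.singleton_add]; rwa [zero_add] at hc)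
      refine ⟨F, pen', W', h1, h2, fun e => ?_, fun e => ?_, ?_, Or.inl ?_⟩
      · have := h3 e
        have h7 : G.coverCount (a ::ₘ τ) e = G.coverCount {a} e + G.coverCount τ e := by
          rw [← Multiset.singleton_add, coverCount_add]
        rw [h7]; simp only [coverCount_zero]; omega
      · have := h4 e
        have h7 : G.coverCount (a ::ₘ τ) e = G.coverCount {a} e + G.coverCount τ e := by
          rw [← Multiset.singleton_add, coverCount_add]
        rw [h7]; simp only [coverCount_zero]; omega
      · rw [h5]; simp; ring
      · rcases h6 with h6 | ⟨rfl, rfl⟩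
        · exact h6.trans (Multiset.le_cons_self _ _)
        · simp
    · have hpen : pen = {p} := by
        obtain ⟨r, rfl⟩ := Multiset.exists_cons_of_mem hpp
        have := hp.1
        rw [Multiset.card_cons] at this
        rw [Multiset.card_eq_zero.1 (by omega : r.card = 0)]; rfl
      subst hpen
      obtain ⟨hpu, x, hx, hr⟩ := hp.2.2 p (by simp)
      obtain ⟨S, hS, hpS, haS, hSs⟩ := exists_barbell hpu haa.1
        (hc p a τ (by rw [Multiset.singleton_add])) hx haa.2 hr
      obtain ⟨F, pen', W', h1, h2, h3, h4, h5, h6⟩ := ih hτ' (pen := 0) (W := ∅)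
        ⟨by simp, by simp, by simp⟩ (hc.mono (by
          rw [zero_add]
          exact (Multiset.le_cons_self _ _).trans (Multiset.le_add_left _ _)))
      have hd : Disjoint p a := (hc p a τ (by rw [Multiset.singleton_add])).1
      refine ⟨S ::ₘ F, pen', W', ?_, h2, fun e => ?_, fun e => ?_, ?_, Or.inl ?_⟩
      · intro T hT
        rcases Multiset.mem_cons.1 hT with rfl | hT
        exacts [hS, h1 T hT]
      · have h7 := h3 e
        have h8 := ind_le_of_subset hSs e
        have h9 := ind_union_le (p ∪ a) W e
        have h10 := ind_union_le p a e
        have h11 : ind (e ∈ (∅ : Finset G.E)) = 0 := by simp [ind]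
        rw [coverCount_cons', coverCount_cons', coverCount_singleton]
        simp only [coverCount_zero] at h7
        omega
      · have h7 := h4 e
        have h8 := ind_le_of_subset (Finset.union_subset hpS haS) e
        rw [ind_union hd] at h8
        rw [coverCount_cons', coverCount_cons', coverCount_singleton]
        simp only [coverCount_zero] at h7
        omega
      · rw [h5]; simp only [Multiset.card_zero, Multiset.card_singleton, Multiset.card_cons]
        push_cast
        have : (1 : ZMod 2) + 1 = 0 := by decide
        linear_combination -this
      · rcases h6 with h6 | ⟨rfl, rfl⟩
        · exact h6.trans (Multiset.le_cons_self _ _)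
        · simp

/-- Circuits met by a walk are paired up into barbells along the walk. -/
theorem exists_pairing {v : G.V} (l : List G.E) {u : G.V} (hl : G.IsWalk u l v)
    (τ : Multiset (Finset G.E))
    (hτ : ∀ a ∈ τ, G.IsUnbalancedCircuit a ∧ ∃ x ∈ G.support a, G.Visits u l x)
    {pen : Multiset (Finset G.E)} {W : Finset G.E} (hp : G.Pending pen W u)
    (hc : G.PairCompat (pen + τ)) :
    ∃ F pen' W', (∀ S ∈ F, G.IsSignedCircuit S) ∧ G.Pending pen' W' v ∧
      (∀ e, G.coverCount F e + G.coverCount pen' e + ind (e ∈ W') ≤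
        G.coverCount pen e + G.coverCount τ e + ind (e ∈ W) + l.count e) ∧
      (∀ e, G.coverCount pen e + G.coverCount τ e ≤ G.coverCount F e + G.coverCount pen' e) ∧
      (pen'.card : ZMod 2) = pen.card + τ.card ∧
      (pen' ≤ τ ∨ τ = 0 ∧ pen' = pen) := by
  induction l generalizing u τ pen W with
  | nil =>
    simp only [IsWalk] at hl; subst hl
    obtain ⟨F, pen', W', h⟩ := exists_pairing_at τ (fun a ha => by
      obtain ⟨h1, x, hx, l₁, l₂, h2, h3⟩ := hτ a ha
      obtain ⟨rfl, rfl⟩ := List.append_eq_nil_iff.1 h2.symm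
      simp only [IsWalk] at h3; subst h3
      exact ⟨h1, hx⟩) hp hc
    exact ⟨F, pen', W', by simpa using h⟩
  | cons a l ih =>
    obtain ⟨w, hw, hl⟩ := hl
    set τ₁ := τ.filter fun a => u ∈ G.support a
    set τ₂ := τ.filter fun a => ¬ u ∈ G.support a
    have hτ12 : τ = τ₁ + τ₂ := (Multiset.filter_add_not _ _).symm
    obtain ⟨F, pen', W', h1, h2, h3, h4, h5, h6⟩ := exists_pairing_at τ₁ (u := u) (fun b hb =>
      ⟨(hτ b (Multiset.mem_filter.1 hb).1).1, (Multiset.mem_filter.1 hb).2⟩) hp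
      (hc.mono (by rw [hτ12, ← add_assoc]; exact Multiset.le_add_right _ _))
    have hle : pen' + τ₂ ≤ pen + τ := by
      rw [hτ12]
      rcases h6 with h6 | ⟨h6, rfl⟩
      · exact (add_le_add_left h6 τ₂).trans (Multiset.le_add_left _ _)
      · rw [h6, zero_add]
    set W'' : Finset G.E := if pen' = 0 then ∅ else insert a W'
    have hpen : G.Pending pen' W'' w := by
      refine ⟨h2.1, fun h => by simp [W'', h], fun p hp => ?_⟩
      have hne : pen' ≠ 0 := by rintro h; simp [h] at hp
      obtain ⟨h7, x, hx, hr⟩ := h2.2.2 p hp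
      refine ⟨h7, x, hx, ?_⟩
      simp only [W'', if_neg hne]
      exact (hr.mono (Finset.subset_insert _ _)).trans'
        (reach_edge (Finset.mem_insert_self _ _) hw)
    obtain ⟨F', pen'', W₃, k1, k2, k3, k4, k5, k6⟩ := ih hl τ₂ (fun b hb => by
      have hb' := Multiset.mem_filter.1 hb
      obtain ⟨h7, x, hx, hv⟩ := hτ b hb'.1
      refine ⟨h7, x, hx, ?_⟩
      rcases (visits_cons hw).1 hv with rfl | hv
      · exact absurd hx hb'.2
      · exact hv) hpen (hc.mono hle)
    have hW : ∀ e, ind (e ∈ W'') ≤ ind (e ∈ W') + if a = e then 1 else 0 := by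
      intro e
      by_cases h0 : pen' = 0
      · simp [W'', h0, ind]
      · simp only [W'', if_neg h0]
        by_cases hae : a = e
        · have := ind_le_one (e ∈ insert a W')
          rw [if_pos hae]; omega
        · rw [if_neg hae, add_zero]
          refine le_of_eq ?_
          congr 1
          simp [Ne.symm hae]
    refine ⟨F + F', pen'', W₃, ?_, k2, fun e => ?_, fun e => ?_, ?_, ?_⟩
    · intro S hS
      rcases Multiset.mem_add.1 hS with hS | hS
      exacts [h1 S hS, k1 S hS]
    · have := h3 e; have := k3 e; have := hW e
      rw [hτ12, coverCount_add, coverCount_add, List.count_cons]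
      simp only [beq_iff_eq]
      omega
    · have := h4 e; have := k4 e
      rw [hτ12, coverCount_add, coverCount_add]
      omega
    · rw [k5, h5, hτ12, Multiset.card_add]; push_cast; ring
    · rcases k6 with k6 | ⟨k6, rfl⟩
      · exact Or.inl (k6.trans (by rw [hτ12]; exact Multiset.le_add_left _ _))
      · rcases h6 with h6 | ⟨h6, rfl⟩
        · exact Or.inl (h6.trans (by rw [hτ12]; exact Multiset.le_add_right _ _))
        · exact Or.inr ⟨by rw [hτ12, h6, k6]; rfl, rfl⟩

end Pairing

section Trail

variable {G : SignedMultigraph}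

theorem Acyc.eq_empty {P : Finset G.E} {v : G.V} (ha : G.Acyc P) (hb : G.bd P = G.pt v + G.pt v) :
    P = ∅ := ha P subset_rfl (by rw [hb, pi_add_self])

theorem acyc_empty : G.Acyc ∅ := fun _ hX _ => Finset.subset_empty.1 hX

theorem bd_insert {P : Finset G.E} {e : G.E} (he : e ∉ P) {x y : G.V} (h : G.ends e = s(x, y)) :
    G.bd (insert e P) = G.pt x + G.pt y + G.bd P := by
  rw [Finset.insert_eq, bd_union (by simpa using he), bd_singleton h]

theorem par_insert {P : Finset G.E} {e : G.E} (he : e ∉ P) :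
    G.par (insert e P) = G.sgn e + G.par P := Finset.sum_insert he

theorem support_insert {P : Finset G.E} {e : G.E} {x y : G.V} (h : G.ends e = s(x, y)) :
    G.support (insert e P) = {x, y} ∪ G.support P := by
  rw [Finset.insert_eq, support_union, support_singleton h]

/-- A barbell with prescribed circuits and prescribed (possibly trivial) path. -/
theorem isSignedCircuit_of_path {A B P : Finset G.E} {p v : G.V}
    (hA : G.IsUnbalancedCircuit A) (hB : G.IsUnbalancedCircuit B) (hd : Disjoint A B)
    (hp : p ∈ G.support A) (hv : v ∈ G.support B)
    (hPa : G.Acyc P) (hPb : G.bd P = G.pt v + G.pt p)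
    (hPA : ∀ x ∈ G.support P, x ∈ G.support A → x = p)
    (hPB : ∀ x ∈ G.support P, x ∈ G.support B → x = v)
    (hAB : ∀ x ∈ G.support A, x ∈ G.support B → x = p ∧ x = v) :
    G.IsSignedCircuit (A ∪ B ∪ P) := by
  by_cases hvp : v = p
  · subst hvp
    rw [hPa.eq_empty hPb, Finset.union_empty]
    refine Or.inr (Or.inl ⟨A, B, hA, hB, hd, ?_, rfl⟩)
    rw [Finset.card_eq_one]
    refine ⟨v, Finset.Subset.antisymm (fun x hx => ?_) (by simp [hp, hv])⟩
    rw [Finset.mem_inter] at hx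
    simpa using (hAB x hx.1 hx.2).1
  · have hP := (hPa.isPath hPb hvp).symm
    refine isSignedCircuit_barbell hA hB ?_ hP ?_ ?_
    · rw [Finset.disjoint_left]
      intro x hx hx'
      obtain ⟨rfl, h⟩ := hAB x hx hx'
      exact hvp h.symm
    · refine Finset.Subset.antisymm (fun x hx => ?_) (by simp [hp, hP.left_mem])
      rw [Finset.mem_inter] at hx
      simpa using hPA x hx.1 hx.2
    · refine Finset.Subset.antisymm (fun x hx => ?_) (by simp [hv, hP.right_mem])
      rw [Finset.mem_inter] at hx
      simpa using hPB x hx.1 hx.2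

theorem Acyc.split {P : Finset G.E} {v p w : G.V} (ha : G.Acyc P)
    (hb : G.bd P = G.pt v + G.pt p) (hw : w = v ∨ w ∈ G.support P) :
    ∃ A ⊆ P, G.bd A = G.pt v + G.pt w ∧
      ∀ x ∈ G.support A, x ∈ G.support (P \ A) → x = w := by
  by_cases hwv : w = v
  · subst hwv
    exact ⟨∅, by simp, by rw [pi_add_self]; simp, by simp⟩
  have hw := hw.resolve_left hwv
  have hvp : v ≠ p := by
    rintro rfl; rw [ha.eq_empty hb] at hw; simp at hw
  by_cases hwp : w = p
  · subst hwp
    exact ⟨P, subset_rfl, hb, by simp⟩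
  · obtain ⟨A, hA, hA1, hA2, hA3⟩ := (ha.isPath hb hvp).split hw hwv hwp
    refine ⟨A, hA, hA1.bd, fun x hx hx' => ?_⟩
    have := hA3.subset (Finset.mem_inter.2 ⟨hx, hx'⟩)
    simpa using this

theorem Acyc.circuit {A : Finset G.E} {v w : G.V} {e : G.E} (ha : G.Acyc A)
    (hb : G.bd A = G.pt v + G.pt w) (he : G.ends e = s(v, w)) (heA : e ∉ A) :
    G.IsCircuit (insert e A) := by
  by_cases hvw : v = w
  · subst hvw
    rw [ha.eq_empty hb]; exact isCircuit_loop he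
  · rw [Finset.insert_eq]
    refine (isPath_singleton he hvw).join (ha.isPath hb hvw) (by simpa using heA) ?_
    rw [support_singleton he]; exact Finset.inter_subset_left

theorem IsCircuit.loop_eq {C : Finset G.E} (hC : G.IsCircuit C) {e : G.E} {x : G.V} (he : e ∈ C)
    (h : G.ends e = s(x, x)) : C = {e} :=
  (hC.eq_of_subset (by simpa using he) (isCircuit_loop h).bd (by simp)).symm

theorem par_singleton (e : G.E) : G.par {e} = G.sgn e := by simp [par]

/-- A negative loop. -/
def IsNegLoop (G : SignedMultigraph) (e : G.E) : Prop :=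
  G.sgn e = 1 ∧ ∃ x, G.ends e = s(x, x)

theorem IsNegLoop.unbalanced {e : G.E} (h : G.IsNegLoop e) : G.IsUnbalancedCircuit {e} := by
  obtain ⟨h1, x, hx⟩ := h
  exact unbalanced_iff.2 ⟨isCircuit_loop hx, by rw [par_singleton, h1]⟩

/-- The coverage obtained along a walk `R` ending at the negative loop `ℓ` and starting at the end
of a tail `P` of an unbalanced circuit `O`. -/
structure TrailCover (J O P : Finset G.E) (R : List G.E) (ℓ : G.E)
    (F : Multiset (Finset G.E)) : Prop where
  signed : ∀ S ∈ F, G.IsSignedCircuit S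
  base : ∀ e, e ∈ O ∨ e = ℓ → G.coverCount F e = ind (e ∈ O) + ind (e = ℓ)
  trail : ∀ e ∉ J, e ∈ P ∨ e ∈ R → 1 ≤ G.coverCount F e ∧ G.coverCount F e ≤ 2
  loops : ∀ e ∈ R, G.IsNegLoop e → G.coverCount F e = 2
  doubled : ∀ e ∈ J, G.coverCount F e ≤ ind (e ∈ P) + R.count e
  rest : ∀ e, e ∉ O → e ≠ ℓ → e ∉ P → e ∉ R → G.coverCount F e = 0

theorem count_cons_ind (e : G.E) (R : List G.E) (x : G.E) :
    (e :: R).count x = R.count x + ind (x = e) := by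
  rw [List.count_cons, ind_eq]
  by_cases h : x = e
  · subst h; simp
  · simp [h, Ne.symm h]

theorem ind_insert {e : G.E} {P : Finset G.E} (h : e ∉ P) (x : G.E) :
    ind (x ∈ insert e P) = ind (x = e) + ind (x ∈ P) := by
  rw [Finset.insert_eq, ind_union (by simpa using h)]
  simp

/-- An unbalanced circuit `O` with a tail `P` from `p` to `v`, followed by a walk `R` ending at a
negative loop `ℓ` with vertex `r`. -/
structure TrailData (J : Finset G.E) (ℓ : G.E) (r : G.V) (O P : Finset G.E) (p v : G.V)
    (R : List G.E) : Prop where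
  hℓ : G.ends ℓ = s(r, r)
  hℓn : G.sgn ℓ = 1
  hℓJ : ℓ ∉ J
  hO : G.IsUnbalancedCircuit O
  hp : p ∈ G.support O
  hPa : G.Acyc P
  hPb : G.bd P = G.pt v + G.pt p
  hPO : ∀ x ∈ G.support P, x ∈ G.support O → x = p
  hR : G.IsWalk v R r
  hcount : ∀ e, ind (e ∈ O) + ind (e ∈ P) + R.count e ≤ 1 + ind (e ∈ J)
  hJ : ∀ C, (∀ e ∈ C, e ∈ O ∨ e ∈ P ∨ e ∈ R) → G.IsCircuit C → ∀ e ∈ C, e ∉ J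
  hℓP : ℓ ∉ P
  hℓR : ℓ ∉ R
  hcond : ℓ ∈ O → G.par P + (R.map G.sgn).sum = 1 ∨ ∃ e ∈ R, G.IsNegLoop e

namespace TrailData

variable {J : Finset G.E} {ℓ : G.E} {r : G.V} {O P : Finset G.E} {p v : G.V} {R : List G.E}
  {e : G.E} {w : G.V}

theorem not_mem_J (h : TrailData J ℓ r O P p v R) : ∀ x ∈ O, x ∉ J :=
  h.hJ O (fun _ he => Or.inl he) h.hO.1

theorem loop_not_mem_J (h : TrailData J ℓ r O P p v R) : ∀ x ∈ R, G.IsNegLoop x → x ∉ J := by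
  intro x hx hl
  exact h.hJ {x} (fun y hy => by simp at hy; simp [hy, hx]) hl.unbalanced.1 x (by simp)

theorem of_loop_mem (h : TrailData J ℓ r O P p v R) (hmem : ℓ ∈ O) : p = r := by
  have hp := h.hp
  rw [h.hO.1.loop_eq hmem h.hℓ, support_singleton h.hℓ] at hp
  simpa using hp

theorem once (h : TrailData J ℓ r O P p v R) {x : G.E} (hx : x ∉ J) :
    ind (x ∈ O) + ind (x ∈ P) + R.count x ≤ 1 := by
  have := h.hcount x; rwa [ind_false hx] at this

theorem of_mem_O (h : TrailData J ℓ r O P p v R) {x : G.E} (hx : x ∈ O) : x ∉ P ∧ x ∉ R := by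
  have h1 := h.once (h.not_mem_J x hx)
  rw [ind_true hx] at h1
  refine ⟨fun h => ?_, fun h => ?_⟩
  · rw [ind_true h] at h1; omega
  · have := List.count_pos_iff.2 h; omega

theorem nil (h : TrailData J ℓ r O P p v []) : ∃ F, TrailCover J O P [] ℓ F := by
  have hR := h.hR
  simp only [IsWalk] at hR; subst hR
  have hℓ := h.hℓ
  have hℓO : ℓ ∉ O := by
    intro hmem
    have := h.of_loop_mem hmem
    subst this
    have := h.hcond hmem
    rw [h.hPa.eq_empty h.hPb] at this
    simp [par] at this
  have hvO : v ∈ G.support O → v = p := by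
    intro hv
    by_contra hne
    exact hne (h.hPO v (h.hPa.isPath h.hPb hne).left_mem hv)
  have hS := isSignedCircuit_of_path h.hO (IsNegLoop.unbalanced ⟨h.hℓn, v, hℓ⟩)
    (by simpa using hℓO) h.hp (v := v) (by simp [support_singleton hℓ]) h.hPa h.hPb h.hPO
    (fun x _ h => by simpa [support_singleton hℓ] using h) (fun x hx h => by
      have : x = v := by simpa [support_singleton hℓ] using h
      subst this; exact ⟨hvO hx, rfl⟩)
  have hmem : ∀ e, G.coverCount {O ∪ {ℓ} ∪ P} e = ind (e ∈ O ∪ {ℓ} ∪ P) :=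
    fun e => coverCount_singleton _ e
  refine ⟨{O ∪ {ℓ} ∪ P}, by simpa using hS, fun e he => ?_, fun e heJ he => ?_, by simp,
    fun e he => ?_, fun e h1 h2 h3 _ => ?_⟩ <;> rw [hmem]
  · rw [ind_true (by rcases he with h | h <;> simp [h])]
    rcases he with he | rfl
    · rw [ind_true he, ind_false (by rintro rfl; exact hℓO he)]
    · rw [ind_false hℓO, ind_true rfl]
  · rw [ind_true (by rcases he with h | h <;> simp_all)]; omega
  · by_cases heP : e ∈ P
    · rw [ind_true heP]; exact (ind_le_one _).trans (by omega)
    · rw [ind_false]; · omega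
      intro hm
      simp only [Finset.mem_union, Finset.mem_singleton] at hm
      rcases hm with (hm | rfl) | hm
      · exact h.not_mem_J e hm he
      · exact h.hℓJ he
      · exact heP hm
  · rw [ind_false (by simp [h1, h2, h3])]

theorem fresh (h : TrailData J ℓ r O P p v (e :: R)) (he : G.ends e = s(v, w))
    (hwP : w ∉ G.support P) (hwv : w ≠ v) (hwp : w ≠ p) : e ∉ P ∧ ¬ G.IsNegLoop e ∧
      G.IsPath (insert e P) w p ∧
      ∀ x ∈ G.support (insert e P), x ∈ G.support O → x = p ∨ x = w := by
  have heP : e ∉ P := fun h => hwP (mem_support.2 ⟨e, h, by simp [he]⟩)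
  have he' : G.ends e = s(w, v) := by rw [he, Sym2.eq_swap]
  refine ⟨heP, ?_, ?_, ?_⟩
  · rintro ⟨_, y, hy⟩
    rw [he] at hy
    rcases Sym2.eq_iff.1 hy with ⟨h1, h2⟩ | ⟨h1, h2⟩ <;> exact hwv (h2.trans h1.symm)
  · by_cases hvp : v = p
    · subst hvp
      rw [h.hPa.eq_empty h.hPb]
      exact isPath_singleton he' hwv
    · exact (h.hPa.isPath h.hPb hvp).cons he' hwP
  · intro x hx hxO
    rw [support_insert he] at hx
    simp only [Finset.mem_union, Finset.mem_insert, Finset.mem_singleton] at hx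
    rcases hx with (rfl | rfl) | hx
    · left
      by_contra hne
      exact hne (h.hPO x (h.hPa.isPath h.hPb hne).left_mem hxO)
    · exact Or.inr rfl
    · exact Or.inl (h.hPO x hx hxO)

theorem count' (h : TrailData J ℓ r O P p v (e :: R)) (x : G.E) :
    ind (x ∈ O) + ind (x ∈ P) + R.count x + ind (x = e) ≤ 1 + ind (x ∈ J) := by
  have := h.hcount x; rw [count_cons_ind] at this; omega

/-- The walk leaves to a new vertex. -/
theorem extend (h : TrailData J ℓ r O P p v (e :: R)) (he : G.ends e = s(v, w))
    (hR : G.IsWalk w R r) (hwP : w ∉ G.support P) (hwv : w ≠ v) (hwO : w ∉ G.support O) :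
    TrailData J ℓ r O (insert e P) p w R ∧
      ∀ F, TrailCover J O (insert e P) R ℓ F → TrailCover J O P (e :: R) ℓ F := by
  have hwp : w ≠ p := fun h' => hwO (h' ▸ h.hp)
  obtain ⟨heP, heloop, hP2, hP2s⟩ := h.fresh he hwP hwv hwp
  have hloop : ∀ x ∈ e :: R, G.IsNegLoop x → x ∈ R := by
    intro x hx hl
    rcases List.mem_cons.1 hx with rfl | hx
    · exact absurd hl heloop
    · exact hx
  refine ⟨⟨h.hℓ, h.hℓn, h.hℓJ, h.hO, h.hp, hP2.acyc, hP2.bd, ?_, hR, ?_, ?_, ?_, ?_, ?_⟩,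
    fun F hF => ⟨hF.signed, hF.base, fun x hx h => ?_,
      fun x hx hl => hF.loops x (hloop x hx hl) hl, fun x hx => ?_, fun x h1 h2 h3 h4 => ?_⟩⟩
  · exact fun x hx hxO => (hP2s x hx hxO).resolve_right (fun h => hwO (h ▸ hxO))
  · intro x
    rw [ind_insert heP]; have := h.count' x; omega
  · intro C hC
    refine h.hJ C fun x hx => ?_
    have := hC x hx; simp only [Finset.mem_insert, List.mem_cons] at this ⊢; tauto
  · have := h.hℓR; have := h.hℓP; simp_all
  · have := h.hℓR; simp_all
  · intro hm
    refine (h.hcond hm).imp (fun h => ?_) (fun ⟨x, hx, hl⟩ => ⟨x, hloop x hx hl, hl⟩)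
    rw [par_insert heP, ← h, List.map_cons, List.sum_cons]; ring
  · refine hF.trail x hx ?_
    simp only [Finset.mem_insert, List.mem_cons] at h ⊢; tauto
  · rw [count_cons_ind]
    have := hF.doubled x hx
    rw [ind_insert heP] at this; omega
  · simp only [List.mem_cons] at h4
    refine hF.rest x h1 h2 ?_ ?_
    · simp only [Finset.mem_insert]; tauto
    · tauto

/-- The walk retraces the last edge of the tail. -/
theorem retrace (h : TrailData J ℓ r O P p v (e :: R)) (he : G.ends e = s(v, w))
    (hR : G.IsWalk w R r) (heP : e ∈ P) :
    TrailData J ℓ r O (P.erase e) p w R ∧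
      ∀ F, TrailCover J O (P.erase e) R ℓ F → TrailCover J O P (e :: R) ℓ F := by
  have hsub : P.erase e ⊆ P := Finset.erase_subset _ _
  have hins := Finset.insert_erase heP
  have hne := Finset.notMem_erase e P
  have hind : ∀ x, ind (x ∈ P) = ind (x = e) + ind (x ∈ P.erase e) := by
    intro x; rw [← ind_insert hne, hins]
  have heJ : e ∈ J := by
    by_contra hJ
    have := h.count' e
    rw [ind_true heP, ind_true rfl, ind_false hJ] at this; omega
  have heloop : ¬ G.IsNegLoop e := fun hl => h.loop_not_mem_J e (by simp) hl heJ
  have hloop : ∀ x ∈ e :: R, G.IsNegLoop x → x ∈ R := by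
    intro x hx hl
    rcases List.mem_cons.1 hx with rfl | hx
    · exact absurd hl heloop
    · exact hx
  refine ⟨⟨h.hℓ, h.hℓn, h.hℓJ, h.hO, h.hp, h.hPa.mono hsub, ?_, ?_, hR, ?_, ?_,
      fun hm => h.hℓP (hsub hm), ?_, ?_⟩,
      fun F hF => ⟨hF.signed, hF.base, fun x hx h => ?_,
      fun x hx hl => hF.loops x (hloop x hx hl) hl, fun x hx => ?_, fun x h1 h2 h3 h4 => ?_⟩⟩
  · have h1 := bd_insert hne he
    rw [hins, h.hPb] at h1
    calc G.bd (P.erase e) = (G.pt v + G.pt w + G.bd (P.erase e)) + (G.pt v + G.pt w) := by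
          rw [add_right_comm, pi_add_self, zero_add]
      _ = G.pt w + G.pt p + (G.pt v + G.pt v) := by rw [← h1]; abel
      _ = _ := by rw [pi_add_self, add_zero]
  · exact fun x hx hxO => h.hPO x (support_mono hsub hx) hxO
  · intro x
    have h1 := hind x; have := h.count' x; omega
  · intro C hC
    refine h.hJ C fun x hx => ?_
    have := hC x hx; simp only [Finset.mem_erase, List.mem_cons] at this ⊢; tauto
  · have := h.hℓR; simp_all
  · intro hm
    refine (h.hcond hm).imp (fun h => ?_) (fun ⟨x, hx, hl⟩ => ⟨x, hloop x hx hl, hl⟩)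
    rw [List.map_cons, List.sum_cons, ← hins, par_insert hne] at h
    rw [← h, add_add_add_comm, CharTwo.add_self_eq_zero, zero_add]
  · refine hF.trail x hx ?_
    have : x ≠ e := by rintro rfl; exact hx heJ
    simp only [Finset.mem_erase, List.mem_cons] at h ⊢; tauto
  · rw [count_cons_ind, hind]
    have := hF.doubled x hx
    omega
  · simp only [List.mem_cons] at h4
    refine hF.rest x h1 h2 (fun hm => h3 (hsub hm)) ?_
    tauto

/-- The walk hits the circuit `O` away from the foot of the tail. -/
theorem reroute (h : TrailData J ℓ r O P p v (e :: R)) (he : G.ends e = s(v, w))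
    (hR : G.IsWalk w R r) (hwP : w ∉ G.support P) (hwv : w ≠ v) (hwO : w ∈ G.support O)
    (hwp : w ≠ p) :
    ∃ O' Z, TrailData J ℓ r O' ∅ w w R ∧
      ∀ F, TrailCover J O' ∅ R ℓ F → TrailCover J O P (e :: R) ℓ (Z ::ₘ F) := by
  obtain ⟨heP, heloop, hP2, hP2s⟩ := h.fresh he hwP hwv hwp
  have hloop : ∀ x ∈ e :: R, G.IsNegLoop x → x ∈ R := by
    intro x hx hl
    rcases List.mem_cons.1 hx with rfl | hx
    · exact absurd hl heloop
    · exact hx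
  have hdis : Disjoint (insert e P) O := by
    rw [Finset.disjoint_right]
    intro x hx hm
    obtain ⟨h1, h2⟩ := h.of_mem_O hx
    simp only [Finset.mem_insert, List.mem_cons] at hm h2
    tauto
  have hℓO : ℓ ∉ O := by
    intro hmem
    have h1 := h.hO.1.loop_eq hmem h.hℓ
    have h2 := h.of_loop_mem hmem
    rw [h1, support_singleton h.hℓ] at hwO
    exact hwp (by rw [h2]; simpa using hwO)
  have hℓP2 : ℓ ∉ insert e P := by
    have := h.hℓP; have := h.hℓR
    simp only [Finset.mem_insert, List.mem_cons] at *; tauto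
  obtain ⟨β, hβ, hβc, hβo⟩ : ∃ β ⊆ O, (G.IsCircuit (insert e P ∪ β) ∧ G.par (insert e P ∪ β) = 0) ∧
      G.IsCircuit (insert e P ∪ (O \ β)) ∧ G.par (insert e P ∪ (O \ β)) = 1 := by
    obtain ⟨hOc, hOp⟩ := unbalanced_iff.1 h.hO
    obtain ⟨A, hA, hA1, hA2, -⟩ := hOc.split hwO h.hp hwp
    have key : ∀ B ⊆ O, G.IsPath B w p → G.IsCircuit (insert e P ∪ B) ∧
        G.par (insert e P ∪ B) = G.par (insert e P) + G.par B := by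
      intro B hB hBp
      have hd : Disjoint (insert e P) B := hdis.mono_right hB
      refine ⟨hP2.join hBp.symm.symm hd fun x hx => ?_, par_union hd⟩
      rw [Finset.mem_inter] at hx
      have := hP2s x hx.1 (support_mono hB hx.2)
      simp only [Finset.mem_insert, Finset.mem_singleton]; tauto
    obtain ⟨k1, k2⟩ := key A hA hA1
    obtain ⟨k3, k4⟩ := key (O \ A) Finset.sdiff_subset hA2
    rw [par_sdiff hA, hOp] at k4
    rcases zmod_two_cases (G.par (insert e P) + G.par A) with h0 | h0
    · refine ⟨A, hA, ⟨k1, k2.trans h0⟩, k3, k4.trans ?_⟩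
      rw [add_left_comm, h0, add_zero]
    · refine ⟨O \ A, Finset.sdiff_subset, ⟨k3, k4.trans ?_⟩, ?_⟩
      · rw [add_left_comm, h0]; decide
      · rw [Finset.sdiff_sdiff_eq_self hA]; exact ⟨k1, k2.trans h0⟩
  have hsubc : ∀ x, x ∈ insert e P ∪ (O \ β) → x ∈ O ∨ x ∈ P ∨ x ∈ e :: R := by
    intro x hx
    simp only [Finset.mem_union, Finset.mem_insert, Finset.mem_sdiff, List.mem_cons] at hx ⊢
    tauto
  have hO'J : ∀ x ∈ insert e P ∪ (O \ β), x ∉ J := h.hJ _ hsubc hβo.1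
  have hdis' : Disjoint (insert e P) (O \ β) := hdis.mono_right Finset.sdiff_subset
  have hRO : ∀ x, x ∈ R → x ∉ O := fun x hx hm => (h.of_mem_O hm).2 (by simp [hx])
  have hRP : ∀ x, x ∉ J → x ∈ R → x ∉ insert e P := by
    intro x hxJ hx hm
    have := h.count' x
    have hc := List.count_pos_iff.2 hx
    rw [ind_false hxJ] at this
    rcases Finset.mem_insert.1 hm with hm | hm <;> rw [ind_true hm] at this <;> omega
  have hdisj : ∀ x, x ∈ O → x ∉ insert e P := fun x hx => Finset.disjoint_right.1 hdis hx
  refine ⟨insert e P ∪ (O \ β), insert e P ∪ β,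
    ⟨h.hℓ, h.hℓn, h.hℓJ, unbalanced_iff.2 hβo, ?_, acyc_empty, ?_, by simp, hR, ?_, ?_,
      by simp, fun hm => h.hℓR (by simp [hm]), ?_⟩,
      fun F hF => ⟨?_, fun x hx => ?_, fun x hx hm => ?_,
      fun x hx hl => ?_, fun x hx => ?_, fun x h1 h2 h3 h4 => ?_⟩⟩
  · rw [support_union]; exact Finset.mem_union_left _ hP2.left_mem
  · rw [pi_add_self, bd_empty]
  · intro x
    rw [ind_union hdis', ind_insert heP]
    have h1 := h.count' x
    have h2 := ind_le_of_subset (Finset.sdiff_subset (s := O) (t := β)) x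
    rw [ind_false (p := x ∈ (∅ : Finset G.E)) (by simp)]
    omega
  · intro C hC
    refine h.hJ C fun x hx => ?_
    rcases hC x hx with hm | hm | hm
    · exact hsubc x hm
    · simp at hm
    · exact Or.inr (Or.inr (by simp [hm]))
  · intro hm
    exfalso
    rcases Finset.mem_union.1 hm with hm | hm
    · exact hℓP2 hm
    · exact hℓO (Finset.mem_sdiff.1 hm).1
  · intro S hS
    rcases Multiset.mem_cons.1 hS with rfl | hS
    · exact Or.inl (balanced_iff.2 hβc)
    · exact hF.signed S hS
  · rw [coverCount_cons']
    by_cases hxβ : x ∈ β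
    · have hxO := hβ hxβ
      have hxℓ : x ≠ ℓ := by rintro rfl; exact hℓO hxO
      rw [hF.rest x (by simp only [Finset.mem_union, Finset.mem_sdiff]
                        have := hdisj x hxO; tauto) hxℓ (by simp) (fun hm => hRO x hm hxO),
        ind_true (by simp [hxβ]), ind_true hxO, ind_false hxℓ]
    · have hxP : x ∉ insert e P := by
        rcases hx with hx | rfl
        · exact hdisj x hx
        · exact hℓP2
      have : x ∈ insert e P ∪ (O \ β) ↔ x ∈ O := by
        simp only [Finset.mem_union, Finset.mem_sdiff]; tauto
      rw [hF.base x (by rw [this]; exact hx), this, ind_false (p := x ∈ insert e P ∪ β)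
        (by simp only [Finset.mem_union]; tauto), zero_add]
  · rw [coverCount_cons']
    by_cases hxP : x ∈ insert e P
    · have hxℓ : x ≠ ℓ := by rintro rfl; exact hℓP2 hxP
      rw [hF.base x (Or.inl (Finset.mem_union_left _ hxP)),
        ind_true (Finset.mem_union_left _ hxP), ind_false hxℓ,
        ind_true (Finset.mem_union_left _ hxP)]
      omega
    · have hxR : x ∈ R := by
        simp only [Finset.mem_insert, List.mem_cons] at hxP hm; tauto
      have := hF.trail x hx (Or.inr hxR)
      rw [ind_false (by simp only [Finset.mem_union, not_or]
                        exact ⟨hxP, fun hm => hRO x hxR (hβ hm)⟩)]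
      omega
  · have hxR := hloop x hx hl
    have hxJ := h.loop_not_mem_J x hx hl
    rw [coverCount_cons', hF.loops x hxR hl,
      ind_false (by simp only [Finset.mem_union, not_or]
                    exact ⟨hRP x hxJ hxR, fun hm => hRO x hxR (hβ hm)⟩)]
  · have hxZ : x ∉ insert e P ∪ β := by
      simp only [Finset.mem_union, not_or]
      exact ⟨fun hm => hO'J x (Finset.mem_union_left _ hm) hx,
        fun hm => h.not_mem_J x (hβ hm) hx⟩
    have := hF.doubled x hx
    rw [ind_false (p := x ∈ (∅ : Finset G.E)) (by simp)] at this
    rw [coverCount_cons', ind_false hxZ, count_cons_ind]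
    omega
  · simp only [List.mem_cons] at h4
    have h5 : x ∉ insert e P := by simp only [Finset.mem_insert]; tauto
    rw [coverCount_cons', hF.rest x (by simp only [Finset.mem_union, Finset.mem_sdiff]; tauto) h2
      (by simp) (by tauto), ind_false]
    simp only [Finset.mem_union, not_or]
    exact ⟨h5, fun hm => h1 (hβ hm)⟩

/-- The walk closes an ear `Z` on the tail. -/
theorem exists_ear (h : TrailData J ℓ r O P p v (e :: R)) (he : G.ends e = s(v, w))
    (heP : e ∉ P) (hw : w = v ∨ w ∈ G.support P) :
    ∃ Z P₁, G.IsCircuit Z ∧ e ∈ Z ∧ w ∈ G.support Z ∧ P₁ ⊆ P ∧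
      G.bd P₁ = G.pt w + G.pt p ∧ G.par Z + G.par P₁ = G.sgn e + G.par P ∧
      (∀ x, ind (x ∈ Z) + ind (x ∈ P₁) = ind (x = e) + ind (x ∈ P)) ∧
      (∀ x ∈ G.support P₁, x ∈ G.support Z → x = w) ∧
      ∀ x ∈ G.support Z, x ∈ G.support O → (w ∈ G.support O → w = p) → x = p ∧ x = w := by
  obtain ⟨A, hA, hAb, hA1⟩ := h.hPa.split h.hPb hw
  have heA : e ∉ A := fun hm => heP (hA hm)
  have hP₁ : G.bd (P \ A) = G.pt w + G.pt p := by
    rw [bd_sdiff hA, h.hPb, hAb]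
    calc _ = G.pt w + G.pt p + (G.pt v + G.pt v) := by abel
      _ = _ := by rw [pi_add_self, add_zero]
  have hvA : v = w ∨ v ∈ G.support A := by
    by_cases hvw : v = w
    · exact Or.inl hvw
    · exact Or.inr ((h.hPa.mono hA).isPath hAb hvw).left_mem
  refine ⟨insert e A, P \ A, (h.hPa.mono hA).circuit hAb he heA, by simp,
    by simp [support_insert he], Finset.sdiff_subset, hP₁, ?_, fun x => ?_, ?_, ?_⟩
  · rw [par_insert heA, par_sdiff hA]
    calc _ = G.sgn e + G.par P + (G.par A + G.par A) := by ring
      _ = _ := by rw [CharTwo.add_self_eq_zero, add_zero]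
  · rw [ind_insert heA, add_assoc, ← ind_union Finset.disjoint_sdiff,
      Finset.union_sdiff_of_subset hA]
  · intro x hx hxZ
    rw [support_insert he] at hxZ
    simp only [Finset.mem_union, Finset.mem_insert, Finset.mem_singleton] at hxZ
    rcases hxZ with (rfl | rfl) | hxZ
    · rcases hvA with hv | hv
      · exact hv
      · exact hA1 x hv hx
    · rfl
    · exact hA1 x hxZ hx
  · intro x hxZ hxO hwO
    have hpv : ∀ x ∈ G.support A, x ∈ G.support O → x = p ∧ x = w := by
      intro x hx hxO
      have hxp := h.hPO x (support_mono hA hx) hxO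
      subst hxp
      refine ⟨rfl, ?_⟩
      by_contra hne
      exact hne (hA1 x hx ((h.hPa.mono Finset.sdiff_subset).isPath hP₁ (Ne.symm hne)).right_mem)
    rw [support_insert he] at hxZ
    simp only [Finset.mem_union, Finset.mem_insert, Finset.mem_singleton] at hxZ
    rcases hxZ with (rfl | rfl) | hxZ
    · rcases hvA with hv | hv
      · subst hv; exact ⟨hwO hxO, rfl⟩
      · exact hpv x hv hxO
    · exact ⟨hwO hxO, rfl⟩
    · exact hpv x hxZ hxO

theorem ear_even (h : TrailData J ℓ r O P p v (e :: R)) (hR : G.IsWalk w R r)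
    {Z P₁ : Finset G.E} (hZ : G.IsBalancedCircuit Z)
    (hP₁ : P₁ ⊆ P) (hb : G.bd P₁ = G.pt w + G.pt p)
    (hpar : G.par Z + G.par P₁ = G.sgn e + G.par P)
    (hind : ∀ x, ind (x ∈ Z) + ind (x ∈ P₁) = ind (x = e) + ind (x ∈ P)) :
    TrailData J ℓ r O P₁ p w R ∧
      ∀ F, TrailCover J O P₁ R ℓ F → TrailCover J O P (e :: R) ℓ (Z ::ₘ F) := by
  obtain ⟨hZc, hZp⟩ := balanced_iff.1 hZ
  have hsub : ∀ x, x ∈ Z → x = e ∨ x ∈ P := by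
    intro x hx
    have := hind x
    rw [ind_true hx] at this
    by_contra hc
    rw [not_or] at hc
    rw [ind_false hc.1, ind_false hc.2] at this
    omega
  have hZJ : ∀ x ∈ Z, x ∉ J := h.hJ Z (fun x hx => by
    have := hsub x hx; simp only [List.mem_cons]; tauto) hZc
  have hℓZ : ℓ ∉ Z := by
    intro hm; have := h.hℓP; have := h.hℓR; have := hsub ℓ hm
    simp only [List.mem_cons] at *; tauto
  have hloop : ∀ x ∈ e :: R, G.IsNegLoop x → x ∈ R ∧ x ∉ Z := by
    intro x hx hl
    have hxZ : x ∉ Z := by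
      intro hm
      obtain ⟨hs, y, hy⟩ := hl
      rw [hZc.loop_eq hm hy, par_singleton, hs] at hZp
      exact one_ne_zero hZp
    refine ⟨?_, hxZ⟩
    by_contra hxR
    have hxe : x = e := by simp only [List.mem_cons] at hx; tauto
    have h1 := hind x
    have h2 := h.count' x
    rw [ind_false hxZ] at h1
    rw [ind_true hxe] at h1 h2
    rw [ind_false (h.loop_not_mem_J x hx hl)] at h2
    have h3 : x ∈ P := hP₁ (ind_pos.1 (by omega))
    rw [ind_true h3] at h2
    omega
  have hcnt : ∀ x, ind (x ∈ O) + ind (x ∈ P₁) + R.count x + ind (x ∈ Z) ≤ 1 + ind (x ∈ J) := by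
    intro x; have := h.count' x; have := hind x; omega
  have hZx : ∀ x ∈ Z, x ∉ O ∧ x ∉ P₁ ∧ x ∉ R := by
    intro x hx
    have h1 := hcnt x
    rw [ind_true hx, ind_false (hZJ x hx)] at h1
    refine ⟨fun h => ?_, fun h => ?_, fun h => ?_⟩
    · rw [ind_true h] at h1; omega
    · rw [ind_true h] at h1; omega
    · have := List.count_pos_iff.2 h; omega
  refine ⟨⟨h.hℓ, h.hℓn, h.hℓJ, h.hO, h.hp, h.hPa.mono hP₁, hb,
    fun x hx => h.hPO x (support_mono hP₁ hx), hR, fun x => by have := hcnt x; omega, fun C hC =>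
    h.hJ C fun x hx => ?_, fun hm => h.hℓP (hP₁ hm), fun hm => h.hℓR (by simp [hm]), fun hm => ?_⟩,
    fun F hF => ⟨?_, fun x hx => ?_, fun x hx hm => ?_,
      fun x hx hl => ?_, fun x hx => ?_, fun x h1 h2 h3 h4 => ?_⟩⟩
  · rcases hC x hx with hm | hm | hm
    · exact Or.inl hm
    · exact Or.inr (Or.inl (hP₁ hm))
    · exact Or.inr (Or.inr (by simp [hm]))
  · refine (h.hcond hm).imp (fun h => ?_) (fun ⟨x, hx, hl⟩ => ⟨x, (hloop x hx hl).1, hl⟩)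
    rw [hZp, zero_add] at hpar
    rw [hpar, ← h, List.map_cons, List.sum_cons]; ring
  · intro S hS
    rcases Multiset.mem_cons.1 hS with rfl | hS
    · exact Or.inl hZ
    · exact hF.signed S hS
  · rw [coverCount_cons', hF.base x hx, ind_false, zero_add]
    rcases hx with hx | rfl
    · exact fun hm => (hZx x hm).1 hx
    · exact hℓZ
  · rw [coverCount_cons']
    by_cases hxZ : x ∈ Z
    · obtain ⟨k1, k2, k3⟩ := hZx x hxZ
      rw [hF.rest x k1 (by rintro rfl; exact hℓZ hxZ) k2 k3, ind_true hxZ]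
      omega
    · have h1 := hind x
      rw [ind_false hxZ] at h1
      rw [ind_false hxZ, zero_add]
      refine hF.trail x hx ?_
      by_cases hxR : x ∈ R
      · exact Or.inr hxR
      · left
        apply ind_pos.1
        simp only [List.mem_cons] at hm
        rcases hm with hm | hm | hm
        · rw [ind_true hm] at h1; omega
        · rw [ind_true hm] at h1; omega
        · exact absurd hm hxR
  · obtain ⟨k1, k2⟩ := hloop x hx hl
    rw [coverCount_cons', ind_false k2, hF.loops x k1 hl]
  · have := hF.doubled x hx
    rw [coverCount_cons', ind_false (fun hm => hZJ x hm hx), count_cons_ind]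
    have := ind_le_of_subset hP₁ x
    omega
  · simp only [List.mem_cons, not_or] at h4
    have h5 : x ∉ Z := fun hm => by have := hsub x hm; tauto
    rw [coverCount_cons', ind_false h5, hF.rest x h1 h2 (fun hm => h3 (hP₁ hm)) h4.2]

theorem ear_odd (h : TrailData J ℓ r O P p v (e :: R)) (hR : G.IsWalk w R r)
    {Z P₁ : Finset G.E} (hZ : G.IsUnbalancedCircuit Z) (heZ : e ∈ Z) (hwZ : w ∈ G.support Z)
    (hP₁ : P₁ ⊆ P) (hb : G.bd P₁ = G.pt w + G.pt p)
    (hind : ∀ x, ind (x ∈ Z) + ind (x ∈ P₁) = ind (x = e) + ind (x ∈ P))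
    (hPZ : ∀ x ∈ G.support P₁, x ∈ G.support Z → x = w)
    (hZO : ∀ x ∈ G.support Z, x ∈ G.support O → x = p ∧ x = w) :
    TrailData J ℓ r Z ∅ w w R ∧
      ∀ F, TrailCover J Z ∅ R ℓ F → TrailCover J O P (e :: R) ℓ ((O ∪ Z ∪ P₁) ::ₘ F) := by
  have hsub : ∀ x, x ∈ Z → x = e ∨ x ∈ P := by
    intro x hx
    have := hind x
    rw [ind_true hx] at this
    by_contra hc
    rw [not_or] at hc
    rw [ind_false hc.1, ind_false hc.2] at this
    omega
  have hZJ : ∀ x ∈ Z, x ∉ J := h.hJ Z (fun x hx => by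
    have := hsub x hx; simp only [List.mem_cons]; tauto) hZ.1
  have hℓZ : ℓ ∉ Z := by
    intro hm; have := h.hℓP; have := h.hℓR; have := hsub ℓ hm
    simp only [List.mem_cons] at *; tauto
  have hcnt : ∀ x, ind (x ∈ O) + ind (x ∈ P₁) + R.count x + ind (x ∈ Z) ≤ 1 + ind (x ∈ J) := by
    intro x; have := h.count' x; have := hind x; omega
  have hZx : ∀ x ∈ Z, x ∉ O ∧ x ∉ P₁ ∧ x ∉ R := by
    intro x hx
    have h1 := hcnt x
    rw [ind_true hx, ind_false (hZJ x hx)] at h1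
    refine ⟨fun h => ?_, fun h => ?_, fun h => ?_⟩
    · rw [ind_true h] at h1; omega
    · rw [ind_true h] at h1; omega
    · have := List.count_pos_iff.2 h; omega
  have hS : G.IsSignedCircuit (O ∪ Z ∪ P₁) := by
    refine isSignedCircuit_of_path h.hO hZ ?_ h.hp hwZ (h.hPa.mono hP₁) hb
      (fun x hx => h.hPO x (support_mono hP₁ hx)) hPZ (fun x hx hx' => hZO x hx' hx)
    rw [Finset.disjoint_right]
    exact fun x hx => (hZx x hx).1
  have hSO : ∀ x ∈ O, x ∉ Z ∧ x ∉ P₁ ∧ x ∉ R := by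
    intro x hx
    obtain ⟨k1, k2⟩ := h.of_mem_O hx
    simp only [List.mem_cons] at k2
    exact ⟨fun hm => (hZx x hm).1 hx, fun hm => k1 (hP₁ hm), by tauto⟩
  have hSind : ∀ x, ind (x ∈ O ∪ Z ∪ P₁) = ind (x ∈ O) + ind (x ∈ Z) + ind (x ∈ P₁) := by
    intro x
    have h1 := hSO x
    have h2 := hZx x
    rw [ind_union, ind_union]
    · rw [Finset.disjoint_left]; exact fun y hy => (hSO y hy).1
    · rw [Finset.disjoint_left]
      intro y hy
      rcases Finset.mem_union.1 hy with hy | hy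
      · exact (hSO y hy).2.1
      · exact (hZx y hy).2.1
  have hP1R : ∀ x ∉ J, x ∈ R → x ∉ O ∧ x ∉ P₁ := by
    intro x hx hxR
    have h1 := hcnt x
    have h2 := List.count_pos_iff.2 hxR
    rw [ind_false hx] at h1
    exact ⟨fun h => by rw [ind_true h] at h1; omega, fun h => by rw [ind_true h] at h1; omega⟩
  have hℓP₁ : ℓ ∉ P₁ := fun hm => h.hℓP (hP₁ hm)
  have h0 : ∀ x, ind (x ∈ (∅ : Finset G.E)) = 0 := fun x => ind_false (by simp)
  refine ⟨⟨h.hℓ, h.hℓn, h.hℓJ, hZ, hwZ, acyc_empty, by rw [pi_add_self, bd_empty], by simp, hR,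
    fun x => by have := hcnt x; rw [h0]; omega, fun C hC =>
    h.hJ C fun x hx => ?_, by simp, fun hm => h.hℓR (by simp [hm]), fun hm => absurd hm hℓZ⟩,
    fun F hF => ⟨?_, fun x hx => ?_, fun x hx hm => ?_,
      fun x hx hl => ?_, fun x hx => ?_, fun x h1 h2 h3 h4 => ?_⟩⟩
  · rcases hC x hx with hm | hm | hm
    · have := hsub x hm
      simp only [List.mem_cons]; tauto
    · simp at hm
    · exact Or.inr (Or.inr (by simp [hm]))
  · intro S hS'
    rcases Multiset.mem_cons.1 hS' with rfl | hS'
    · exact hS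
    · exact hF.signed S hS'
  · rw [coverCount_cons', hSind]
    by_cases hxℓ : x = ℓ
    · subst hxℓ
      rw [hF.base x (Or.inr rfl), ind_false hℓZ, ind_false hℓP₁]; omega
    · have hxO := hx.resolve_right hxℓ
      obtain ⟨k1, k2, k3⟩ := hSO x hxO
      rw [hF.rest x k1 hxℓ (by simp) k3, ind_false k1, ind_false k2, ind_false hxℓ]
  · rw [coverCount_cons', hSind]
    by_cases hxZ : x ∈ Z
    · obtain ⟨k1, k2, k3⟩ := hZx x hxZ
      rw [hF.base x (Or.inl hxZ), ind_false k1, ind_false k2, ind_true hxZ,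
        ind_false (by rintro rfl; exact hℓZ hxZ)]
      omega
    · by_cases hxR : x ∈ R
      · obtain ⟨k1, k2⟩ := hP1R x hx hxR
        have := hF.trail x hx (Or.inr hxR)
        rw [ind_false k1, ind_false k2, ind_false hxZ]; omega
      · have h1 := hind x
        rw [ind_false hxZ] at h1
        have hxP : x ∈ P₁ := by
          apply ind_pos.1
          simp only [List.mem_cons] at hm
          rcases hm with hm | hm | hm
          · rw [ind_true hm] at h1; omega
          · rw [ind_true hm] at h1; omega
          · exact absurd hm hxR
        rw [hF.rest x hxZ (by rintro rfl; exact hℓP₁ hxP) (by simp) hxR, ind_true hxP,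
          ind_false hxZ, ind_false (fun hm => (hSO x hm).2.1 hxP)]
        omega
  · have hxJ := h.loop_not_mem_J x hx hl
    rw [coverCount_cons', hSind]
    rcases List.mem_cons.1 hx with rfl | hxR
    · obtain ⟨k1, k2, k3⟩ := hZx x heZ
      rw [hF.base x (Or.inl heZ), ind_false k1, ind_false k2, ind_true heZ,
        ind_false (by rintro rfl; exact hℓZ heZ)]
    · obtain ⟨k1, k2⟩ := hP1R x hxJ hxR
      rw [hF.loops x hxR hl, ind_false k1, ind_false k2, ind_false (fun hm => (hZx x hm).2.2 hxR)]
  · have := hF.doubled x hx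
    rw [coverCount_cons', hSind, ind_false (fun hm => hZJ x hm hx), count_cons_ind,
      ind_false (fun hm => h.not_mem_J x hm hx)]
    rw [h0] at this
    have := ind_le_of_subset hP₁ x
    omega
  · simp only [List.mem_cons, not_or] at h4
    have h5 : x ∉ Z := fun hm => by have := hsub x hm; tauto
    rw [coverCount_cons', hSind, ind_false h5, hF.rest x h5 h2 (by simp) h4.2, ind_false h1,
      ind_false (fun hm => h3 (hP₁ hm))]

end TrailData

/-- Covering a trail: an unbalanced circuit `O` with a tail `P` attached at `p`, followed by a
walk `R` ending at a negative loop `ℓ`. -/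
theorem exists_trail_cover {J : Finset G.E} {ℓ : G.E} {r : G.V} (R : List G.E) :
    ∀ {O P : Finset G.E} {p v : G.V}, TrailData J ℓ r O P p v R → ∃ F, TrailCover J O P R ℓ F := by
  induction R with
  | nil => exact fun h => h.nil
  | cons e R ih =>
    intro O P p v h
    obtain ⟨w, he, hR⟩ := h.hR
    by_cases heP : e ∈ P
    · obtain ⟨h1, h2⟩ := h.retrace he hR heP
      obtain ⟨F, hF⟩ := ih h1
      exact ⟨F, h2 F hF⟩
    by_cases hwP : w = v ∨ w ∈ G.support P
    · obtain ⟨Z, P₁, hZ, heZ, hwZ, hP₁, hb, hpar, hind, hPZ, hZO⟩ := h.exists_ear he heP hwP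
      rcases zmod_two_cases (G.par Z) with h0 | h0
      · obtain ⟨h1, h2⟩ := h.ear_even hR (balanced_iff.2 ⟨hZ, h0⟩) hP₁ hb hpar hind
        obtain ⟨F, hF⟩ := ih h1
        exact ⟨_, h2 F hF⟩
      · have hwO : w ∈ G.support O → w = p := by
          intro hwO
          rcases hwP with rfl | hwP
          · by_contra hne
            exact hne (h.hPO w (h.hPa.isPath h.hPb hne).left_mem hwO)
          · exact h.hPO w hwP hwO
        obtain ⟨h1, h2⟩ := h.ear_odd hR (unbalanced_iff.2 ⟨hZ, h0⟩) heZ hwZ hP₁ hb hind hPZ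
          (fun x hx hxO => hZO x hx hxO hwO)
        obtain ⟨F, hF⟩ := ih h1
        exact ⟨_, h2 F hF⟩
    · rw [not_or] at hwP
      by_cases hwO : w ∈ G.support O
      · by_cases hwp : w = p
        · exfalso
          subst hwp
          exact hwP.2 (h.hPa.isPath h.hPb (Ne.symm hwP.1)).right_mem
        · obtain ⟨O', Z, h1, h2⟩ := h.reroute he hR hwP.2 hwP.1 hwO hwp
          obtain ⟨F, hF⟩ := ih h1
          exact ⟨_, h2 F hF⟩
      · obtain ⟨h1, h2⟩ := h.extend he hR hwP.2 hwP.1 hwO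
        obtain ⟨F, hF⟩ := ih h1
        exact ⟨F, h2 F hF⟩

end Trail

section Tokens

variable {G : SignedMultigraph}

theorem exists_first_hit {S B : Finset G.E} {z x : G.V} (h : G.Reach S z x) (hx : x ∈ G.support B) :
    ∃ q ∈ G.support B, G.Reach (S \ B) z q := by
  induction h using Relation.ReflTransGen.head_induction_on with
  | refl => exact ⟨x, hx, Reach.refl' _ _⟩
  | @head a c hac _ ih =>
    by_cases ha : a ∈ G.support B
    · exact ⟨a, ha, Reach.refl' _ _⟩
    · obtain ⟨q, hq, hr⟩ := ih
      obtain ⟨e, he, hee⟩ := hac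
      refine ⟨q, hq, (reach_edge (Finset.mem_sdiff.2 ⟨he, fun hB => ha ?_⟩) hee).trans' hr⟩
      exact mem_support.2 ⟨e, hB, by simp [hee]⟩

theorem reach_erase_loop {S : Finset G.E} {ℓ : G.E} {z u v : G.V} (hℓ : G.ends ℓ = s(z, z))
    (h : G.Reach S u v) : G.Reach (S.erase ℓ) u v := by
  induction h with
  | refl => exact Reach.refl' _ _
  | @tail b c _ hbc ih =>
    obtain ⟨e, he, hee⟩ := hbc
    by_cases h : e = ℓ
    · subst h
      rw [hℓ] at hee
      have : b = c := by
        rcases Sym2.eq_iff.1 hee with ⟨h1, h2⟩ | ⟨h1, h2⟩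
        · exact h1.symm.trans h2
        · exact h2.symm.trans h1
      rwa [← this]
    · exact ih.trans' (reach_edge (Finset.mem_erase.2 ⟨h, he⟩) hee)

theorem pairCompat_cons {A : Finset G.E} {τ : Multiset (Finset G.E)}
    (h : ∀ b ∈ τ, G.Compat A b) (hτ : G.PairCompat τ) : G.PairCompat (A ::ₘ τ) := by
  intro a b r hr
  rcases Multiset.cons_eq_cons.1 hr with ⟨rfl, h2⟩ | ⟨h1, c, h2, h3⟩
  · exact h b (by simp [h2])
  · rcases Multiset.cons_eq_cons.1 h3 with ⟨rfl, h5⟩ | ⟨h4, d, h5, h6⟩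
    · exact (h a (by simp [h2])).symm
    · exact hτ a b d (by rw [h2, h6])

theorem compat_loop {ℓ : G.E} {z : G.V} (hℓ : G.ends ℓ = s(z, z)) {C : Finset G.E} (h : ℓ ∉ C) :
    G.Compat {ℓ} C := by
  refine ⟨by simpa using h, (Finset.card_le_card Finset.inter_subset_left).trans ?_⟩
  rw [support_singleton hℓ]; simp

/-- An unbalanced circuit `A` rooted at the base point of a closed walk together with an even
number of unbalanced circuits met by the walk. -/
theorem exists_rooted_pairing {z : G.V} {l : List G.E} (hl : G.IsWalk z l z) {A : Finset G.E}
    (hA : G.IsUnbalancedCircuit A) (hz : z ∈ G.support A) {τ : Multiset (Finset G.E)}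
    (hτ : ∀ a ∈ τ, G.IsUnbalancedCircuit a ∧ ∃ x ∈ G.support a, G.Visits z l x)
    (hc : G.PairCompat (A ::ₘ τ)) (h0 : τ ≠ 0) (hcard : (τ.card : ZMod 2) = 0) :
    ∃ F, (∀ S ∈ F, G.IsSignedCircuit S) ∧
      (∀ e, G.coverCount F e ≤ 2 * ind (e ∈ A) + G.coverCount τ e + l.count e) ∧
      ∀ e, 2 * ind (e ∈ A) + G.coverCount τ e ≤ G.coverCount F e := by
  have hp : G.Pending {A} ∅ z := ⟨by simp, by simp, by
    simpa using ⟨hA, z, hz, Reach.refl' _ _⟩⟩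
  obtain ⟨F, pen, W, hF, hpen, hle, hge, hpar, hor⟩ :=
    exists_pairing l hl τ hτ hp (by rwa [Multiset.singleton_add])
  have hpτ : pen ≤ τ := hor.resolve_right fun h => h0 h.1
  have hp1 : pen.card = 1 := by
    rw [hcard, Multiset.card_singleton, Nat.cast_one, add_zero] at hpar
    have := hpen.1
    interval_cases h : pen.card
    · simp at hpar
    · rfl
  obtain ⟨p, rfl⟩ := Multiset.card_eq_one.1 hp1
  obtain ⟨hpu, x, hx, hr⟩ := hpen.2.2 p (by simp)
  have hcomp : G.Compat A p := by
    obtain ⟨r, hr⟩ := Multiset.le_iff_exists_add.1 hpτ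
    exact hc A p r (by rw [hr, Multiset.singleton_add])
  obtain ⟨S, hS, hS1, hS2, hS3⟩ := exists_barbell hpu hA hcomp.symm hx hz hr
  refine ⟨S ::ₘ F, ?_, fun e => ?_, fun e => ?_⟩
  · intro S' hS'
    rcases Multiset.mem_cons.1 hS' with rfl | hS'
    · exact hS
    · exact hF S' hS'
  · have h1 := hle e
    rw [coverCount_singleton, coverCount_singleton, ind_false (p := e ∈ (∅ : Finset G.E)) (by simp)]
      at h1
    have h2 := ind_le_of_subset hS3 e
    have h3 := ind_union_le (p ∪ A) W e
    have h4 := ind_union_le p A e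
    rw [coverCount_cons']
    omega
  · have h1 := hge e
    rw [coverCount_singleton, coverCount_singleton] at h1
    have h2 := ind_le_of_subset (Finset.union_subset hS1 hS2) e
    rw [ind_union hcomp.symm.1] at h2
    rw [coverCount_cons']
    omega

/-- A negative loop at the base point of a closed walk can be joined to two unbalanced circuits
met by the walk, without any assumption on the position of the two circuits. -/
theorem exists_loop_pairing {z : G.V} {l : List G.E} (hl : G.IsWalk z l z) {ℓ : G.E}
    (hℓ : G.ends ℓ = s(z, z)) (hs : G.sgn ℓ = 1) {a b : Finset G.E}
    (ha : G.IsUnbalancedCircuit a) (hb : G.IsUnbalancedCircuit b) (hla : ℓ ∉ a) (hlb : ℓ ∉ b)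
    (hva : ∃ x ∈ G.support a, G.Visits z l x) (hvb : ∃ x ∈ G.support b, G.Visits z l x) :
    ∃ F, (∀ S ∈ F, G.IsSignedCircuit S) ∧
      (∀ e, G.coverCount F e ≤ 2 * ind (e ∈ ({ℓ} : Finset G.E)) + G.coverCount {a, b} e +
        l.count e) ∧
      ∀ e, 2 * ind (e ∈ ({ℓ} : Finset G.E)) + G.coverCount {a, b} e ≤ G.coverCount F e := by
  have hA : G.IsUnbalancedCircuit {ℓ} := IsNegLoop.unbalanced ⟨hs, z, hℓ⟩
  have hz : z ∈ G.support {ℓ} := by simp [support_singleton hℓ]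
  obtain ⟨x, hx, hvx⟩ := hva
  obtain ⟨y, hy, hvy⟩ := hvb
  obtain ⟨l₁, l₂, rfl, hl₁, hl₂⟩ := hvx.split hl
  have key : ∀ {a b : Finset G.E} {x y : G.V} {l₁ l₂ : List G.E}, G.IsWalk z l₁ x →
      G.IsWalk y l₂ z → G.IsUnbalancedCircuit a → G.IsUnbalancedCircuit b → ℓ ∉ a → ℓ ∉ b →
      x ∈ G.support a → y ∈ G.support b → ∃ F, (∀ S ∈ F, G.IsSignedCircuit S) ∧
      (∀ e, G.coverCount F e ≤ 2 * ind (e ∈ ({ℓ} : Finset G.E)) + (ind (e ∈ a) + ind (e ∈ b)) +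
        (l₁.count e + l₂.count e)) ∧
      ∀ e, 2 * ind (e ∈ ({ℓ} : Finset G.E)) + (ind (e ∈ a) + ind (e ∈ b)) ≤ G.coverCount F e := by
    intro a b x y l₁ l₂ h1 h2 ha hb hla hlb hx hy
    have hcount : ∀ (l : List G.E) e, ind (e ∈ l.toFinset) ≤ l.count e := by
      intro l e
      by_cases he : e ∈ l
      · have := List.count_pos_iff.2 he
        exact (ind_le_one _).trans this
      · rw [ind_false (by simpa using he)]; omega
    obtain ⟨S, hS, hS1, hS2, hS3⟩ := exists_barbell hA ha (compat_loop hℓ hla) hz hx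
      (h1.reach (S := l₁.toFinset) (by simp))
    obtain ⟨S', hS', hS1', hS2', hS3'⟩ := exists_barbell hb hA (compat_loop hℓ hlb).symm hy hz
      (h2.reach (S := l₂.toFinset) (by simp))
    refine ⟨S ::ₘ {S'}, ?_, fun e => ?_, fun e => ?_⟩
    · intro T hT
      simp only [Multiset.mem_cons, Multiset.mem_singleton] at hT
      rcases hT with rfl | rfl <;> assumption
    · have k1 := ind_le_of_subset hS3 e
      have k2 := ind_le_of_subset hS3' e
      have k3 := ind_union_le ({ℓ} ∪ a) l₁.toFinset e
      have k4 := ind_union_le {ℓ} a e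
      have k5 := ind_union_le (b ∪ {ℓ}) l₂.toFinset e
      have k6 := ind_union_le b {ℓ} e
      have k7 := hcount l₁ e
      have k8 := hcount l₂ e
      rw [coverCount_cons', coverCount_singleton]
      omega
    · have k1 := ind_le_of_subset (Finset.union_subset hS1 hS2) e
      have k2 := ind_le_of_subset (Finset.union_subset hS1' hS2') e
      rw [ind_union (compat_loop hℓ hla).1] at k1
      rw [ind_union (compat_loop hℓ hlb).symm.1] at k2
      rw [coverCount_cons', coverCount_singleton]
      omega
  have hab : ∀ e, G.coverCount {a, b} e = ind (e ∈ a) + ind (e ∈ b) := by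
    intro e
    rw [Multiset.insert_eq_cons, coverCount_cons', coverCount_singleton]
  simp only [hab]
  by_cases hy2 : G.Visits x l₂ y
  · obtain ⟨m, l₃, rfl, hm, hl₃⟩ := hy2.split hl₂
    obtain ⟨F, h1, h2, h3⟩ := key hl₁ hl₃ ha hb hla hlb hx hy
    refine ⟨F, h1, fun e => (h2 e).trans ?_, h3⟩
    simp only [List.count_append]; omega
  · have hy1 : G.Visits z l₁ y := by
      obtain ⟨m, n, hmn, hm⟩ := hvy
      rcases List.append_eq_append_iff.1 hmn with ⟨k, hk1, hk2⟩ | ⟨k, hk1, hk2⟩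
      · obtain ⟨w, hw, h⟩ := isWalk_append.1 (hk1 ▸ hm)
        obtain rfl := hw.unique hl₁
        exact absurd ⟨k, n, hk2, h⟩ hy2
      · exact ⟨m, k, hk1, hm⟩
    obtain ⟨m, l₃, rfl, hm, hl₃⟩ := hy1.split hl₁
    obtain ⟨F, h1, h2, h3⟩ := key hm hl₂ hb ha hlb hla hy hx
    refine ⟨F, h1, fun e => (h2 e).trans ?_, fun e => (by omega : _ ≤ _).trans (h3 e)⟩
    simp only [List.count_append]; omega

end Tokens

section Loop

variable {G : SignedMultigraph}

/-- A connected subgraph `H` with set of negative edges `N`, connected by its positive edges,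
and a set `L` of negative loops. -/
structure Setup (G : SignedMultigraph) (H N L : Finset G.E) : Prop where
  hN : N ⊆ H
  hL : L ⊆ N
  neg : ∀ e ∈ H, G.sgn e = 1 ↔ e ∈ N
  loop : ∀ e ∈ L, ∃ x, G.ends e = s(x, x)
  conn : ∀ u ∈ G.support H, ∀ v ∈ G.support H, G.Reach (H \ N) u v
  two : 2 ≤ N.card

/-- A family of signed circuits covering the edges of `H` at most twice, the edges of `L` exactly
twice, and the edges of an even subgraph through each negative edge at least once. -/
structure Good (G : SignedMultigraph) (H N L : Finset G.E) (F : Multiset (Finset G.E)) : Prop where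
  signed : ∀ S ∈ F, G.IsSignedCircuit S
  out : ∀ e ∉ H, G.coverCount F e = 0
  le : ∀ e, G.coverCount F e ≤ 2
  loops : ∀ e ∈ L, G.coverCount F e = 2
  cov : ∀ e ∈ N, ∃ X, e ∈ X ∧ G.bd X = 0 ∧ ∀ x ∈ X, 1 ≤ G.coverCount F x

theorem mem_ends_left {e : G.E} {x y : G.V} (h : G.ends e = s(x, y)) : x ∈ G.ends e := by simp [h]

theorem mem_ends_right {e : G.E} {x y : G.V} (h : G.ends e = s(x, y)) : y ∈ G.ends e := by simp [h]

theorem sgn_zero_or_one (e : G.E) : G.sgn e = 0 ∨ G.sgn e = 1 := zmod_two_cases _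

theorem exists_even_extension {T S : Finset G.E}
    (h : ∀ e ∈ S, ∀ x y, G.ends e = s(x, y) → G.Reach T x y) : ∃ X ⊆ T, G.bd X = G.bd S := by
  induction S using Finset.induction_on with
  | empty => exact ⟨∅, by simp, rfl⟩
  | insert e S he ih =>
    obtain ⟨X, hX, hXb⟩ := ih fun e' he' => h e' (by simp [he'])
    obtain ⟨x, y, hxy⟩ := exists_ends e
    obtain ⟨P, hP, hPb⟩ := exists_bd_of_reach (h e (by simp) x y hxy)
    exact ⟨symmDiff P X, symmDiff_subset_of hP hX, by rw [bd_symmDiff, hXb, hPb, bd_insert he hxy]⟩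

theorem exists_minimal_conn {D T : Finset G.E} {U : Finset G.V}
    (h : ∀ u ∈ U, ∀ v ∈ U, G.Reach (D ∪ T) u v) :
    ∃ J ⊆ T, (∀ u ∈ U, ∀ v ∈ U, G.Reach (D ∪ J) u v) ∧
      ∀ C ⊆ D ∪ J, G.IsCircuit C → ∀ e ∈ C, e ∈ J → e ∈ D := by
  induction T using Finset.strongInduction with
  | H T ih =>
    by_cases hc : ∀ C ⊆ D ∪ T, G.IsCircuit C → ∀ e ∈ C, e ∈ T → e ∈ D
    · exact ⟨T, subset_rfl, h, hc⟩
    · push Not at hc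
      obtain ⟨C, hC, hCc, e, heC, heT, heD⟩ := hc
      have key : ∀ u ∈ U, ∀ v ∈ U, G.Reach (D ∪ T.erase e) u v := by
        intro u hu v hv
        obtain ⟨x, y, hxy⟩ := exists_ends e
        have hb : G.bd (C.erase e) = G.pt x + G.pt y := by
          rw [← Finset.sdiff_singleton_eq_erase, bd_sdiff (by simpa using heC), hCc.bd,
            bd_singleton hxy, zero_add]
        have hr : G.Reach (D ∪ T.erase e) x y := (reach_of_bd hb).mono (by
          intro a ha
          obtain ⟨ha1, ha2⟩ := Finset.mem_erase.1 ha
          have := hC ha2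
          simp only [Finset.mem_union, Finset.mem_erase] at this ⊢; tauto)
        have hr' := h u hu v hv
        clear hv
        induction hr' with
        | refl => exact Reach.refl' _ _
        | @tail b c _ hbc ih =>
          refine Reach.trans' ih ?_
          obtain ⟨f, hf, hff⟩ := hbc
          by_cases hfe : f = e
          · subst hfe
            rw [hxy] at hff
            rcases Sym2.eq_iff.1 hff with ⟨rfl, rfl⟩ | ⟨rfl, rfl⟩
            · exact hr
            · exact hr.symm'
          · refine reach_edge ?_ hff
            simp only [Finset.mem_union, Finset.mem_erase] at hf ⊢; tauto
      obtain ⟨J, hJ, h1⟩ := ih (T.erase e) (Finset.erase_ssubset heT) key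
      exact ⟨J, hJ.trans (Finset.erase_subset _ _), h1⟩

theorem sum_sgn_list {D J : Finset G.E} {l : List G.E}
    (h : ∀ e, l.count e = ind (e ∈ D) + 2 * ind (e ∈ J)) : (l.map G.sgn).sum = G.par D := by
  have h1 : (l : Multiset G.E) = D.val + 2 • J.val := by
    ext e
    rw [Multiset.coe_count, h, Multiset.count_add, Multiset.count_nsmul, count_val, count_val]
  have h2 : (l.map G.sgn).sum = ((l : Multiset G.E).map G.sgn).sum := by simp
  rw [h2, h1, Multiset.map_add, Multiset.sum_add, Multiset.map_nsmul, Multiset.sum_nsmul]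
  have h3 : (2 • (J.val.map G.sgn).sum : ZMod 2) = 0 := by
    rw [two_nsmul]; exact CharTwo.add_self_eq_zero _
  rw [h3, add_zero]; rfl

namespace Setup

variable {H N L : Finset G.E}

theorem reach_ends_edge (h : G.Setup H N L) {e : G.E} (he : e ∈ H) (x y : G.V)
    (hxy : G.ends e = s(x, y)) : G.Reach (H \ N) x y :=
  h.conn x (mem_support.2 ⟨e, he, mem_ends_left hxy⟩) y (mem_support.2 ⟨e, he, mem_ends_right hxy⟩)

/-- An even subgraph of `H` containing all negative edges. -/
theorem exists_even (h : G.Setup H N L) : ∃ D, N ⊆ D ∧ D ⊆ H ∧ G.bd D = 0 := by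
  obtain ⟨X, hX, hb⟩ := exists_even_extension (S := N) (T := H \ N)
    fun e he => h.reach_ends_edge (h.hN he)
  refine ⟨N ∪ X, Finset.subset_union_left, Finset.union_subset h.hN (hX.trans Finset.sdiff_subset),
    ?_⟩
  rw [bd_union (Finset.disjoint_of_subset_right hX Finset.disjoint_sdiff), hb, pi_add_self]

/-- A negative edge and positive edges form an unbalanced circuit. -/
theorem exists_fundamental (h : G.Setup H N L) {e : G.E} (he : e ∈ N) :
    ∃ C ⊆ insert e (H \ N), G.IsUnbalancedCircuit C ∧ e ∈ C := by
  obtain ⟨x, y, hxy⟩ := exists_ends e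
  obtain ⟨P, hP, hb⟩ := exists_bd_of_reach (h.reach_ends_edge (h.hN he) x y hxy)
  obtain ⟨Q, hQ, hQb, hQa⟩ := exists_acyc (P := P)
  have heQ : e ∉ Q := fun hm => (Finset.mem_sdiff.1 (hP (hQ hm))).2 he
  refine ⟨insert e Q, Finset.insert_subset_insert _ (hQ.trans hP), unbalanced_iff.2
    ⟨hQa.circuit (hQb.trans hb) hxy heQ, ?_⟩, by simp⟩
  rw [par_insert heQ, (h.neg e (h.hN he)).2 he, par, Finset.sum_eq_zero, add_zero]
  intro f hf
  obtain ⟨h1, h2⟩ := Finset.mem_sdiff.1 (hP (hQ hf))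
  exact (sgn_zero_or_one f).resolve_right fun hc => h2 ((h.neg f h1).1 hc)

theorem mem_support_of_reach (_ : G.Setup H N L) {S : Finset G.E} (hS : S ⊆ H) {u v : G.V}
    (hu : u ∈ G.support H) (hr : G.Reach S u v) : v ∈ G.support H := by
  induction hr with
  | refl => exact hu
  | tail _ hbc _ =>
    obtain ⟨e, he, hee⟩ := hbc
    exact mem_support.2 ⟨e, hS he, mem_ends_right hee⟩

end Setup

theorem good_of_trail {H N L : Finset G.E} (h : G.Setup H N L) {ℓ : G.E} (hℓ : ℓ ∈ L)
    {D : Finset G.E} (hND : N ⊆ D) (hDH : D ⊆ H) (hD : G.bd D = 0)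
    (hc : G.par (D.erase ℓ) = 1 ∨ ∃ e ∈ L, e ≠ ℓ) : ∃ F, G.Good H N L F := by
  obtain ⟨z, hz⟩ := h.loop ℓ hℓ
  have hℓN := h.hL hℓ
  have hℓs : G.sgn ℓ = 1 := (h.neg ℓ (h.hN hℓN)).2 hℓN
  have hzH : z ∈ G.support H := mem_support.2 ⟨ℓ, h.hN hℓN, mem_ends_left hz⟩
  obtain ⟨J, hJ, hJc, hJmin⟩ := exists_minimal_conn (D := D) (T := H \ D) (U := G.support H)
    (fun u hu v hv => (h.conn u hu v hv).mono (by
      rw [Finset.union_sdiff_of_subset hDH]; exact Finset.sdiff_subset))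
  have hJD : ∀ e ∈ J, e ∉ D := fun e he => (Finset.mem_sdiff.1 (hJ he)).2
  have hJH : J ⊆ H := hJ.trans Finset.sdiff_subset
  have hℓD := hND hℓN
  have hD' : G.bd (D.erase ℓ) = 0 := by
    rw [← Finset.sdiff_singleton_eq_erase, bd_sdiff (by simpa using hℓD), hD, bd_singleton hz,
      pi_add_self, add_zero]
  obtain ⟨l, hl, hle, hvis, heq⟩ := exists_euler_walk' (J := J) hD' z
  have hℓJ : ℓ ∉ J := fun hm => hJD ℓ hm hℓD
  have hvisH : ∀ x ∈ G.support H, G.Visits z l x := by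
    intro x hx
    refine hvis x ((reach_erase_loop hz (hJc z hzH x hx)).mono ?_)
    intro e he
    simp only [Finset.mem_erase, Finset.mem_union] at he ⊢; tauto
  have hsub : ∀ e, e ∈ D.erase ℓ ∨ e ∈ J → e ∈ H := by
    rintro e (he | he)
    · exact hDH (Finset.mem_of_mem_erase he)
    · exact hJH he
  have hcount : ∀ e, l.count e = ind (e ∈ D.erase ℓ) + 2 * ind (e ∈ J) := by
    intro e
    by_cases he : e ∈ D.erase ℓ ∨ e ∈ J
    · obtain ⟨x, y, hxy⟩ := exists_ends e
      exact heq x e (hvisH x (mem_support.2 ⟨e, hsub e he, mem_ends_left hxy⟩)) (mem_ends_left hxy)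
    · rw [not_or] at he
      have := hle e
      rw [ind_false he.1, ind_false he.2] at this ⊢
      omega
  have hdis : ∀ e, ind (e ∈ D.erase ℓ) + ind (e ∈ J) ≤ 1 := by
    intro e
    by_cases he : e ∈ J
    · rw [ind_false (p := e ∈ D.erase ℓ) (fun hm => hJD e he (Finset.mem_of_mem_erase hm))]
      have := ind_le_one (e ∈ J); omega
    · rw [ind_false he]; have := ind_le_one (e ∈ D.erase ℓ); omega
  have hmem : ∀ e, e ∈ l ↔ e ∈ D.erase ℓ ∨ e ∈ J := by
    intro e
    rw [← List.count_pos_iff, hcount, ← ind_pos (p := _ ∨ _)]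
    by_cases h1 : e ∈ D.erase ℓ <;> by_cases h2 : e ∈ J <;> simp [ind, h1, h2]
  have hℓl : ℓ ∉ l := by rw [hmem]; simp [hℓJ]
  have hdata : TrailData J ℓ z {ℓ} ∅ z z l := by
    refine ⟨hz, hℓs, hℓJ, IsNegLoop.unbalanced ⟨hℓs, z, hz⟩, by simp [support_singleton hz],
      acyc_empty, by rw [pi_add_self, bd_empty], by simp, hl, fun e => ?_,
      fun C hC hCc e he heJ => ?_,
      by simp, hℓl, fun _ => ?_⟩
    · rw [ind_false (p := e ∈ (∅ : Finset G.E)) (by simp)]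
      by_cases heℓ : e = ℓ
      · rw [heℓ, List.count_eq_zero.2 hℓl]
        have := ind_le_one (ℓ ∈ ({ℓ} : Finset G.E)); omega
      · rw [ind_false (p := e ∈ ({ℓ} : Finset G.E)) (by simpa using heℓ), hcount]
        have := hdis e
        omega
    · refine hJD e heJ (hJmin C (fun x hx => ?_) hCc e he heJ)
      have := hC x hx
      rw [hmem, Finset.mem_singleton] at this
      rcases this with rfl | hm | hm | hm
      · exact Finset.mem_union_left _ hℓD
      · simp at hm
      · exact Finset.mem_union_left _ (Finset.mem_of_mem_erase hm)
      · exact Finset.mem_union_right _ hm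
    · refine hc.imp (fun hp => ?_) (fun ⟨e, he, hne⟩ => ⟨e, (hmem e).2 (Or.inl ?_), ?_⟩)
      · rw [sum_sgn_list hcount, hp, par_empty, zero_add]
      · exact Finset.mem_erase.2 ⟨hne, hND (h.hL he)⟩
      · exact ⟨(h.neg e (h.hN (h.hL he))).2 (h.hL he), h.loop e he⟩
  obtain ⟨F, hF⟩ := exists_trail_cover l hdata
  have hℓ2 : G.coverCount F ℓ = 2 := by
    rw [hF.base ℓ (Or.inr rfl), ind_true (by simp), ind_true rfl]
  have hDcov : ∀ e ∈ D, 1 ≤ G.coverCount F e ∧ G.coverCount F e ≤ 2 := by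
    intro e he
    by_cases heℓ : e = ℓ
    · rw [heℓ, hℓ2]; omega
    · exact hF.trail e (fun hm => hJD e hm he) (Or.inr ((hmem e).2
        (Or.inl (Finset.mem_erase.2 ⟨heℓ, he⟩))))
  have hrest : ∀ e, e ∉ D → e ∉ J → G.coverCount F e = 0 := by
    intro e h1 h2
    have hne : e ≠ ℓ := by rintro rfl; exact h1 hℓD
    refine hF.rest e (by simpa using hne) hne (by simp) ?_
    rw [hmem]
    exact not_or.2 ⟨fun hm => h1 (Finset.mem_of_mem_erase hm), h2⟩
  refine ⟨F, hF.signed, fun e he => hrest e (fun hm => he (hDH hm)) (fun hm => he (hJH hm)),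
    fun e => ?_, fun e he => ?_, fun e he => ⟨D, hND he, hD, fun x hx => (hDcov x hx).1⟩⟩
  · by_cases h1 : e ∈ D
    · exact (hDcov e h1).2
    by_cases h2 : e ∈ J
    · have := hF.doubled e h2
      rw [hcount, ind_false (by simp), ind_false (fun hm => h1 (Finset.mem_of_mem_erase hm)),
        ind_true h2] at this
      omega
    · rw [hrest e h1 h2]; omega
  · by_cases heℓ : e = ℓ
    · rw [heℓ, hℓ2]
    · have h1 := h.hL he
      exact hF.loops e ((hmem e).2 (Or.inl (Finset.mem_erase.2 ⟨heℓ, hND h1⟩)))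
        ⟨(h.neg e (h.hN h1)).2 h1, h.loop e he⟩

end Loop

section OneLoop

variable {G : SignedMultigraph}

theorem ind_erase {D : Finset G.E} {ℓ : G.E} (h : ℓ ∈ D) (e : G.E) :
    ind (e ∈ D.erase ℓ) + ind (e ∈ ({ℓ} : Finset G.E)) = ind (e ∈ D) := by
  rw [← ind_union (by simp), Finset.union_singleton, Finset.insert_erase h]

theorem ind_symmDiff (S T : Finset G.E) (e : G.E) :
    ind (e ∈ symmDiff S T) + 2 * ind (e ∈ S ∩ T) = ind (e ∈ S) + ind (e ∈ T) := by
  unfold ind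
  by_cases hs : e ∈ S <;> by_cases ht : e ∈ T <;> simp [Finset.mem_symmDiff, hs, ht]

theorem ind_sdiff {S T : Finset G.E} (h : T ⊆ S) (e : G.E) :
    ind (e ∈ S \ T) + ind (e ∈ T) = ind (e ∈ S) := by
  rw [← ind_union Finset.sdiff_disjoint, Finset.sdiff_union_of_subset h]

theorem exists_decomp_cons {Y D : Finset G.E} (hY : G.IsCircuit Y) (h : Y ⊆ D) (hD : G.bd D = 0) :
    ∃ F, G.IsDecomp (Y ::ₘ F) D := by
  obtain ⟨F, hF⟩ := exists_decomp (S := D \ Y) (by rw [bd_sdiff h, hD, hY.bd, add_zero])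
  refine ⟨F, ?_⟩
  have := (isDecomp_singleton hY).add hF Finset.disjoint_sdiff
  rwa [Finset.union_sdiff_of_subset h, Multiset.singleton_add] at this

theorem two_le_card_odds {F : Multiset (Finset G.E)} {Y D : Finset G.E} (hY : G.par Y = 1)
    (h : G.IsDecomp (Y ::ₘ F) D) (hD : G.par D = 0) : 2 ≤ (G.odds (Y ::ₘ F)).card := by
  have h1 := h.card_odds
  rw [hD, ZMod.natCast_eq_zero_iff_even] at h1
  have h2 : 0 < (G.odds (Y ::ₘ F)).card := Multiset.card_pos_iff_exists_mem.2
    ⟨Y, Multiset.mem_filter.2 ⟨Multiset.mem_cons_self _ _, hY⟩⟩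
  obtain ⟨k, hk⟩ := h1
  omega

/-- The case of a single loop `ℓ` when an unbalanced circuit lies in `D - ℓ`. -/
theorem Setup.good_of_loop_of_subset {H N L : Finset G.E} (h : G.Setup H N L) {ℓ : G.E}
    (hℓ : ℓ ∈ L) (hL : ∀ e ∈ L, e = ℓ) {D : Finset G.E} (hND : N ⊆ D) (hDH : D ⊆ H)
    (hD : G.bd D = 0) (hp : G.par (D.erase ℓ) = 0) {Y : Finset G.E}
    (hY : G.IsUnbalancedCircuit Y) (hYD : Y ⊆ D.erase ℓ) : ∃ F, G.Good H N L F := by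
  obtain ⟨z, hz⟩ := h.loop ℓ hℓ
  have hℓN := h.hL hℓ
  have hℓD := hND hℓN
  have hℓs : G.sgn ℓ = 1 := (h.neg ℓ (h.hN hℓN)).2 hℓN
  have hzH : z ∈ G.support H := mem_support.2 ⟨ℓ, h.hN hℓN, mem_ends_left hz⟩
  have hD' : G.bd (D.erase ℓ) = 0 := by
    rw [← Finset.sdiff_singleton_eq_erase, bd_sdiff (by simpa using hℓD), hD, bd_singleton hz,
      pi_add_self, add_zero]
  obtain ⟨F0, hF0⟩ := exists_decomp_cons hY.1 hYD hD'
  obtain ⟨F, hF, h2, hPC⟩ := exists_max_decomp 2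
    ⟨_, hF0, two_le_card_odds (unbalanced_iff.1 hY).2 hF0 hp⟩
  obtain ⟨l, hl, hle, hvis, -⟩ := exists_euler_walk' (J := H \ D) hD' z
  have hvisH : ∀ x ∈ G.support H, G.Visits z l x := by
    intro x hx
    refine hvis x ((reach_erase_loop hz (h.conn z hzH x hx)).mono ?_)
    intro e he
    simp only [Finset.mem_erase, Finset.mem_union, Finset.mem_sdiff] at he ⊢; tauto
  have hodd : ∀ a ∈ G.odds F, G.IsUnbalancedCircuit a ∧ ℓ ∉ a ∧
      ∃ x ∈ G.support a, G.Visits z l x := by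
    intro a ha
    obtain ⟨h3, h4⟩ := hF.odd_mem ha
    obtain ⟨x, hx⟩ := support_nonempty h3.1.1.ne_empty
    refine ⟨h3, fun hm => by simpa using h4 hm, x, hx, hvisH x ?_⟩
    exact support_mono (h4.trans ((Finset.erase_subset _ _).trans hDH)) hx
  have hA : G.IsUnbalancedCircuit {ℓ} := IsNegLoop.unbalanced ⟨hℓs, z, hz⟩
  obtain ⟨F2, hF2s, hF2l, hF2g⟩ : ∃ F2, (∀ S ∈ F2, G.IsSignedCircuit S) ∧
      (∀ e, G.coverCount F2 e ≤ 2 * ind (e ∈ ({ℓ} : Finset G.E)) + G.coverCount (G.odds F) e +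
        l.count e) ∧
      ∀ e, 2 * ind (e ∈ ({ℓ} : Finset G.E)) + G.coverCount (G.odds F) e ≤ G.coverCount F2 e := by
    by_cases h4 : (G.odds F).card = 2
    · obtain ⟨a, b, hab⟩ := Multiset.card_eq_two.1 h4
      rw [hab] at hodd ⊢
      obtain ⟨a1, a2, a3⟩ := hodd a (by simp)
      obtain ⟨b1, b2, b3⟩ := hodd b (by simp)
      exact exists_loop_pairing hl hz hℓs a1 b1 a2 b2 a3 b3
    · have h5 := hF.card_odds
      rw [hp] at h5
      have h6 := (ZMod.natCast_eq_zero_iff_even).1 h5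
      refine exists_rooted_pairing hl hA (by simp [support_singleton hz])
        (fun a ha => ⟨(hodd a ha).1, (hodd a ha).2.2⟩)
        (pairCompat_cons (fun b hb => compat_loop hz (hodd b hb).2.1) (hPC ?_)) ?_ h5
      · obtain ⟨k, hk⟩ := h6; omega
      · intro h7; rw [h7] at h2; simp at h2
  have hc : ∀ e, ind (e ∈ D) + ind (e ∈ ({ℓ} : Finset G.E)) ≤ G.coverCount (G.evens F + F2) e ∧
      G.coverCount (G.evens F + F2) e ≤ ind (e ∈ D) + ind (e ∈ ({ℓ} : Finset G.E)) +
        (ind (e ∈ D.erase ℓ) + 2 * ind (e ∈ H \ D)) := by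
    intro e
    have e1 := hF2l e
    have e2 := hF2g e
    have e3 := coverCount_odds_add_evens F e
    rw [hF.count] at e3
    have e4 := hle e
    have e5 := ind_erase hℓD e
    rw [coverCount_add]
    omega
  refine ⟨G.evens F + F2, fun S hS => ?_, fun e he => ?_, fun e => ?_, fun e he => ?_,
    fun e he => ⟨D, hND he, hD, fun x hx => ?_⟩⟩
  · rcases Multiset.mem_add.1 hS with hS | hS
    exacts [(hF.even_mem hS).1, hF2s S hS]
  · have := (hc e).2
    have h1 := ind_erase hℓD e
    rw [ind_false (p := e ∈ D) fun hm => he (hDH hm)] at this h1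
    rw [ind_false (p := e ∈ H \ D) fun hm => he (Finset.sdiff_subset hm)] at this
    omega
  · have := (hc e).2
    have h1 := ind_erase hℓD e
    have h3 := ind_sdiff hDH e
    have h4 := ind_le_one (e ∈ H)
    omega
  · rw [hL e he]
    have := hc ℓ
    rw [ind_true hℓD, ind_true (p := ℓ ∈ ({ℓ} : Finset G.E)) (by simp),
      ind_false (p := ℓ ∈ D.erase ℓ) (by simp), ind_false (p := ℓ ∈ H \ D) (by simp [hℓD])] at this
    omega
  · have := (hc x).1
    rw [ind_true hx] at this
    omega

/-- The case of a single loop `ℓ` when no unbalanced circuit lies in `D - ℓ`. -/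
theorem Setup.good_of_loop_of_not_subset {H N L : Finset G.E} (h : G.Setup H N L) {ℓ : G.E}
    (hℓ : ℓ ∈ L) (hL : ∀ e ∈ L, e = ℓ) {D : Finset G.E} (hND : N ⊆ D) (hDH : D ⊆ H)
    (hD : G.bd D = 0) (hp : G.par (D.erase ℓ) = 0) {Y : Finset G.E}
    (hY : G.IsUnbalancedCircuit Y) (hYH : Y ⊆ H.erase ℓ) (hYD : (Y \ D).Nonempty)
    (hmin : ∀ Y' ⊆ H.erase ℓ, G.IsUnbalancedCircuit Y' → (Y \ D).card ≤ (Y' \ D).card) :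
    ∃ F, G.Good H N L F := by
  obtain ⟨z, hz⟩ := h.loop ℓ hℓ
  have hℓN := h.hL hℓ
  have hℓD := hND hℓN
  have hℓs : G.sgn ℓ = 1 := (h.neg ℓ (h.hN hℓN)).2 hℓN
  have hzH : z ∈ G.support H := mem_support.2 ⟨ℓ, h.hN hℓN, mem_ends_left hz⟩
  have hD' : G.bd (D.erase ℓ) = 0 := by
    rw [← Finset.sdiff_singleton_eq_erase, bd_sdiff (by simpa using hℓD), hD, bd_singleton hz,
      pi_add_self, add_zero]
  have hYpar := (unbalanced_iff.1 hY).2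
  have hℓY : ℓ ∉ Y := fun hm => by simpa using hYH hm
  have hYH' : Y ⊆ H := hYH.trans (Finset.erase_subset _ _)
  obtain ⟨F, hF⟩ := exists_decomp (S := symmDiff (D.erase ℓ) Y)
    (by rw [bd_symmDiff, hD', hY.1.bd, add_zero])
  have hSH : symmDiff (D.erase ℓ) Y ⊆ H.erase ℓ :=
    symmDiff_subset_of (Finset.erase_subset_erase _ hDH) hYH
  have hcard := hF.card_odds
  rw [par_symmDiff, hp, hYpar, zero_add] at hcard
  have hodd : ∀ C ∈ G.odds F, Y \ D ⊆ C := by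
    intro C hC
    obtain ⟨h1, h2⟩ := hF.odd_mem hC
    have h3 : C \ D ⊆ Y \ D := by
      intro e he
      have h4 := Finset.mem_symmDiff.1 (h2 (Finset.mem_sdiff.1 he).1)
      simp only [Finset.mem_sdiff, Finset.mem_erase] at he h4 ⊢
      tauto
    rw [← Finset.eq_of_subset_of_card_le h3 (hmin C (h2.trans hSH) h1)]
    exact Finset.sdiff_subset
  obtain ⟨g, hg⟩ := hYD
  obtain ⟨C, hC⟩ : ∃ C, G.odds F = {C} := by
    have h1 : (G.odds F).card ≤ 1 := by
      have h2 := coverCount_odds_add_evens F g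
      have h3 : G.coverCount (G.odds F) g = (G.odds F).card := by
        rw [coverCount, Multiset.filter_eq_self.2 fun S hS => hodd S hS hg]
      rw [hF.count] at h2
      have := ind_le_one (g ∈ symmDiff (D.erase ℓ) Y)
      omega
    have h2 : (G.odds F).card ≠ 0 := by intro h3; rw [h3] at hcard; simp at hcard
    exact Multiset.card_eq_one.1 (by omega)
  obtain ⟨hCu, hCS⟩ := hF.odd_mem (C := C) (by simp [hC])
  have hCY := hodd C (by simp [hC])
  obtain ⟨l, hl, hle, hvis, -⟩ := exists_euler_walk' (J := (H \ D) \ Y) hD' z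
  obtain ⟨gx, gy, hgxy⟩ := exists_ends g
  have hgB : gx ∈ G.support (Y \ D) := mem_support.2 ⟨g, hg, mem_ends_left hgxy⟩
  obtain ⟨q, hq, hqr⟩ := exists_first_hit (S := H) (B := Y \ D)
    ((h.conn z hzH gx (support_mono (Finset.sdiff_subset.trans hYH') hgB)).mono Finset.sdiff_subset)
    hgB
  have hqv : G.Visits z l q := by
    refine hvis q ((reach_erase_loop hz hqr).mono ?_)
    intro e he
    simp only [Finset.mem_erase, Finset.mem_union, Finset.mem_sdiff] at he ⊢; tauto
  obtain ⟨F2, hF2s, hF2l, hF2g⟩ := exists_loop_pairing hl hz hℓs hY hCu hℓY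
    (fun hm => by simpa using hSH (hCS hm)) ⟨q, support_mono Finset.sdiff_subset hq, hqv⟩
    ⟨q, support_mono hCY hq, hqv⟩
  have hc : ∀ e, ind (e ∈ symmDiff (D.erase ℓ) Y) + ind (e ∈ Y) +
        2 * ind (e ∈ ({ℓ} : Finset G.E)) ≤ G.coverCount (G.evens F + F2) e ∧
      G.coverCount (G.evens F + F2) e ≤ ind (e ∈ symmDiff (D.erase ℓ) Y) + ind (e ∈ Y) +
        2 * ind (e ∈ ({ℓ} : Finset G.E)) +
        (ind (e ∈ D.erase ℓ) + 2 * ind (e ∈ (H \ D) \ Y)) := by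
    intro e
    have e1 := hF2l e
    have e2 := hF2g e
    have e3 := coverCount_odds_add_evens F e
    rw [hF.count, hC, coverCount_singleton] at e3
    have e4 := hle e
    have e6 : G.coverCount {Y, C} e = ind (e ∈ Y) + ind (e ∈ C) := by
      rw [Multiset.insert_eq_cons, coverCount_cons', coverCount_singleton]
    rw [coverCount_add]
    omega
  have hbool : ∀ e, ∀ {n : ℕ}, n ≤ ind (e ∈ symmDiff (D.erase ℓ) Y) + ind (e ∈ Y) +
        2 * ind (e ∈ ({ℓ} : Finset G.E)) +
        (ind (e ∈ D.erase ℓ) + 2 * ind (e ∈ (H \ D) \ Y)) → n ≤ 2 ∧ (e ∉ H → n = 0) := by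
    intro e n hn
    have h1 : e ∈ Y → e ∈ H := fun hm => hYH' hm
    have h2 : e ∈ D → e ∈ H := fun hm => hDH hm
    by_cases he : e = ℓ
    · subst he
      simp only [ind, Finset.mem_symmDiff, Finset.mem_erase, Finset.mem_sdiff, hℓY, hℓD] at hn
      simp at hn
      exact ⟨by omega, fun h3 => absurd (h2 hℓD) h3⟩
    · by_cases h3 : e ∈ Y <;> by_cases h4 : e ∈ D <;> by_cases h5 : e ∈ H <;>
        simp [ind, Finset.mem_symmDiff, h3, h4, h5, he] at hn h1 h2 ⊢ <;> omega
  refine ⟨G.evens F + F2, fun S hS => ?_, fun e he => (hbool e (hc e).2).2 he,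
    fun e => (hbool e (hc e).2).1, fun e he => ?_,
    fun e he => ⟨D, hND he, hD, fun x hx => ?_⟩⟩
  · rcases Multiset.mem_add.1 hS with hS | hS
    exacts [(hF.even_mem hS).1, hF2s S hS]
  · rw [hL e he]
    have h1 := (hc ℓ).1
    have h2 := (hbool ℓ (hc ℓ).2).1
    rw [ind_true (p := ℓ ∈ ({ℓ} : Finset G.E)) (by simp)] at h1
    omega
  · refine le_trans ?_ (hc x).1
    by_cases he : x = ℓ
    · rw [ind_true (p := x ∈ ({ℓ} : Finset G.E)) (by simp [he])]; omega
    · by_cases h3 : x ∈ Y <;> simp [ind, Finset.mem_symmDiff, h3, hx, he]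

theorem Setup.good_of_loop {H N L : Finset G.E} (h : G.Setup H N L) {ℓ : G.E}
    (hℓ : ℓ ∈ L) : ∃ F, G.Good H N L F := by
  obtain ⟨D, hND, hDH, hD⟩ := h.exists_even
  by_cases hp : G.par (D.erase ℓ) = 1
  · exact good_of_trail h hℓ hND hDH hD (Or.inl hp)
  by_cases hL : ∃ e ∈ L, e ≠ ℓ
  · exact good_of_trail h hℓ hND hDH hD (Or.inr hL)
  replace hp := (zmod_two_cases _).resolve_right hp
  push Not at hL
  obtain ⟨f, hf, hfℓ⟩ := Finset.exists_mem_ne h.two ℓ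
  obtain ⟨C, hC, hCu, -⟩ := h.exists_fundamental hf
  have hCH : C ⊆ H.erase ℓ := by
    intro e he
    rcases Finset.mem_insert.1 (hC he) with rfl | hm
    · exact Finset.mem_erase.2 ⟨hfℓ, h.hN hf⟩
    · obtain ⟨h1, h2⟩ := Finset.mem_sdiff.1 hm
      exact Finset.mem_erase.2 ⟨fun h3 => h2 (h3 ▸ h.hL hℓ), h1⟩
  obtain ⟨Y, hY, hmin⟩ := Finset.exists_min_image
    ((H.erase ℓ).powerset.filter fun Y => G.IsUnbalancedCircuit Y) (fun Y => (Y \ D).card)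
    ⟨C, Finset.mem_filter.2 ⟨Finset.mem_powerset.2 hCH, hCu⟩⟩
  obtain ⟨hYH, hYu⟩ := Finset.mem_filter.1 hY
  rw [Finset.mem_powerset] at hYH
  by_cases hYD : (Y \ D).Nonempty
  · exact h.good_of_loop_of_not_subset hℓ hL hND hDH hD hp hYu hYH hYD fun Y' h1 h2 =>
      hmin Y' (Finset.mem_filter.2 ⟨Finset.mem_powerset.2 h1, h2⟩)
  · rw [Finset.not_nonempty_iff_eq_empty, Finset.sdiff_eq_empty_iff_subset] at hYD
    exact h.good_of_loop_of_subset hℓ hL hND hDH hD hp hYu fun e he =>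
      Finset.mem_erase.2 ⟨fun h3 => by simpa [h3] using hYH he, hYD he⟩

end OneLoop

section NoLoop

variable {G : SignedMultigraph}

theorem reach_sdiff_of_avoid {S a : Finset G.E} {z v : G.V} (h : G.Reach S z v)
    (ha : ∀ x ∈ G.support a, ¬ G.Reach S z x) : G.Reach (S \ a) z v := by
  induction h with
  | refl => exact Reach.refl' _ _
  | @tail b c hb hbc ih =>
    obtain ⟨e, he, hee⟩ := hbc
    refine ih.trans' (reach_edge (Finset.mem_sdiff.2 ⟨he, fun hm => ?_⟩) hee)
    exact ha c (mem_support.2 ⟨e, hm, mem_ends_right hee⟩)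
      (Reach.trans' hb (reach_edge he hee))

/-- One of several disjoint circuits is the root of a connected remainder meeting all others. -/
theorem exists_root {H : Finset G.E} (hH : ∀ u ∈ G.support H, ∀ v ∈ G.support H, G.Reach H u v)
    {τ : Multiset (Finset G.E)} (hτ : ∀ a ∈ τ, G.IsCircuit a ∧ a ⊆ H)
    (hd : ∀ a b r, τ = a ::ₘ b ::ₘ r → Disjoint a b) (h0 : τ ≠ 0) :
    ∃ O r, τ = O ::ₘ r ∧ ∃ z ∈ G.support O, ∀ a ∈ r, ∃ x ∈ G.support a, G.Reach (H \ O) z x := by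
  set R : Finset G.E × G.V → Finset G.V :=
    fun p => Finset.univ.filter fun v => G.Reach (H \ p.1) p.2 v
  obtain ⟨A, hA⟩ := Multiset.exists_mem_of_ne_zero h0
  obtain ⟨w, hw⟩ := support_nonempty (hτ A hA).1.1.ne_empty
  obtain ⟨⟨O, z⟩, hOz, hmax⟩ := Finset.exists_max_image
    ((Finset.univ : Finset (Finset G.E × G.V)).filter fun p => p.1 ∈ τ ∧ p.2 ∈ G.support p.1)
    (fun p => (R p).card) ⟨(A, w), by simp [hA, hw]⟩
  simp only [Finset.mem_filter, Finset.mem_univ, true_and] at hOz hmax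
  obtain ⟨hO, hz⟩ := hOz
  obtain ⟨r, hr⟩ := Multiset.exists_cons_of_mem hO
  refine ⟨O, r, hr, z, hz, fun a ha => ?_⟩
  by_contra hc
  push Not at hc
  obtain ⟨r', hr'⟩ := Multiset.exists_cons_of_mem ha
  have haτ : a ∈ τ := by rw [hr]; exact Multiset.mem_cons_of_mem ha
  have hdis : Disjoint O a := hd O a r' (by rw [hr, hr'])
  obtain ⟨y, hy⟩ := support_nonempty (hτ a haτ).1.1.ne_empty
  obtain ⟨q, hq, hyq⟩ := exists_first_hit
    (hH y (support_mono (hτ a haτ).2 hy) z (support_mono (hτ O hO).2 hz)) hz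
  obtain ⟨z2, hz2, hqz⟩ := exists_first_hit hyq.symm' hy
  have h1 : G.Reach (H \ a) z2 z := by
    refine (hqz.symm'.mono ?_).trans' (((hτ O hO).1.2.1 q hq z hz).mono ?_)
    · intro e he; simp only [Finset.mem_sdiff] at he ⊢; tauto
    · intro e he
      exact Finset.mem_sdiff.2 ⟨(hτ O hO).2 he, Finset.disjoint_left.1 hdis he⟩
  have h2 : R (O, z) ⊂ R (a, z2) := by
    rw [Finset.ssubset_iff_of_subset]
    · refine ⟨z2, ?_, ?_⟩
      · simpa [R] using Reach.refl' _ _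
      · simpa [R] using hc z2 hz2
    · intro v hv
      simp only [R, Finset.mem_filter, Finset.mem_univ, true_and] at hv ⊢
      refine h1.trans' ((reach_sdiff_of_avoid hv hc).mono ?_)
      intro e he; simp only [Finset.mem_sdiff] at he ⊢; tauto
  have h3 := Finset.card_lt_card h2
  have h4 := hmax (a, z2) ⟨haτ, hz2⟩
  omega

namespace Setup

variable {H N : Finset G.E}

theorem good_of_cover {D : Finset G.E} (hND : N ⊆ D) (hDH : D ⊆ H) (hD : G.bd D = 0)
    {F : Multiset (Finset G.E)} (hF : ∀ S ∈ F, G.IsSignedCircuit S)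
    (hc : ∀ e, ind (e ∈ D) ≤ G.coverCount F e ∧
      G.coverCount F e ≤ 2 * ind (e ∈ D) + 2 * ind (e ∈ H \ D)) : G.Good H N ∅ F := by
  refine ⟨hF, fun e he => ?_, fun e => ?_, by simp,
    fun e he => ⟨D, hND he, hD, fun x hx => ?_⟩⟩
  · have := (hc e).2
    rw [ind_false (p := e ∈ D) fun hm => he (hDH hm),
      ind_false (p := e ∈ H \ D) fun hm => he (Finset.sdiff_subset hm)] at this
    omega
  · have := (hc e).2
    have h1 := ind_sdiff hDH e
    have h2 := ind_le_one (e ∈ H)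
    omega
  · have := (hc x).1; rwa [ind_true hx] at this

theorem conn' {L : Finset G.E} (h : G.Setup H N L) : ∀ u ∈ G.support H, ∀ v ∈ G.support H,
    G.Reach H u v := fun u hu v hv => (h.conn u hu v hv).mono Finset.sdiff_subset

theorem good_of_even_odds (h : G.Setup H N ∅) {D : Finset G.E} (hND : N ⊆ D) (hDH : D ⊆ H)
    (hD : G.bd D = 0) {F : Multiset (Finset G.E)} (hF : G.IsDecomp F D)
    (hPC : 2 ≤ (G.odds F).card → G.PairCompat (G.odds F)) (hev : Even (G.odds F).card) :
    ∃ F, G.Good H N ∅ F := by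
  by_cases h0 : G.odds F = 0
  · refine ⟨G.evens F, good_of_cover hND hDH hD (fun S hS => (hF.even_mem hS).1) fun e => ?_⟩
    have := coverCount_odds_add_evens F e
    rw [hF.count, h0, coverCount_zero] at this
    omega
  obtain ⟨A, hA⟩ := Multiset.exists_mem_of_ne_zero h0
  have h2 : 2 ≤ (G.odds F).card := by
    have := Multiset.card_pos.2 h0
    obtain ⟨k, hk⟩ := hev; omega
  have hsub : ∀ a ∈ G.odds F, ∀ x ∈ G.support a, x ∈ G.support H := fun a ha x hx =>
    support_mono ((hF.odd_mem ha).2.trans hDH) hx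
  obtain ⟨z, hz⟩ := support_nonempty (hF.odd_mem hA).1.1.1.ne_empty
  obtain ⟨l, hl, hle, hvis, -⟩ := exists_euler_walk' (J := H \ D) hD z
  obtain ⟨F2, pen, W, hs, hpen, hle2, hge, hpar, -⟩ := exists_pairing l hl (G.odds F)
    (pen := 0) (W := ∅) (fun a ha => by
      obtain ⟨h1, -⟩ := hF.odd_mem ha
      obtain ⟨x, hx⟩ := support_nonempty h1.1.1.ne_empty
      refine ⟨h1, x, hx, hvis x ?_⟩
      rw [Finset.union_sdiff_of_subset hDH]
      exact h.conn' z (hsub A hA z hz) x (hsub a ha x hx)) ⟨by simp, fun _ => rfl, by simp⟩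
    (by rw [zero_add]; exact hPC h2)
  have hpen0 : pen = 0 := by
    rw [Multiset.card_zero, Nat.cast_zero, zero_add, (ZMod.natCast_eq_zero_iff_even).2 hev,
      ZMod.natCast_eq_zero_iff_even] at hpar
    obtain ⟨k, hk⟩ := hpar
    have := hpen.1
    exact Multiset.card_eq_zero.1 (by omega)
  refine ⟨G.evens F + F2, good_of_cover hND hDH hD (fun S hS => ?_) fun e => ?_⟩
  · rcases Multiset.mem_add.1 hS with hS | hS
    exacts [(hF.even_mem hS).1, hs S hS]
  · have e1 := hle2 e
    have e2 := hge e
    have e3 := coverCount_odds_add_evens F e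
    have e4 := hle e
    rw [hF.count] at e3
    rw [hpen0, coverCount_zero] at e1 e2
    rw [ind_false (p := e ∈ (∅ : Finset G.E)) (by simp)] at e1
    rw [coverCount_add]
    omega

theorem good_of_three_le_odds (h : G.Setup H N ∅) {D : Finset G.E} (hND : N ⊆ D) (hDH : D ⊆ H)
    (hD : G.bd D = 0) {F : Multiset (Finset G.E)} (hF : G.IsDecomp F D)
    (hPC : G.PairCompat (G.odds F)) (h3 : 3 ≤ (G.odds F).card) (hodd : ¬ Even (G.odds F).card) :
    ∃ F, G.Good H N ∅ F := by
  obtain ⟨O, r, hr, z, hz, hroot⟩ := exists_root h.conn' (τ := G.odds F)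
    (fun a ha => ⟨(hF.odd_mem ha).1.1, (hF.odd_mem ha).2.trans hDH⟩)
    (fun a b r hr => (hPC a b r hr).1) (by rintro h0; rw [h0] at h3; simp at h3)
  obtain ⟨hO, hOD⟩ := hF.odd_mem (C := O) (by simp [hr])
  have hDO : G.bd (D \ O) = 0 := by rw [bd_sdiff hOD, hD, hO.1.bd, add_zero]
  obtain ⟨l, hl, hle, hvis, -⟩ := exists_euler_walk' (J := H \ D) hDO z
  have hcard : (G.odds F).card = r.card + 1 := by rw [hr, Multiset.card_cons]
  obtain ⟨F2, hs, hle2, hge⟩ := exists_rooted_pairing hl hO hz (τ := r)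
    (fun a ha => by
      obtain ⟨x, hx, hzx⟩ := hroot a ha
      refine ⟨(hF.odd_mem (C := a) (by simp [hr, ha])).1, x, hx, hvis x (hzx.mono ?_)⟩
      intro e he; simp only [Finset.mem_union, Finset.mem_sdiff] at he ⊢; tauto)
    (by rw [← hr]; exact hPC) (by rintro rfl; rw [Multiset.card_zero] at hcard; omega)
    (by
      rw [hcard, Nat.even_add_one, not_not] at hodd
      exact (ZMod.natCast_eq_zero_iff_even).2 hodd)
  refine ⟨G.evens F + F2, good_of_cover hND hDH hD (fun S hS => ?_) fun e => ?_⟩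
  · rcases Multiset.mem_add.1 hS with hS | hS
    exacts [(hF.even_mem hS).1, hs S hS]
  · have e1 := hle2 e
    have e2 := hge e
    have e3 := coverCount_odds_add_evens F e
    have e4 := hle e
    rw [hF.count, hr, coverCount_cons'] at e3
    have e5 := ind_sdiff hOD e
    rw [coverCount_add]
    omega

end Setup

end NoLoop

section Links

variable {G : SignedMultigraph}

/-- The coboundary of a vertex function. -/
def dif (G : SignedMultigraph) (τ : G.V → ZMod 2) (e : G.E) : ZMod 2 :=
  ∑ v, τ v * (G.inc e v : ZMod 2)

theorem sum_mul_pt (τ : G.V → ZMod 2) (x y : G.V) :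
    ∑ v, τ v * (G.pt x + G.pt y) v = τ x + τ y := by
  simp [pt, mul_add, Finset.sum_add_distrib]

theorem dif_eq (τ : G.V → ZMod 2) {e : G.E} {x y : G.V} (h : G.ends e = s(x, y)) :
    G.dif τ e = τ x + τ y := by
  rw [← sum_mul_pt]
  simp only [dif, inc_eq h, pt, Pi.add_apply]
  push_cast; rfl

theorem sum_dif (τ : G.V → ZMod 2) (S : Finset G.E) :
    ∑ e ∈ S, G.dif τ e = ∑ v, τ v * G.bd S v := by
  simp only [dif]
  rw [Finset.sum_comm]
  simp [bd, degIn_eq_sum, Finset.mul_sum]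

/-- A vertex function whose coboundary on `O` is the signature, except at `f`. -/
def IsPot (G : SignedMultigraph) (O : Finset G.E) (f : G.E) (τ : G.V → ZMod 2) : Prop :=
  ∀ e ∈ O, G.dif τ e = G.sgn e + (if e = f then 1 else 0)

theorem isPot_of_erase {O : Finset G.E} (hO : G.IsUnbalancedCircuit O) {f : G.E} (hf : f ∈ O)
    {τ : G.V → ZMod 2} (h : ∀ e ∈ O, e ≠ f → G.dif τ e = G.sgn e) : G.IsPot O f τ := by
  obtain ⟨h1, h2⟩ := unbalanced_iff.1 hO
  have h3 := sum_dif τ O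
  rw [h1.bd] at h3
  simp only [Pi.zero_apply, mul_zero, Finset.sum_const_zero] at h3
  rw [par, ← Finset.add_sum_erase _ _ hf] at h2
  rw [← Finset.add_sum_erase _ _ hf, Finset.sum_congr rfl fun e he =>
    h e (Finset.mem_of_mem_erase he) (Finset.ne_of_mem_erase he)] at h3
  intro e he
  by_cases hef : e = f
  · subst hef
    rw [if_pos rfl]
    generalize ∑ x ∈ O.erase e, G.sgn x = s at h2 h3
    generalize G.dif τ e = d at h3 ⊢
    generalize G.sgn e = t at h2 ⊢
    revert s d t; decide
  · rw [if_neg hef, add_zero, h e he hef]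

/-- An unbalanced circuit `O` of `H` meeting every other edge-disjoint unbalanced circuit in at
least two vertices. -/
structure Rigid (G : SignedMultigraph) (H O : Finset G.E) : Prop where
  unb : G.IsUnbalancedCircuit O
  meet : ∀ C ⊆ H \ O, G.IsUnbalancedCircuit C → ¬ G.Compat O C

theorem Rigid.par_eq_zero {H O : Finset G.E} (h : G.Rigid H O) {Y : Finset G.E} (hY : Y ⊆ H \ O)
    (hb : G.bd Y = 0) (x : G.V) (hx : ∀ v ∈ G.support O, v ∈ G.support Y → v = x) :
    G.par Y = 0 := by
  by_contra hp
  obtain ⟨F, hF⟩ := exists_decomp hb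
  have h1 := hF.card_odds
  have h2 : (G.odds F).card ≠ 0 := by
    intro h3; rw [h3] at h1; exact hp (by rw [← h1]; simp)
  obtain ⟨C, hC⟩ := Multiset.card_pos_iff_exists_mem.1 (Nat.pos_of_ne_zero h2)
  obtain ⟨hCu, hCY⟩ := hF.odd_mem hC
  refine h.meet C (hCY.trans hY) hCu ⟨?_, Finset.card_le_one.2 fun a ha b hb => ?_⟩
  · exact Finset.disjoint_of_subset_right (hCY.trans hY) Finset.disjoint_sdiff
  · rw [Finset.mem_inter] at ha hb
    rw [hx a ha.1 (support_mono hCY ha.2), hx b hb.1 (support_mono hCY hb.2)]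

/-- A set of edges regarded as a single edge between two vertices. -/
structure Link (G : SignedMultigraph) where
  src : G.V
  tgt : G.V
  edges : Finset G.E

/-- The conditions on a link: its edges avoid `O`, and it meets `O` only at its ends. -/
structure IsLink (G : SignedMultigraph) (H O : Finset G.E) (t : G.Link) : Prop where
  sub : t.edges ⊆ H \ O
  bd : G.bd t.edges = G.pt t.src + G.pt t.tgt
  deg : ∀ v ∈ G.support O, G.degIn t.edges v ≤ ind (v = t.src) + ind (v = t.tgt)

/-- The discrepancy between the parity of a link and a vertex function. -/
def res (G : SignedMultigraph) (τ : G.V → ZMod 2) (t : G.Link) : ZMod 2 :=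
  τ t.src + τ t.tgt + G.par t.edges

/-- The boundary of a family of links. -/
def lbd (G : SignedMultigraph) (T : Multiset G.Link) : G.V → ZMod 2 :=
  (T.map fun t => G.pt t.src + G.pt t.tgt).sum

theorem lbd_cons (t : G.Link) (T : Multiset G.Link) :
    G.lbd (t ::ₘ T) = G.pt t.src + G.pt t.tgt + G.lbd T := by simp [lbd]

/-- A family of links of total boundary zero, covering each edge `e` at most `m e` times. -/
structure IsSystem (G : SignedMultigraph) (H O : Finset G.E) (m : G.E → ℕ)
    (T : Multiset G.Link) : Prop where
  link : ∀ t ∈ T, G.IsLink H O t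
  even : G.lbd T = 0
  count : ∀ e, G.coverCount (T.map Link.edges) e ≤ m e

/-- No potential for `O - f` extends to the links. -/
def Inconsistent (G : SignedMultigraph) (O : Finset G.E) (f : G.E) (T : Multiset G.Link) : Prop :=
  ∀ τ, G.IsPot O f τ → ∃ t ∈ T, G.res τ t ≠ 0

theorem not_mem_of_degIn_eq_zero {S : Finset G.E} {v : G.V} (h : G.degIn S v ≤ 0) :
    v ∉ G.support S := degIn_eq_zero.1 (by omega)

theorem IsLink.not_mem {H O : Finset G.E} {t : G.Link} (h : G.IsLink H O t) {v : G.V}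
    (hv : v ∈ G.support O) (h1 : v ≠ t.src) (h2 : v ≠ t.tgt) : v ∉ G.support t.edges := by
  have := h.deg v hv
  rw [ind_false h1, ind_false h2] at this
  exact not_mem_of_degIn_eq_zero this

theorem IsLink.flip {H O : Finset G.E} {t : G.Link} (h : G.IsLink H O t) :
    G.IsLink H O ⟨t.tgt, t.src, t.edges⟩ :=
  ⟨h.sub, by rw [h.bd, add_comm], fun v hv => by rw [add_comm]; exact h.deg v hv⟩

theorem IsLink.par_eq_zero {H O : Finset G.E} (hR : G.Rigid H O) {t : G.Link} (h : G.IsLink H O t)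
    (ht : t.src = t.tgt) : G.par t.edges = 0 := by
  refine hR.par_eq_zero h.sub (by rw [h.bd, ht, pi_add_self]) t.src fun v hv hvs => ?_
  by_contra hc
  exact h.not_mem hv hc (ht ▸ hc) hvs

theorem degIn_symmDiff_le (S T : Finset G.E) (v : G.V) :
    G.degIn (symmDiff S T) v ≤ G.degIn S v + G.degIn T v := by
  have h1 : symmDiff S T ⊆ S ∪ T \ S := by
    intro x; simp only [Finset.mem_symmDiff, Finset.mem_union, Finset.mem_sdiff]; tauto
  have h2 := degIn_mono (G := G) (Finset.sdiff_subset (s := T) (t := S)) v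
  have h3 := degIn_mono (G := G) h1 v
  rw [degIn_union Finset.disjoint_sdiff] at h3
  omega

theorem IsLink.merge {H O : Finset G.E} {a b w : G.V} {A B : Finset G.E}
    (hA : G.IsLink H O ⟨a, w, A⟩) (hB : G.IsLink H O ⟨b, w, B⟩) (hw : w ∉ G.support O) :
    G.IsLink H O ⟨a, b, symmDiff A B⟩ := by
  refine ⟨symmDiff_subset_of hA.sub hB.sub, ?_, fun v hv => ?_⟩
  · have h1 := hA.bd
    have h2 := hB.bd
    dsimp only at h1 h2 ⊢
    rw [bd_symmDiff, h1, h2, add_comm (G.pt a), add_comm (G.pt b), pt_add_cancel, add_comm]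
  · have h1 := hA.deg v hv
    have h2 := hB.deg v hv
    have h3 := degIn_symmDiff_le A B v
    have hvw : v ≠ w := by rintro rfl; exact hw hv
    rw [ind_false (p := v = _) hvw] at h1 h2
    dsimp only at *
    omega

theorem ind_symmDiff_le (S T : Finset G.E) (e : G.E) :
    ind (e ∈ symmDiff S T) ≤ ind (e ∈ S) + ind (e ∈ T) := by
  have := ind_symmDiff S T e; omega

namespace IsSystem

variable {H O : Finset G.E} {m : G.E → ℕ} {T : Multiset G.Link} {a b w : G.V} {A B : Finset G.E}

theorem merge (h : G.IsSystem H O m (⟨a, w, A⟩ ::ₘ ⟨b, w, B⟩ ::ₘ T)) (hw : w ∉ G.support O) :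
    G.IsSystem H O m (⟨a, b, symmDiff A B⟩ ::ₘ T) := by
  refine ⟨fun t ht => ?_, ?_, fun e => ?_⟩
  · rcases Multiset.mem_cons.1 ht with rfl | ht
    · exact (h.link _ (by simp)).merge (h.link _ (by simp)) hw
    · exact h.link t (by simp [ht])
  · have := h.even
    rw [lbd_cons, lbd_cons] at this
    rw [lbd_cons, ← this]
    have hp := pi_add_self (G.pt w)
    dsimp only
    calc _ = G.pt a + G.pt b + (G.pt w + G.pt w) + G.lbd T := by rw [hp, add_zero]
      _ = _ := by abel
  · have h1 := h.count e
    have h2 := ind_symmDiff_le A B e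
    simp only [Multiset.map_cons, coverCount_cons'] at h1 ⊢
    omega

theorem flip (h : G.IsSystem H O m (⟨a, b, A⟩ ::ₘ T)) : G.IsSystem H O m (⟨b, a, A⟩ ::ₘ T) := by
  refine ⟨fun t ht => ?_, ?_, fun e => ?_⟩
  · rcases Multiset.mem_cons.1 ht with rfl | ht
    · exact (h.link _ (Multiset.mem_cons_self _ _)).flip
    · exact h.link t (by simp [ht])
  · have := h.even
    rw [lbd_cons] at this ⊢
    rw [← this, add_comm (G.pt _)]
  · have h1 := h.count e
    simpa only [Multiset.map_cons] using h1

theorem tail {t : G.Link} (h : G.IsSystem H O m (t ::ₘ T)) (ht : t.src = t.tgt) :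
    G.IsSystem H O m T := by
  refine ⟨fun s hs => h.link s (by simp [hs]), ?_, fun e => ?_⟩
  · have := h.even
    rwa [lbd_cons, ht, pi_add_self, zero_add] at this
  · have h1 := h.count e
    simp only [Multiset.map_cons, coverCount_cons'] at h1
    omega

end IsSystem

theorem exists_end_of_lbd_ne_zero {T : Multiset G.Link} {w : G.V} (h : G.lbd T w ≠ 0) :
    ∃ t ∈ T, t.src = w ∨ t.tgt = w := by
  by_contra hc
  push Not at hc
  apply h
  induction T using Multiset.induction with
  | empty => simp [lbd]
  | cons t T ih =>
    obtain ⟨h1, h2⟩ := hc t (by simp)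
    rw [lbd_cons, Pi.add_apply, Pi.add_apply, pt_ne h1.symm, pt_ne h2.symm]
    have := ih (by_contra fun h3 => ?_) fun s hs => hc s (by simp [hs])
    · rw [this]; simp
    · apply h; rw [lbd_cons, Pi.add_apply, Pi.add_apply, pt_ne h1.symm, pt_ne h2.symm]
      simpa using h3

theorem sum_mul_lbd (τ : G.V → ZMod 2) (T : Multiset G.Link) :
    ∑ v, τ v * G.lbd T v = (T.map fun t => τ t.src + τ t.tgt).sum := by
  induction T using Multiset.induction with
  | empty => simp [lbd]
  | cons t T ih =>
    rw [lbd_cons, Multiset.map_cons, Multiset.sum_cons, ← ih, ← sum_mul_pt,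
      ← Finset.sum_add_distrib]
    exact Finset.sum_congr rfl fun v _ => by rw [Pi.add_apply, mul_add]

end Links

section Reduction

variable {G : SignedMultigraph} {H O Q : Finset G.E} {m : G.E → ℕ} {T R : Multiset G.Link}
  {f : G.E} {a b c d w : G.V} {A B C D : Finset G.E}

theorem Inconsistent.flip (h : G.Inconsistent O f (⟨a, b, A⟩ ::ₘ T)) :
    G.Inconsistent O f (⟨b, a, A⟩ ::ₘ T) := by
  intro τ hτ
  obtain ⟨t, ht, htr⟩ := h τ hτ
  rcases Multiset.mem_cons.1 ht with rfl | ht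
  · exact ⟨_, Multiset.mem_cons_self _ _, by simpa only [res, add_comm (τ a)] using htr⟩
  · exact ⟨t, by simp [ht], htr⟩

theorem Inconsistent.tail (hR : G.Rigid H O) {t : G.Link} (ht : G.IsLink H O t)
    (hl : t.src = t.tgt) (h : G.Inconsistent O f (t ::ₘ T)) : G.Inconsistent O f T := by
  intro τ hτ
  obtain ⟨s, hs, hsr⟩ := h τ hτ
  rcases Multiset.mem_cons.1 hs with rfl | hs
  · exact absurd (by rw [res, ht.par_eq_zero hR hl, hl, CharTwo.add_self_eq_zero, add_zero]) hsr
  · exact ⟨s, hs, hsr⟩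

theorem exists_of_not_inconsistent_merge
    (h : G.Inconsistent O f (⟨a, w, A⟩ ::ₘ ⟨b, w, B⟩ ::ₘ T))
    (h' : ¬ G.Inconsistent O f (⟨a, b, symmDiff A B⟩ ::ₘ T)) :
    ∃ τ, G.IsPot O f τ ∧ G.res τ ⟨a, w, A⟩ = 1 ∧ G.res τ ⟨b, w, B⟩ = 1 ∧
      ∀ t ∈ T, G.res τ t = 0 := by
  simp only [Inconsistent] at h'
  push Not at h'
  obtain ⟨τ, hτ, h0⟩ := h'
  have h1 := h0 _ (Multiset.mem_cons_self _ _)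
  have h2 : ∀ t ∈ T, G.res τ t = 0 := fun t ht => h0 t (by simp [ht])
  obtain ⟨t, ht, htr⟩ := h τ hτ
  refine ⟨τ, hτ, ?_, ?_, h2⟩ <;>
  · have h3 : G.res τ ⟨a, w, A⟩ ≠ 0 ∨ G.res τ ⟨b, w, B⟩ ≠ 0 := by
      rcases Multiset.mem_cons.1 ht with rfl | ht
      · exact Or.inl htr
      rcases Multiset.mem_cons.1 ht with rfl | ht
      · exact Or.inr htr
      · exact absurd (h2 t ht) htr
    simp only [res, par_symmDiff] at h1 h3 ⊢
    revert h1 h3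
    generalize τ a = p; generalize τ b = q; generalize τ w = r
    generalize G.par A = s; generalize G.par B = t
    revert p q r s t; decide

theorem Inconsistent.merge_of_isolated (hw : w ∉ G.support O) (haw : a ≠ w) (hbw : b ≠ w)
    (hT : ∀ t ∈ T, t.src ≠ w ∧ t.tgt ≠ w)
    (h : G.Inconsistent O f (⟨a, w, A⟩ ::ₘ ⟨b, w, B⟩ ::ₘ T)) :
    G.Inconsistent O f (⟨a, b, symmDiff A B⟩ ::ₘ T) := by
  by_contra h'
  obtain ⟨τ, hτ, h1, h2, h3⟩ := exists_of_not_inconsistent_merge h h'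
  obtain ⟨t, ht, htr⟩ := h (Function.update τ w (τ w + 1)) (fun e he => by
    obtain ⟨x, y, hxy⟩ := exists_ends e
    rw [← hτ e he, dif_eq _ hxy, dif_eq _ hxy, Function.update_of_ne, Function.update_of_ne]
    · rintro rfl; exact hw (mem_support.2 ⟨e, he, by rw [hxy]; simp⟩)
    · rintro rfl; exact hw (mem_support.2 ⟨e, he, by rw [hxy]; simp⟩))
  rcases Multiset.mem_cons.1 ht with rfl | ht
  · apply htr
    simp only [res, Function.update_of_ne haw, Function.update_self] at h1 ⊢
    rw [← add_assoc, add_right_comm, h1]; decide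
  rcases Multiset.mem_cons.1 ht with rfl | ht
  · apply htr
    simp only [res, Function.update_of_ne hbw, Function.update_self] at h2 ⊢
    rw [← add_assoc, add_right_comm, h2]; decide
  · apply htr
    rw [← h3 t ht, res, Function.update_of_ne (hT t ht).1, Function.update_of_ne (hT t ht).2, res]

theorem not_three_fail (hT : G.lbd (⟨a, w, A⟩ ::ₘ ⟨b, w, B⟩ ::ₘ ⟨c, w, C⟩ ::ₘ ⟨d, w, D⟩ ::ₘ R) = 0)
    {τ₁ τ₂ τ₃ : G.V → ZMod 2}
    (ha₁ : G.res τ₁ ⟨a, w, A⟩ = 1) (hb₁ : G.res τ₁ ⟨b, w, B⟩ = 1) (hc₁ : G.res τ₁ ⟨c, w, C⟩ = 0)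
    (hd₁ : G.res τ₁ ⟨d, w, D⟩ = 0) (hR₁ : ∀ t ∈ R, G.res τ₁ t = 0)
    (ha₂ : G.res τ₂ ⟨a, w, A⟩ = 1) (hb₂ : G.res τ₂ ⟨b, w, B⟩ = 0) (hc₂ : G.res τ₂ ⟨c, w, C⟩ = 1)
    (hd₂ : G.res τ₂ ⟨d, w, D⟩ = 0) (hR₂ : ∀ t ∈ R, G.res τ₂ t = 0)
    (ha₃ : G.res τ₃ ⟨a, w, A⟩ = 1) (hb₃ : G.res τ₃ ⟨b, w, B⟩ = 0) (hc₃ : G.res τ₃ ⟨c, w, C⟩ = 0)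
    (hd₃ : G.res τ₃ ⟨d, w, D⟩ = 1) (hR₃ : ∀ t ∈ R, G.res τ₃ t = 0) : False := by
  have key : ∀ (τ τ' : G.V → ZMod 2) (x : G.V) (X : Finset G.E) (p q : ZMod 2),
      G.res τ ⟨x, w, X⟩ = p → G.res τ' ⟨x, w, X⟩ = q → τ x + τ' x + τ w + τ' w = p + q := by
    rintro τ τ' x X p q rfl rfl
    simp only [res]
    generalize τ x = p; generalize τ' x = q; generalize τ w = r; generalize τ' w = s
    generalize G.par X = t
    revert p q r s t; decide
  set h : G.V → ZMod 2 := fun v =>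
    (τ₁ v + τ₂ v + τ₁ w + τ₂ w) * (τ₁ v + τ₃ v + τ₁ w + τ₃ w) with hh
  have hs := sum_mul_lbd h (⟨a, w, A⟩ ::ₘ ⟨b, w, B⟩ ::ₘ ⟨c, w, C⟩ ::ₘ ⟨d, w, D⟩ ::ₘ R)
  have hR : (R.map fun t => h t.src + h t.tgt).sum = 0 := by
    rw [Multiset.map_congr rfl (g := fun _ => (0 : ZMod 2)), Multiset.sum_map_zero]
    intro t ht
    have key' : ∀ (τ τ' : G.V → ZMod 2), G.res τ t = 0 → G.res τ' t = 0 →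
        τ t.src + τ' t.src = τ t.tgt + τ' t.tgt := by
      intro τ τ'
      simp only [res]
      generalize τ t.src = p; generalize τ t.tgt = q; generalize τ' t.src = r
      generalize τ' t.tgt = s; generalize G.par t.edges = t
      revert p q r s t; decide
    simp only [hh]
    rw [key' _ _ (hR₁ t ht) (hR₂ t ht), key' _ _ (hR₁ t ht) (hR₃ t ht), CharTwo.add_self_eq_zero]
  have hw : h w = 0 := by
    simp only [hh]
    rw [add_assoc (τ₁ w + τ₂ w), CharTwo.add_self_eq_zero, zero_mul]
  rw [hT] at hs
  simp only [Multiset.map_cons, Multiset.sum_cons, hR, hw, Pi.zero_apply, mul_zero,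
    Finset.sum_const_zero] at hs
  simp only [hh] at hs
  rw [key _ _ a A _ _ ha₁ ha₂, key _ _ b B _ _ hb₁ hb₂, key _ _ c C _ _ hc₁ hc₂,
    key _ _ d D _ _ hd₁ hd₂, key _ _ a A _ _ ha₁ ha₃, key _ _ b B _ _ hb₁ hb₃,
    key _ _ c C _ _ hc₁ hc₃, key _ _ d D _ _ hd₁ hd₃] at hs
  revert hs; decide

/-- A system which is inconsistent with the potentials of `O - f` for each `f ∈ Q`. -/
structure IsObstruction (G : SignedMultigraph) (H O Q : Finset G.E) (m : G.E → ℕ)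
    (T : Multiset G.Link) : Prop where
  sys : G.IsSystem H O m T
  inc : ∀ f ∈ Q, G.Inconsistent O f T

namespace IsObstruction

variable {S : Multiset G.Link}

theorem orient (h : G.IsObstruction H O Q m (S + T)) {t : G.Link} (ht : t ∈ T)
    (hw : t.src = w ∨ t.tgt = w) (hl : ∀ t ∈ T, t.src ≠ t.tgt) :
    ∃ a A R, a ≠ w ∧ G.IsObstruction H O Q m (⟨a, w, A⟩ ::ₘ (S + R)) ∧
      R.card + 1 = T.card ∧ R ⊆ T := by
  obtain ⟨R, rfl⟩ := Multiset.exists_cons_of_mem ht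
  have hne := hl t ht
  rw [Multiset.add_cons] at h
  obtain ⟨x, y, X⟩ := t
  rcases hw with rfl | rfl
  · exact ⟨y, X, R, Ne.symm hne, ⟨h.sys.flip, fun f hf => (h.inc f hf).flip⟩, by simp,
      Multiset.subset_cons _ _⟩
  · exact ⟨x, X, R, hne, h, by simp, Multiset.subset_cons _ _⟩

theorem merge_or (h : G.IsObstruction H O Q m (⟨a, w, A⟩ ::ₘ ⟨b, w, B⟩ ::ₘ T))
    (hw : w ∉ G.support O) :
    (∃ t, G.IsObstruction H O Q m (t ::ₘ T)) ∨
      ∃ τ, G.res τ ⟨a, w, A⟩ = 1 ∧ G.res τ ⟨b, w, B⟩ = 1 ∧ ∀ t ∈ T, G.res τ t = 0 := by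
  by_cases hc : ∀ f ∈ Q, G.Inconsistent O f (⟨a, b, symmDiff A B⟩ ::ₘ T)
  · exact Or.inl ⟨_, h.sys.merge hw, hc⟩
  · push Not at hc
    obtain ⟨f, hf, hc⟩ := hc
    obtain ⟨τ, -, h1⟩ := exists_of_not_inconsistent_merge (h.inc f hf) hc
    exact Or.inr ⟨τ, h1⟩

theorem lbd_ne_zero (h : G.lbd (⟨a, w, A⟩ ::ₘ T) w = 0) (haw : a ≠ w) : G.lbd T w ≠ 0 := by
  intro h0
  rw [lbd_cons, Pi.add_apply, Pi.add_apply, h0, pt_ne haw.symm, pt_self] at h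
  revert h; decide

/-- Links at a vertex off `O` can be merged. -/
theorem exists_smaller (h : G.IsObstruction H O Q m T) (hl : ∀ t ∈ T, t.src ≠ t.tgt)
    (hw : w ∉ G.support O) {t : G.Link} (ht : t ∈ T) (htw : t.src = w ∨ t.tgt = w) :
    ∃ T', T'.card < T.card ∧ G.IsObstruction H O Q m T' := by
  rw [← zero_add T] at h
  obtain ⟨a, A, R₁, haw, h₁, hc₁, hs₁⟩ := h.orient ht htw hl
  rw [zero_add] at h₁
  have hl₁ : ∀ t ∈ R₁, t.src ≠ t.tgt := fun t ht => hl t (hs₁ ht)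
  have hz₁ := lbd_ne_zero (by rw [h₁.sys.even]; rfl) haw
  obtain ⟨t, ht, htw⟩ := exists_end_of_lbd_ne_zero hz₁
  rw [← Multiset.singleton_add] at h₁
  obtain ⟨b, B, R₂, hbw, h₂, hc₂, hs₂⟩ := h₁.orient ht htw hl₁
  rw [Multiset.singleton_add] at h₂
  have hl₂ : ∀ t ∈ R₂, t.src ≠ t.tgt := fun t ht => hl₁ t (hs₂ ht)
  by_cases hiso : ∀ t ∈ R₂, t.src ≠ w ∧ t.tgt ≠ w
  · exact ⟨_, by rw [Multiset.card_cons]; omega, h₂.sys.merge hw, fun f hf =>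
      (h₂.inc f hf).merge_of_isolated hw hbw haw hiso⟩
  obtain ⟨t, ht, htw⟩ : ∃ t ∈ R₂, t.src = w ∨ t.tgt = w := by
    by_contra hc; apply hiso; push Not at hc; exact hc
  rw [← Multiset.singleton_add (⟨a, w, A⟩ : G.Link), ← Multiset.cons_add] at h₂
  obtain ⟨c, C, R₃, hcw, h₃, hc₃, hs₃⟩ := h₂.orient ht htw hl₂
  rw [Multiset.cons_add, Multiset.singleton_add] at h₃
  have hl₃ : ∀ t ∈ R₃, t.src ≠ t.tgt := fun t ht => hl₂ t (hs₃ ht)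
  have hz₃ : G.lbd R₃ w ≠ 0 := by
    have h0 := congrFun h₃.sys.even w
    intro h1
    simp only [lbd_cons, Pi.add_apply, pt_ne haw.symm, pt_ne hbw.symm, pt_ne hcw.symm, pt_self,
      h1, Pi.zero_apply] at h0
    revert h0; decide
  obtain ⟨t, ht, htw⟩ := exists_end_of_lbd_ne_zero hz₃
  rw [← Multiset.singleton_add (⟨a, w, A⟩ : G.Link), ← Multiset.cons_add, ← Multiset.cons_add] at h₃
  obtain ⟨d, D, R, -, h₄, hc₄, -⟩ := h₃.orient ht htw hl₃
  rw [Multiset.cons_add, Multiset.cons_add, Multiset.singleton_add] at h₄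
  have done : ∀ t : G.Link, ∀ l l' : G.Link, (t ::ₘ l ::ₘ l' ::ₘ R).card < T.card := by
    intro t l l'
    simp only [Multiset.card_cons]; omega
  have hab : (⟨d, w, D⟩ : G.Link) ::ₘ ⟨c, w, C⟩ ::ₘ ⟨b, w, B⟩ ::ₘ ⟨a, w, A⟩ ::ₘ R =
      ⟨a, w, A⟩ ::ₘ ⟨b, w, B⟩ ::ₘ ⟨c, w, C⟩ ::ₘ ⟨d, w, D⟩ ::ₘ R := by
    simp only [← Multiset.singleton_add]; abel
  have hac : (⟨d, w, D⟩ : G.Link) ::ₘ ⟨c, w, C⟩ ::ₘ ⟨b, w, B⟩ ::ₘ ⟨a, w, A⟩ ::ₘ R =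
      ⟨a, w, A⟩ ::ₘ ⟨c, w, C⟩ ::ₘ ⟨b, w, B⟩ ::ₘ ⟨d, w, D⟩ ::ₘ R := by
    simp only [← Multiset.singleton_add]; abel
  have had : (⟨d, w, D⟩ : G.Link) ::ₘ ⟨c, w, C⟩ ::ₘ ⟨b, w, B⟩ ::ₘ ⟨a, w, A⟩ ::ₘ R =
      ⟨a, w, A⟩ ::ₘ ⟨d, w, D⟩ ::ₘ ⟨b, w, B⟩ ::ₘ ⟨c, w, C⟩ ::ₘ R := by
    simp only [← Multiset.singleton_add]; abel
  rcases merge_or (hab ▸ h₄) hw with ⟨t, h⟩ | ⟨τ₁, ha₁, hb₁, hR₁⟩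
  · exact ⟨_, done _ _ _, h⟩
  rcases merge_or (hac ▸ h₄) hw with ⟨t, h⟩ | ⟨τ₂, ha₂, hc₂, hR₂⟩
  · exact ⟨_, done _ _ _, h⟩
  rcases merge_or (had ▸ h₄) hw with ⟨t, h⟩ | ⟨τ₃, ha₃, hd₃, hR₃⟩
  · exact ⟨_, done _ _ _, h⟩
  exact (not_three_fail (hab ▸ h₄.sys.even) ha₁ hb₁ (hR₁ _ (by simp)) (hR₁ _ (by simp))
    (fun t ht => hR₁ t (by simp [ht])) ha₂ (hR₂ _ (by simp)) hc₂ (hR₂ _ (by simp))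
    (fun t ht => hR₂ t (by simp [ht])) ha₃ (hR₃ _ (by simp)) (hR₃ _ (by simp)) hd₃
    (fun t ht => hR₃ t (by simp [ht]))).elim

/-- An obstruction can be reduced to one all of whose links join distinct vertices of `O`. -/
theorem exists_reduced (hR : G.Rigid H O) (h : G.IsObstruction H O Q m T) :
    ∃ T', G.IsObstruction H O Q m T' ∧
      ∀ t ∈ T', t.src ≠ t.tgt ∧ t.src ∈ G.support O ∧ t.tgt ∈ G.support O := by
  induction hn : T.card using Nat.strong_induction_on generalizing T with
  | _ n ih =>
  subst hn
  by_cases hl : ∀ t ∈ T, t.src ≠ t.tgt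
  · by_cases hO : ∀ t ∈ T, t.src ∈ G.support O ∧ t.tgt ∈ G.support O
    · exact ⟨T, h, fun t ht => ⟨hl t ht, hO t ht⟩⟩
    · push Not at hO
      obtain ⟨t, ht, hO⟩ := hO
      obtain ⟨w, hw, htw⟩ : ∃ w, w ∉ G.support O ∧ (t.src = w ∨ t.tgt = w) := by
        by_cases h1 : t.src ∈ G.support O
        · exact ⟨_, hO h1, Or.inr rfl⟩
        · exact ⟨_, h1, Or.inl rfl⟩
      obtain ⟨T', h1, h2⟩ := h.exists_smaller hl hw ht htw
      exact ih _ h1 h2 rfl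
  · push Not at hl
    obtain ⟨t, ht, hl⟩ := hl
    obtain ⟨R, rfl⟩ := Multiset.exists_cons_of_mem ht
    exact ih _ (by simp) ⟨h.sys.tail hl, fun f hf =>
      (h.inc f hf).tail hR (h.sys.link t (by simp)) hl⟩ rfl

end IsObstruction

end Reduction

section Arcs

variable {G : SignedMultigraph} {H O Q : Finset G.E}

/-- Parities of paths avoiding an edge `f` of a circuit form a potential. -/
theorem exists_potential (hO : G.IsCircuit O) {f : G.E} (hf : f ∈ O) :
    ∃ τ : G.V → ZMod 2, ∀ Y ⊆ O, f ∉ Y → ∀ x ∈ G.support O, ∀ y ∈ G.support O,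
      G.bd Y = G.pt x + G.pt y → τ x + τ y = G.par Y := by
  obtain ⟨o, ho⟩ := support_nonempty hO.1.ne_empty
  have hA : ∀ v, ∃ A, v ∈ G.support O → A ⊆ O ∧ f ∉ A ∧ G.bd A = G.pt o + G.pt v := by
    intro v
    by_cases hv : v ∈ G.support O
    · obtain ⟨P, hP, hb⟩ := exists_bd_of_reach (hO.2.1 o ho v hv)
      by_cases hfP : f ∈ P
      · exact ⟨symmDiff O P, fun _ => ⟨symmDiff_subset_of subset_rfl hP, by
          simp [Finset.mem_symmDiff, hf, hfP], by rw [bd_symmDiff, hO.bd, hb, zero_add]⟩⟩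
      · exact ⟨P, fun _ => ⟨hP, hfP, hb⟩⟩
    · exact ⟨∅, fun h => absurd h hv⟩
  choose A hA using hA
  refine ⟨fun v => G.par (A v), fun Y hY hfY x hx y hy hb => ?_⟩
  obtain ⟨hx1, hx2, hx3⟩ := hA x hx
  obtain ⟨hy1, hy2, hy3⟩ := hA y hy
  have h0 : symmDiff (symmDiff (A x) (A y)) Y = ∅ := by
    by_contra hne
    have := hO.eq_of_subset (symmDiff_subset_of (symmDiff_subset_of hx1 hy1) hY) (by
      rw [bd_symmDiff, bd_symmDiff, hx3, hy3, hb, pt_add_cancel, add_comm (G.pt y),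
        pi_add_self]) hne
    rw [← this] at hf
    simp [Finset.mem_symmDiff, hx2, hy2, hfY] at hf
  have h1 := congrArg G.par h0
  rw [par_symmDiff, par_symmDiff, par_empty] at h1
  exact CharTwo.add_eq_zero.1 h1

theorem degIn_inter_add_sdiff (S T : Finset G.E) (v : G.V) :
    G.degIn (S ∩ T) v + G.degIn (S \ T) v = G.degIn S v := by
  rw [add_comm, ← degIn_union (Finset.disjoint_sdiff_inter S T), Finset.sdiff_union_inter]

theorem sum_mod_two_le (a b c d p q r s : ℕ) (h : a + b + c + d + p + q + r + s ≤ 2) :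
    a % 2 + b % 2 + c % 2 + d % 2 ≤
      (a + b + p + q) % 2 + (a + c + p + r) % 2 + (a + d + q + r) % 2 := by
  have : ∀ n, n ≤ 2 → n = 0 ∨ n = 1 ∨ n = 2 := by omega
  rcases this a (by omega) with rfl | rfl | rfl <;>
  rcases this b (by omega) with rfl | rfl | rfl <;> omega

theorem two_le_sum_degIn_mod (hO : G.IsCircuit O) {K : Finset G.E} (hK : K ⊆ O) {e f : G.E}
    (he : e ∈ K) (hf : f ∈ O) (hfK : f ∉ K) : 2 ≤ ∑ v, G.degIn K v % 2 := by
  have h1 : G.bd K ≠ 0 := fun h =>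
    hfK (hO.eq_of_subset hK h (Finset.ne_empty_of_mem he) ▸ hf)
  obtain ⟨v, hv⟩ := Function.ne_iff.1 h1
  have h2 : (((∑ v, G.degIn K v % 2 : ℕ)) : ZMod 2) = 0 := by
    have h3 := sum_bd K Finset.univ
    have h4 : G.boundary K Finset.univ = ∅ := by
      ext e
      obtain ⟨x, y, hxy⟩ := exists_ends e
      simp [mem_boundary hxy]
    rw [h4, Finset.card_empty, Nat.cast_zero] at h3
    rw [Nat.cast_sum, ← h3]
    exact Finset.sum_congr rfl fun v _ => by simp [bd]
  have h3 : G.degIn K v % 2 ≠ 0 := by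
    intro h; apply hv
    simp only [bd, Pi.zero_apply]
    exact (ZMod.natCast_eq_zero_iff _ _).2 (Nat.dvd_of_mod_eq_zero h)
  have h4 : G.degIn K v % 2 ≤ ∑ v, G.degIn K v % 2 :=
    Finset.single_le_sum (f := fun v => G.degIn K v % 2) (fun _ _ => Nat.zero_le _)
      (Finset.mem_univ v)
  have h5 := (ZMod.natCast_eq_zero_iff _ _).1 h2
  omega

theorem sum_degIn_mod_le {P : Finset G.E} {x y : G.V} (h : G.bd P = G.pt x + G.pt y) :
    ∑ v, G.degIn P v % 2 ≤ 2 := by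
  calc ∑ v, G.degIn P v % 2 ≤ ∑ v, ((if v = x then 1 else 0) + (if v = y then 1 else 0)) := by
        refine Finset.sum_le_sum fun v _ => ?_
        have h1 := congrFun h v
        have h2 : G.degIn P v % 2 = ((if v = x then 1 else 0) + (if v = y then 1 else 0)) % 2 := by
          apply (ZMod.natCast_eq_natCast_iff' _ _ _).1
          simpa [bd, pt] using h1
        rw [h2]; exact Nat.mod_le _ _
    _ = 2 := by simp [Finset.sum_add_distrib]

theorem degIn_mod_two_le (hO : G.IsCircuit O) {A₁ A₂ A₃ : Finset G.E} (h₁ : A₁ ⊆ O) (h₂ : A₂ ⊆ O)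
    (h₃ : A₃ ⊆ O) (v : G.V) :
    G.degIn (O ∩ A₁ ∩ A₂ ∩ A₃) v % 2 + G.degIn (((O ∩ A₁) \ A₂) \ A₃) v % 2 +
      G.degIn (((O \ A₁) ∩ A₂) \ A₃) v % 2 + G.degIn (((O \ A₁) \ A₂) ∩ A₃) v % 2 ≤
      G.degIn A₁ v % 2 + G.degIn A₂ v % 2 + G.degIn A₃ v % 2 := by
  have hv : G.degIn O v ≤ 2 := by
    by_cases hv : v ∈ G.support O
    · exact (hO.2.2 v hv).le
    · rw [degIn_eq_zero.2 hv]; omega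
  have e1 : G.degIn A₁ v = G.degIn (O ∩ A₁) v := by rw [Finset.inter_eq_right.2 h₁]
  have e2 : G.degIn A₂ v = G.degIn (O ∩ A₁ ∩ A₂) v + G.degIn ((O \ A₁) ∩ A₂) v := by
    rw [← degIn_inter_add_sdiff A₂ A₁]
    congr 2 <;> ext x <;> simp only [Finset.mem_inter, Finset.mem_sdiff] <;>
      have := @h₂ x <;> tauto
  have e3 : G.degIn A₃ v = G.degIn (O ∩ A₁ ∩ A₂ ∩ A₃) v + G.degIn (((O ∩ A₁) \ A₂) ∩ A₃) v +
      (G.degIn ((O \ A₁) ∩ A₂ ∩ A₃) v + G.degIn (((O \ A₁) \ A₂) ∩ A₃) v) := by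
    rw [← degIn_inter_add_sdiff A₃ A₁, ← degIn_inter_add_sdiff (A₃ ∩ A₁) A₂,
      ← degIn_inter_add_sdiff (A₃ \ A₁) A₂]
    congr 1 <;> congr 2 <;> ext x <;> simp only [Finset.mem_inter, Finset.mem_sdiff] <;>
      have := @h₃ x <;> tauto
  have d0 := degIn_inter_add_sdiff O A₁ v
  have d1 := degIn_inter_add_sdiff (O ∩ A₁) A₂ v
  have d2 := degIn_inter_add_sdiff (O \ A₁) A₂ v
  have d3 := degIn_inter_add_sdiff (O ∩ A₁ ∩ A₂) A₃ v
  have d4 := degIn_inter_add_sdiff ((O ∩ A₁) \ A₂) A₃ v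
  have d5 := degIn_inter_add_sdiff ((O \ A₁) ∩ A₂) A₃ v
  have d6 := degIn_inter_add_sdiff ((O \ A₁) \ A₂) A₃ v
  have a1 : G.degIn A₁ v = G.degIn (O ∩ A₁ ∩ A₂ ∩ A₃) v + G.degIn (((O ∩ A₁) \ A₂) \ A₃) v +
      G.degIn ((O ∩ A₁ ∩ A₂) \ A₃) v + G.degIn (((O ∩ A₁) \ A₂) ∩ A₃) v := by
    rw [e1, ← d1, ← d3, ← d4]; ring
  have a2 : G.degIn A₂ v = G.degIn (O ∩ A₁ ∩ A₂ ∩ A₃) v + G.degIn (((O \ A₁) ∩ A₂) \ A₃) v +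
      G.degIn ((O ∩ A₁ ∩ A₂) \ A₃) v + G.degIn ((O \ A₁) ∩ A₂ ∩ A₃) v := by
    rw [e2, ← d3, ← d5]; ring
  have a3 : G.degIn A₃ v = G.degIn (O ∩ A₁ ∩ A₂ ∩ A₃) v + G.degIn (((O \ A₁) \ A₂) ∩ A₃) v +
      G.degIn (((O ∩ A₁) \ A₂) ∩ A₃) v + G.degIn ((O \ A₁) ∩ A₂ ∩ A₃) v := by
    rw [e3]; ring
  rw [← d0, ← d1, ← d2, ← d3, ← d4, ← d5, ← d6] at hv
  rw [a1, a2, a3]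
  exact sum_mod_two_le _ _ _ _ _ _ _ (G.degIn (((O \ A₁) \ A₂) \ A₃) v) (by linarith)

/-- Among three arcs of a circuit with a common edge, one is contained in the union of the other
two. -/
theorem arcs_not_private (hO : G.IsCircuit O) {A₁ A₂ A₃ : Finset G.E} {x₁ y₁ x₂ y₂ x₃ y₃ : G.V}
    (h₁ : A₁ ⊆ O) (h₂ : A₂ ⊆ O) (h₃ : A₃ ⊆ O) (hb₁ : G.bd A₁ = G.pt x₁ + G.pt y₁)
    (hb₂ : G.bd A₂ = G.pt x₂ + G.pt y₂) (hb₃ : G.bd A₃ = G.pt x₃ + G.pt y₃) {e f₁ f₂ f₃ : G.E}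
    (he₁ : e ∈ A₁) (he₂ : e ∈ A₂) (he₃ : e ∈ A₃) (h11 : f₁ ∈ A₁) (h12 : f₁ ∉ A₂) (h13 : f₁ ∉ A₃)
    (h21 : f₂ ∉ A₁) (h22 : f₂ ∈ A₂) (h23 : f₂ ∉ A₃) (h31 : f₃ ∉ A₁) (h32 : f₃ ∉ A₂)
    (h33 : f₃ ∈ A₃) : False := by
  have k1 := two_le_sum_degIn_mod hO (K := O ∩ A₁ ∩ A₂ ∩ A₃) (e := e) (f := f₁)
    (fun x hx => by simp only [Finset.mem_inter] at hx; tauto)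
    (by simp [he₁, he₂, he₃, h₁ he₁]) (h₁ h11) (by simp [h12])
  have k2 := two_le_sum_degIn_mod hO (K := ((O ∩ A₁) \ A₂) \ A₃) (e := f₁) (f := e)
    (fun x hx => by simp only [Finset.mem_inter, Finset.mem_sdiff] at hx; tauto)
    (by simp [h11, h12, h13, h₁ h11]) (h₁ he₁) (by simp [he₂])
  have k3 := two_le_sum_degIn_mod hO (K := ((O \ A₁) ∩ A₂) \ A₃) (e := f₂) (f := e)
    (fun x hx => by simp only [Finset.mem_inter, Finset.mem_sdiff] at hx; tauto)
    (by simp [h21, h22, h23, h₂ h22]) (h₁ he₁) (by simp [he₁])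
  have k4 := two_le_sum_degIn_mod hO (K := ((O \ A₁) \ A₂) ∩ A₃) (e := f₃) (f := e)
    (fun x hx => by simp only [Finset.mem_inter, Finset.mem_sdiff] at hx; tauto)
    (by simp [h31, h32, h33, h₃ h33]) (h₁ he₁) (by simp [he₁])
  have l1 := sum_degIn_mod_le hb₁
  have l2 := sum_degIn_mod_le hb₂
  have l3 := sum_degIn_mod_le hb₃
  have key : ∑ v, (G.degIn (O ∩ A₁ ∩ A₂ ∩ A₃) v % 2 + G.degIn (((O ∩ A₁) \ A₂) \ A₃) v % 2 +
      G.degIn (((O \ A₁) ∩ A₂) \ A₃) v % 2 + G.degIn (((O \ A₁) \ A₂) ∩ A₃) v % 2) ≤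
      ∑ v, (G.degIn A₁ v % 2 + G.degIn A₂ v % 2 + G.degIn A₃ v % 2) :=
    Finset.sum_le_sum fun v _ => degIn_mod_two_le hO h₁ h₂ h₃ v
  simp only [Finset.sum_add_distrib] at key
  omega

/-- A link and an arc of `O` of the same parity form a balanced circuit. -/
theorem IsLink.exists_arc (hR : G.Rigid H O) {t : G.Link} (h : G.IsLink H O t)
    (hne : t.src ≠ t.tgt) (hs : t.src ∈ G.support O) (ht : t.tgt ∈ G.support O) :
    ∃ P A, P ⊆ t.edges ∧ A ⊆ O ∧ G.bd A = G.pt t.src + G.pt t.tgt ∧ G.par A = G.par t.edges ∧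
      G.IsBalancedCircuit (P ∪ A) := by
  obtain ⟨P, hP, hPb, hPa⟩ := exists_acyc (P := t.edges)
  rw [h.bd] at hPb
  have hPp := hPa.isPath hPb hne
  have hPO : G.support P ∩ G.support O ⊆ {t.src, t.tgt} := by
    intro v hv
    rw [Finset.mem_inter] at hv
    by_contra hc
    simp only [Finset.mem_insert, Finset.mem_singleton, not_or] at hc
    exact h.not_mem hv.2 hc.1 hc.2 (support_mono hP hv.1)
  have hpar : G.par (t.edges \ P) = 0 := by
    refine hR.par_eq_zero (Finset.sdiff_subset.trans h.sub) (by
      rw [bd_sdiff hP, h.bd, hPb, pi_add_self]) t.src fun v hv hvs => ?_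
    exfalso
    have h1 := h.deg v hv
    have h2 := degIn_inter_add_sdiff t.edges P v
    rw [Finset.inter_eq_right.2 hP] at h2
    have h3 := degIn_pos.2 hvs
    by_cases h4 : v = t.src
    · rw [ind_true h4, ind_false (p := v = t.tgt) (h4 ▸ hne)] at h1
      have := hPp.2.2.2.2.2.1
      rw [← h4] at this; omega
    · by_cases h5 : v = t.tgt
      · rw [ind_true h5, ind_false (p := v = t.src) h4] at h1
        have := hPp.2.2.2.2.2.2.1
        rw [← h5] at this; omega
      · exact h.not_mem hv h4 h5 (support_mono Finset.sdiff_subset hvs)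
  rw [par_sdiff hP] at hpar
  have hdj : Disjoint P O := Finset.disjoint_of_subset_left (hP.trans h.sub)
    Finset.sdiff_disjoint
  have main : ∀ A ⊆ O, G.IsPath A t.src t.tgt → G.par A = G.par t.edges →
      ∃ P A, P ⊆ t.edges ∧ A ⊆ O ∧ G.bd A = G.pt t.src + G.pt t.tgt ∧
        G.par A = G.par t.edges ∧ G.IsBalancedCircuit (P ∪ A) := by
    intro A hA hAp hpA
    have hdA := Finset.disjoint_of_subset_right hA hdj
    refine ⟨P, A, hP, hA, hAp.bd, hpA, balanced_iff.2 ⟨hPp.join hAp hdA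
      ((Finset.inter_subset_inter_left (support_mono hA)).trans hPO), ?_⟩⟩
    rw [par_union hdA, hpA, add_comm]; exact hpar
  obtain ⟨A, hA, hA1, hA2, -⟩ := hR.unb.1.split hs ht hne
  by_cases hpA : G.par A = G.par t.edges
  · exact main A hA hA1 hpA
  · refine main _ Finset.sdiff_subset hA2 ?_
    rw [par_sdiff hA, (unbalanced_iff.1 hR.unb).2]
    generalize G.par A = p at hpA ⊢; generalize G.par t.edges = q at hpA ⊢
    revert p q; decide

end Arcs

section Initial

variable {G : SignedMultigraph} {H N O D Q : Finset G.E}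

/-- A single edge regarded as a link. -/
def edgeLink (G : SignedMultigraph) (e : G.E) : G.Link :=
  ⟨(exists_ends e).choose, (exists_ends e).choose_spec.choose, {e}⟩

theorem ends_eq_edgeLink (e : G.E) : G.ends e = s((G.edgeLink e).src, (G.edgeLink e).tgt) :=
  (exists_ends e).choose_spec.choose_spec

theorem edges_edgeLink (e : G.E) : (G.edgeLink e).edges = {e} := rfl

theorem isLink_edgeLink {e : G.E} (he : e ∈ H \ O) : G.IsLink H O (G.edgeLink e) := by
  refine ⟨by rw [edges_edgeLink]; simpa using he, bd_singleton (ends_eq_edgeLink e),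
    fun v _ => ?_⟩
  rw [edges_edgeLink, degIn_singleton (ends_eq_edgeLink e), ind_eq, ind_eq]

theorem lbd_edgeLink (M : Multiset G.E) : G.lbd (M.map G.edgeLink) = G.mbd M := by
  induction M using Multiset.induction with
  | empty => simp [lbd]; rfl
  | cons e M ih => rw [Multiset.map_cons, lbd_cons, mbd_cons (ends_eq_edgeLink e), ih]

theorem coverCount_edgeLink (M : Multiset G.E) (e : G.E) :
    G.coverCount ((M.map G.edgeLink).map Link.edges) e = M.count e := by
  induction M using Multiset.induction with
  | empty => simp
  | cons f M ih =>
    rw [Multiset.map_cons, Multiset.map_cons, coverCount_cons', ih, Multiset.count_cons,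
      edges_edgeLink, ind_eq, add_comm]
    simp

theorem Setup.isObstruction (h : G.Setup H N ∅) (hDH : D ⊆ H) (hD : G.bd D = 0)
    (hO : G.IsCircuit O) (hOD : O ⊆ D) :
    G.IsObstruction H O (O ∩ N) (fun e => ind (e ∈ D \ O) + 2 * ind (e ∈ H \ D))
      (((D \ O).val + 2 • (H \ D).val).map G.edgeLink) := by
  refine ⟨⟨fun t ht => ?_, ?_, fun e => ?_⟩, fun f hf τ hτ => ?_⟩
  · obtain ⟨e, he, rfl⟩ := Multiset.mem_map.1 ht
    apply isLink_edgeLink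
    rcases Multiset.mem_add.1 he with he | he
    · exact Finset.sdiff_subset_sdiff hDH subset_rfl he
    · have he : e ∈ H \ D := Multiset.mem_of_mem_nsmul he
      exact Finset.sdiff_subset_sdiff subset_rfl hOD he
  · rw [lbd_edgeLink, mbd_add, mbd_two_nsmul, add_zero, mbd_val, bd_sdiff hOD, hD, hO.bd, add_zero]
  · rw [coverCount_edgeLink, Multiset.count_add, Multiset.count_nsmul, count_val, count_val]
  · by_contra hc
    push Not at hc
    obtain ⟨hfO, hfN⟩ := Finset.mem_inter.1 hf
    have h1 : ∀ e ∈ H, e ≠ f → G.dif τ e = G.sgn e := by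
      intro e he hef
      by_cases heO : e ∈ O
      · rw [hτ e heO, if_neg hef, add_zero]
      · have := hc (G.edgeLink e) (Multiset.mem_map_of_mem _ (by
          rw [Multiset.mem_add]
          by_cases heD : e ∈ D
          · exact Or.inl (Finset.mem_sdiff.2 ⟨heD, heO⟩)
          · exact Or.inr (by
              rw [two_nsmul, Multiset.mem_add]
              exact Or.inl (Finset.mem_sdiff.2 ⟨he, heD⟩))))
        rw [res, edges_edgeLink, par_singleton, ← dif_eq _ (ends_eq_edgeLink e)] at this
        exact CharTwo.add_eq_zero.1 this
    have h2 : ∀ u v, G.Reach (H \ N) u v → τ u = τ v := by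
      intro u v huv
      induction huv with
      | refl => rfl
      | tail _ hvw ih =>
        obtain ⟨e, he, hxy⟩ := hvw
        obtain ⟨heH, heN⟩ := Finset.mem_sdiff.1 he
        have h3 := h1 e heH (by rintro rfl; exact heN hfN)
        rw [dif_eq _ hxy, (zmod_two_cases _).resolve_right (mt (h.neg e heH).1 heN)] at h3
        rw [ih]; exact CharTwo.add_eq_zero.1 h3
    obtain ⟨g, hg, hgf⟩ := Finset.exists_mem_ne (Nat.lt_of_succ_le h.two) f
    obtain ⟨x, y, hxy⟩ := exists_ends g
    have h3 := h1 g (h.hN hg) hgf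
    rw [dif_eq _ hxy, h2 x y (h.reach_ends_edge (h.hN hg) _ _ hxy), CharTwo.add_self_eq_zero,
      (h.neg g (h.hN hg)).2 hg] at h3
    revert h3; decide

/-- The arcs of the links of an obstruction cover `Q`. -/
theorem IsObstruction.exists_mem_arc {m : G.E → ℕ} {T : Multiset G.Link}
    (h : G.IsObstruction H O Q m T) (hO : G.IsUnbalancedCircuit O) {A : G.Link → Finset G.E}
    (hT : ∀ t ∈ T, t.src ∈ G.support O ∧ t.tgt ∈ G.support O)
    (hA : ∀ t ∈ T, A t ⊆ O ∧ G.bd (A t) = G.pt t.src + G.pt t.tgt ∧ G.par (A t) = G.par t.edges)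
    {f : G.E} (hfQ : f ∈ Q) (hfO : f ∈ O) : ∃ t ∈ T, f ∈ A t := by
  by_contra hc
  push Not at hc
  obtain ⟨τ, hτ⟩ := exists_potential hO.1 hfO
  obtain ⟨t, ht, htr⟩ := h.inc f hfQ τ (isPot_of_erase hO hfO fun e he hef => by
    obtain ⟨x, y, hxy⟩ := exists_ends e
    rw [dif_eq _ hxy, hτ {e} (by simpa using he) (by simpa using hef.symm) x
      (mem_support.2 ⟨e, he, mem_ends_left hxy⟩) y (mem_support.2 ⟨e, he, mem_ends_right hxy⟩)
      (bd_singleton hxy), par_singleton])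
  obtain ⟨h1, h2, h3⟩ := hA t ht
  apply htr
  rw [res, hτ _ h1 (hc t ht) _ (hT t ht).1 _ (hT t ht).2 h2, h3, CharTwo.add_self_eq_zero]

theorem exists_three_of_coverCount {ι : Type} (T : Multiset ι) (A : ι → Finset G.E) {e : G.E}
    (h : 3 ≤ G.coverCount (T.map A) e) :
    ∃ a b c R, T = a ::ₘ b ::ₘ c ::ₘ R ∧ e ∈ A a ∧ e ∈ A b ∧ e ∈ A c := by
  have key : ∀ T : Multiset ι, 1 ≤ G.coverCount (T.map A) e → ∃ a R, T = a ::ₘ R ∧ e ∈ A a ∧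
      G.coverCount (T.map A) e = G.coverCount (R.map A) e + 1 := by
    intro T hT
    obtain ⟨S, hS, heS⟩ := coverCount_pos.1 hT
    obtain ⟨a, ha, rfl⟩ := Multiset.mem_map.1 hS
    obtain ⟨R, rfl⟩ := Multiset.exists_cons_of_mem ha
    exact ⟨a, R, rfl, heS, by rw [Multiset.map_cons, coverCount_cons', ind_true heS, add_comm]⟩
  obtain ⟨a, R₁, rfl, ha, h1⟩ := key T (by omega)
  obtain ⟨b, R₂, rfl, hb, h2⟩ := key R₁ (by omega)
  obtain ⟨c, R₃, rfl, hc, h3⟩ := key R₂ (by omega)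
  exact ⟨a, b, c, R₃, rfl, ha, hb, hc⟩

/-- A family of arcs of a circuit has a subfamily covering the same edges of `Q` which covers every
edge at most twice. -/
theorem exists_arc_subfamily (hO : G.IsCircuit O) {T : Multiset G.Link} {A : G.Link → Finset G.E}
    (hA : ∀ t ∈ T, A t ⊆ O ∧ G.bd (A t) = G.pt t.src + G.pt t.tgt)
    (hQ : ∀ f ∈ Q, ∃ t ∈ T, f ∈ A t) :
    ∃ T' ≤ T, (∀ f ∈ Q, ∃ t ∈ T', f ∈ A t) ∧ ∀ e, G.coverCount (T'.map A) e ≤ 2 := by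
  induction hn : T.card using Nat.strong_induction_on generalizing T with
  | _ n ih =>
  subst hn
  by_cases hmin : ∃ t R, T = t ::ₘ R ∧ ∀ f ∈ Q, ∃ t ∈ R, f ∈ A t
  · obtain ⟨t, R, rfl, hR⟩ := hmin
    obtain ⟨T', h1, h2⟩ := ih R.card (by simp) (fun t ht => hA t (by simp [ht])) hR rfl
    exact ⟨T', h1.trans (Multiset.le_cons_self _ _), h2⟩
  · refine ⟨T, le_rfl, hQ, fun e => ?_⟩
    by_contra hc
    obtain ⟨a, b, c, R, hT, ha, hb, hcc⟩ := exists_three_of_coverCount T A (e := e) (by omega)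
    have key : ∀ t S, T = t ::ₘ S → ∃ f ∈ A t, ∀ s ∈ S, f ∉ A s := by
      intro t S hS
      by_contra hcon
      push Not at hcon
      refine hmin ⟨t, S, hS, fun f hf => ?_⟩
      obtain ⟨s, hs, hfs⟩ := hQ f hf
      rw [hS] at hs
      rcases Multiset.mem_cons.1 hs with rfl | hs
      · exact hcon f hfs
      · exact ⟨s, hs, hfs⟩
    obtain ⟨f₁, h11, h1⟩ := key a _ hT
    obtain ⟨f₂, h22, h2⟩ := key b (a ::ₘ c ::ₘ R) (by rw [hT, Multiset.cons_swap])
    obtain ⟨f₃, h33, h3⟩ := key c (a ::ₘ b ::ₘ R) (by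
      rw [hT, Multiset.cons_swap b, Multiset.cons_swap a])
    have hA1 := hA a (by simp [hT])
    have hA2 := hA b (by simp [hT])
    have hA3 := hA c (by simp [hT])
    exact arcs_not_private hO hA1.1 hA2.1 hA3.1 hA1.2 hA2.2 hA3.2 ha hb hcc h11 (h1 b (by simp))
      (h1 c (by simp)) (h2 a (by simp)) h22 (h2 c (by simp)) (h3 a (by simp)) (h3 b (by simp)) h33

end Initial

section Base

variable {G : SignedMultigraph} {H N O D : Finset G.E}

theorem coverCount_map_union_le {ι : Type} (T : Multiset ι) (P A : ι → Finset G.E) (e : G.E) :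
    G.coverCount (T.map fun t => P t ∪ A t) e ≤
      G.coverCount (T.map P) e + G.coverCount (T.map A) e := by
  induction T using Multiset.induction with
  | empty => simp
  | cons t T ih =>
    simp only [Multiset.map_cons, coverCount_cons']
    have := ind_union_le (P t) (A t) e
    omega

theorem coverCount_map_le {ι : Type} {T T' : Multiset ι} (hT : T' ≤ T) {P Q : ι → Finset G.E}
    (h : ∀ t ∈ T, P t ⊆ Q t) (e : G.E) :
    G.coverCount (T'.map P) e ≤ G.coverCount (T.map Q) e := by
  obtain ⟨R, rfl⟩ := Multiset.le_iff_exists_add.1 hT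
  rw [Multiset.map_add, coverCount_add]
  clear hT
  induction T' using Multiset.induction with
  | empty => simp
  | cons t T' ih =>
    simp only [Multiset.map_cons, coverCount_cons']
    have h1 := ind_le_of_subset (h t (by simp)) e
    have h2 := ih fun s hs => h s (by simp only [Multiset.cons_add, Multiset.mem_cons, hs, or_true])
    omega

theorem coverCount_eq_zero {F : Multiset (Finset G.E)} {e : G.E} (h : ∀ S ∈ F, e ∉ S) :
    G.coverCount F e = 0 := by
  by_contra hc
  obtain ⟨S, hS, heS⟩ := coverCount_pos.1 (Nat.pos_of_ne_zero hc)
  exact h S hS heS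

namespace Setup

theorem good_of_compat (h : G.Setup H N ∅) (hND : N ⊆ D) (hDH : D ⊆ H) (hD : G.bd D = 0)
    {F : Multiset (Finset G.E)} (hF : G.IsDecomp F D) (hO : G.odds F = {O}) {C : Finset G.E}
    (hC : C ⊆ H) (hCu : G.IsUnbalancedCircuit C) (hOC : G.Compat O C) : ∃ F, G.Good H N ∅ F := by
  obtain ⟨hOu, hOD⟩ := hF.odd_mem (C := O) (by simp [hO])
  obtain ⟨x, hx⟩ := support_nonempty hOu.1.1.ne_empty
  obtain ⟨y, hy⟩ := support_nonempty hCu.1.1.ne_empty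
  obtain ⟨S, hS, hOS, -, hSH⟩ := exists_barbell hOu hCu hOC hx hy
    (h.conn' x (support_mono (hOD.trans hDH) hx) y (support_mono hC hy))
  refine ⟨S ::ₘ G.evens F, good_of_cover hND hDH hD (fun S' hS' => ?_) fun e => ?_⟩
  · rcases Multiset.mem_cons.1 hS' with rfl | hS'
    exacts [hS, (hF.even_mem hS').1]
  · have e1 := coverCount_odds_add_evens F e
    rw [hO, coverCount_singleton, hF.count] at e1
    have e2 := ind_sdiff hDH e
    have e3 := ind_sdiff hOD e
    have e4 := ind_le_of_subset hOS e
    have e5 := ind_le_of_subset (hSH.trans (Finset.union_subset (Finset.union_subset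
      (hOD.trans hDH) hC) subset_rfl)) e
    have e6 := ind_le_one (e ∈ S)
    rw [coverCount_cons']
    omega

theorem good_of_rigid (h : G.Setup H N ∅) (hND : N ⊆ D) (hDH : D ⊆ H) (hD : G.bd D = 0)
    {F : Multiset (Finset G.E)} (hF : G.IsDecomp F D) (hO : G.odds F = {O}) (hR : G.Rigid H O) :
    ∃ F, G.Good H N ∅ F := by
  obtain ⟨hOu, hOD⟩ := hF.odd_mem (C := O) (by simp [hO])
  obtain ⟨T, hT, hT'⟩ := (h.isObstruction hDH hD hOu.1 hOD).exists_reduced hR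
  have hPA : ∀ t, ∃ P A, t ∈ T → P ⊆ t.edges ∧ A ⊆ O ∧ G.bd A = G.pt t.src + G.pt t.tgt ∧
      G.par A = G.par t.edges ∧ G.IsBalancedCircuit (P ∪ A) := by
    intro t
    by_cases ht : t ∈ T
    · obtain ⟨h1, h2, h3⟩ := hT' t ht
      obtain ⟨P, A, hPA⟩ := (hT.sys.link t ht).exists_arc hR h1 h2 h3
      exact ⟨P, A, fun _ => hPA⟩
    · exact ⟨∅, ∅, fun h => absurd h ht⟩
  choose P A hPA using hPA
  obtain ⟨T', hTT', hcov, hle⟩ := exists_arc_subfamily hOu.1 (T := T) (A := A) (Q := O ∩ N)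
    (fun t ht => ⟨(hPA t ht).2.1, (hPA t ht).2.2.1⟩) fun f hf =>
      hT.exists_mem_arc hOu (fun t ht => (hT' t ht).2)
        (fun t ht => ⟨(hPA t ht).2.1, (hPA t ht).2.2.1, (hPA t ht).2.2.2.1⟩) hf
        (Finset.mem_inter.1 hf).1
  have hmem : ∀ t ∈ T', t ∈ T := fun t ht => Multiset.mem_of_le hTT' ht
  have hev : ∀ e, G.coverCount (G.evens F) e = ind (e ∈ D \ O) := fun e => by
    have e1 := coverCount_odds_add_evens F e
    rw [hO, coverCount_singleton, hF.count] at e1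
    have e3 := ind_sdiff hOD e
    omega
  have hA0 : ∀ e ∉ O, G.coverCount (T'.map A) e = 0 := fun e he => coverCount_eq_zero (by
    intro S hS
    obtain ⟨t, ht, rfl⟩ := Multiset.mem_map.1 hS
    exact fun heA => he ((hPA t (hmem t ht)).2.1 heA))
  have hP : ∀ e, G.coverCount (T'.map P) e ≤ ind (e ∈ D \ O) + 2 * ind (e ∈ H \ D) := fun e =>
    (coverCount_map_le hTT' (fun t ht => (hPA t ht).1) e).trans (hT.sys.count e)
  have hmain : ∀ e, G.coverCount (G.evens F + T'.map fun t => P t ∪ A t) e ≤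
      ind (e ∈ D \ O) + (ind (e ∈ D \ O) + 2 * ind (e ∈ H \ D)) + G.coverCount (T'.map A) e :=
    fun e => by
    rw [coverCount_add, hev]
    have h1 := coverCount_map_union_le T' P A e
    have h2 := hP e
    omega
  refine ⟨G.evens F + T'.map fun t => P t ∪ A t, fun S hS => ?_, fun e he => ?_, fun e => ?_,
    by simp, fun f hf => ?_⟩
  · rcases Multiset.mem_add.1 hS with hS | hS
    · exact (hF.even_mem hS).1
    · obtain ⟨t, ht, rfl⟩ := Multiset.mem_map.1 hS
      exact Or.inl (hPA t (hmem t ht)).2.2.2.2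
  · have h1 := hmain e
    rw [hA0 e fun heO => he (hDH (hOD heO)), ind_false (p := e ∈ D \ O) (by
      intro h2; exact he (hDH (Finset.mem_sdiff.1 h2).1)), ind_false (p := e ∈ H \ D) (by
      intro h2; exact he (Finset.mem_sdiff.1 h2).1)] at h1
    omega
  · have h1 := hmain e
    have h2 := ind_le_one (e ∈ D)
    have h3 := ind_sdiff hDH e
    have h4 := ind_sdiff hOD e
    have h5 := ind_le_one (e ∈ H)
    by_cases heO : e ∈ O
    · have h6 := hle e
      rw [ind_true heO] at h4
      rw [ind_true (hOD heO)] at h3 h4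
      omega
    · rw [hA0 e heO] at h1
      omega
  · by_cases hfO : f ∈ O
    · obtain ⟨t, ht, hft⟩ := hcov f (Finset.mem_inter.2 ⟨hfO, hf⟩)
      refine ⟨P t ∪ A t, Finset.mem_union_right _ hft, (hPA t (hmem t ht)).2.2.2.2.1.bd,
        fun x hx => ?_⟩
      exact coverCount_pos.2 ⟨P t ∪ A t, Multiset.mem_add.2 (Or.inr
        (Multiset.mem_map_of_mem _ ht)), hx⟩
    · refine ⟨D \ O, Finset.mem_sdiff.2 ⟨hND hf, hfO⟩, by
        rw [bd_sdiff hOD, hD, hOu.1.bd, add_zero], fun x hx => ?_⟩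
      rw [coverCount_add, hev, ind_true hx]
      omega

theorem good_of_odds_eq_singleton (h : G.Setup H N ∅) (hND : N ⊆ D) (hDH : D ⊆ H)
    (hD : G.bd D = 0) {F : Multiset (Finset G.E)} (hF : G.IsDecomp F D) (hO : G.odds F = {O}) :
    ∃ F, G.Good H N ∅ F := by
  by_cases hC : ∃ C ⊆ H \ O, G.IsUnbalancedCircuit C ∧ G.Compat O C
  · obtain ⟨C, hC, hCu, hOC⟩ := hC
    exact h.good_of_compat hND hDH hD hF hO (hC.trans Finset.sdiff_subset) hCu hOC
  · push Not at hC
    exact h.good_of_rigid hND hDH hD hF hO ⟨(hF.odd_mem (by simp [hO])).1, hC⟩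

theorem exists_good {L : Finset G.E} (h : G.Setup H N L) : ∃ F, G.Good H N L F := by
  obtain rfl | ⟨ℓ, hℓ⟩ := L.eq_empty_or_nonempty
  · obtain ⟨D, hND, hDH, hD⟩ := h.exists_even
    obtain ⟨F, hF, -, hPC⟩ := exists_max_decomp (S := D) 0 (by
      obtain ⟨F, hF⟩ := exists_decomp hD
      exact ⟨F, hF, Nat.zero_le _⟩)
    rw [zero_add] at hPC
    by_cases hev : Even (G.odds F).card
    · exact h.good_of_even_odds hND hDH hD hF hPC hev
    · by_cases h1 : (G.odds F).card = 1
      · obtain ⟨O, hO⟩ := Multiset.card_eq_one.1 h1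
        exact h.good_of_odds_eq_singleton hND hDH hD hF hO
      · have : 3 ≤ (G.odds F).card := by
          rw [Nat.not_even_iff_odd] at hev
          obtain ⟨k, hk⟩ := hev; omega
        exact h.good_of_three_le_odds hND hDH hD hF (hPC (by omega)) this hev
  · exact h.good_of_loop hℓ

end Setup

end Base

section Inside

variable {G : SignedMultigraph} {H N : Finset G.E} {U W : Finset G.V} {b : G.E}

/-- The edges of `H` with both ends in `U`. -/
def inside (G : SignedMultigraph) (H : Finset G.E) (U : Finset G.V) : Finset G.E :=
  H.filter fun e => ∀ v ∈ G.ends e, v ∈ U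

theorem mem_inside {e : G.E} {x y : G.V} (h : G.ends e = s(x, y)) :
    e ∈ G.inside H U ↔ e ∈ H ∧ x ∈ U ∧ y ∈ U := by
  simp [inside, h]

theorem inside_subset : G.inside H U ⊆ H := Finset.filter_subset _ _

theorem support_inside {v : G.V} (h : v ∈ G.support (G.inside H U)) : v ∈ U := by
  obtain ⟨e, he, hv⟩ := mem_support.1 h
  exact (Finset.mem_filter.1 he).2 v hv

theorem disjoint_inside_compl : Disjoint (G.inside H U) (G.inside H Uᶜ) := by
  rw [Finset.disjoint_left]
  intro e h1 h2
  obtain ⟨x, y, hxy⟩ := exists_ends e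
  rw [mem_inside hxy] at h1 h2
  exact Finset.mem_compl.1 h2.2.1 h1.2.1

theorem boundary_compl : G.boundary H Uᶜ = G.boundary H U := by
  ext e
  obtain ⟨x, y, hxy⟩ := exists_ends e
  simp only [mem_boundary hxy, Finset.mem_compl, not_iff_not]

theorem mem_inside_or {e : G.E} (he : e ∈ H) :
    e ∈ G.inside H U ∨ e ∈ G.inside H Uᶜ ∨ e ∈ G.boundary H U := by
  obtain ⟨x, y, hxy⟩ := exists_ends e
  simp only [mem_boundary hxy, mem_inside hxy, Finset.mem_compl]
  tauto

theorem boundary_mono {S : Finset G.E} (h : S ⊆ H) : G.boundary S U ⊆ G.boundary H U :=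
  Finset.filter_subset_filter _ h

theorem bd_inside (h : G.boundary H U = ∅) {z : G.V} (hz : z ∈ U) :
    G.bd (G.inside H U) z = G.bd H z := by
  have h1 : H = G.inside H U ∪ G.inside H Uᶜ := by
    ext e
    rw [Finset.mem_union]
    refine ⟨fun he => ?_, fun he => he.elim (fun h => inside_subset h) fun h => inside_subset h⟩
    have := mem_inside_or (U := U) he
    simpa [h] using this
  conv_rhs => rw [h1, bd_union disjoint_inside_compl]
  rw [Pi.add_apply]
  have h2 : G.bd (G.inside H Uᶜ) z = 0 := by
    by_contra hc
    exact Finset.mem_compl.1 (support_inside (bd_ne_zero_mem hc)) hz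
  rw [h2, add_zero]

theorem reach_mem_iff {S : Finset G.E} (h : G.boundary S W = ∅) {u v : G.V} (hr : G.Reach S u v) :
    u ∈ W ↔ v ∈ W := by
  induction hr with
  | refl => rfl
  | tail _ hvw ih =>
    obtain ⟨e, he, hxy⟩ := hvw
    rw [ih]
    by_contra hc
    have := (mem_boundary hxy).2 ⟨he, hc⟩
    simp [h] at this

theorem reach_inside {S : Finset G.E} (hb : G.boundary S U ⊆ {b}) {u v : G.V} (hu : u ∈ U)
    (hv : v ∈ U) (hr : G.Reach S u v) : G.Reach (G.inside S U) u v := by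
  obtain ⟨P, hP, hPb⟩ := exists_bd_of_reach hr
  have h1 : G.boundary P U = ∅ := by
    have h2 := sum_bd P U
    simp only [hPb, Pi.add_apply, Finset.sum_add_distrib, sum_pt, if_pos hu, if_pos hv] at h2
    rcases Finset.subset_singleton_iff.1 ((boundary_mono hP).trans hb) with h3 | h3
    · exact h3
    · rw [h3, Finset.card_singleton] at h2
      exact absurd h2 (by rw [Nat.cast_one]; decide)
  refine (reach_of_bd (P := G.inside P U) ?_).mono (Finset.filter_subset_filter _ hP)
  funext z
  by_cases hz : z ∈ U
  · rw [bd_inside h1 hz, hPb]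
  · have h2 : G.bd (G.inside P U) z = 0 := by
      by_contra hc
      exact hz (support_inside (bd_ne_zero_mem hc))
    rw [h2, Pi.add_apply, pt_ne (by rintro rfl; exact hz hu), pt_ne (by rintro rfl; exact hz hv),
      add_zero]

/-- `b` is a bridge of `H` separating two edges of `N`. -/
def Splits (G : SignedMultigraph) (H N : Finset G.E) (b : G.E) : Prop :=
  ∃ U, G.boundary H U = {b} ∧ (G.inside N U).Nonempty ∧ (G.inside N Uᶜ).Nonempty

end Inside

section LoopAt

/-- The signed graph in which `b` is replaced by a negative loop at `x`. -/
abbrev loopAt (G : SignedMultigraph) (b : G.E) (x : G.V) : SignedMultigraph where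
  V := G.V
  E := G.E
  ends := Function.update G.ends b s(x, x)
  neg := Function.update G.neg b true

variable {G : SignedMultigraph} {S : Finset G.E} {b : G.E} {x : G.V}

theorem ends_loopAt {e : G.E} (h : e ≠ b) : (G.loopAt b x).ends e = G.ends e :=
  Function.update_of_ne h _ _

theorem ends_loopAt_self : (G.loopAt b x).ends b = s(x, x) :=
  Function.update_self (f := G.ends) _ _

theorem sgn_loopAt {e : G.E} (h : e ≠ b) : (G.loopAt b x).sgn e = G.sgn e := by
  simp only [sgn, Function.update_of_ne h]

theorem sgn_loopAt_self : (G.loopAt b x).sgn b = 1 := by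
  simp [sgn]

theorem support_loopAt (h : b ∉ S) : (G.loopAt b x).support S = G.support S := by
  ext v
  refine mem_support.trans (Iff.trans ?_ mem_support.symm)
  refine exists_congr fun e => and_congr_right fun he => ?_
  rw [ends_loopAt (G := G) (ne_of_mem_of_not_mem he h)]

theorem degIn_loopAt (h : b ∉ S) (v : G.V) : (G.loopAt b x).degIn S v = G.degIn S v := by
  unfold degIn
  refine Finset.sum_congr rfl fun e he => ?_
  rw [ends_loopAt (G := G) (ne_of_mem_of_not_mem he h)]

theorem bd_loopAt (h : b ∉ S) : (G.loopAt b x).bd S = G.bd S := by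
  funext v; simp only [bd, degIn_loopAt h]

theorem par_loopAt (h : b ∉ S) : (G.loopAt b x).par S = G.par S :=
  Finset.sum_congr rfl fun _ he => sgn_loopAt (ne_of_mem_of_not_mem he h)

theorem reach_loopAt (h : b ∉ S) : (G.loopAt b x).Reach S = G.Reach S := by
  unfold Reach
  congr 1
  funext u v
  refine propext (exists_congr fun e => and_congr_right fun he => ?_)
  rw [ends_loopAt (G := G) (ne_of_mem_of_not_mem he h)]

theorem isCircuit_loopAt (h : b ∉ S) : (G.loopAt b x).IsCircuit S ↔ G.IsCircuit S := by
  simp only [IsCircuit, ConnOn, support_loopAt h, reach_loopAt h, degIn_loopAt h]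

theorem isUnbalancedCircuit_loopAt (h : b ∉ S) :
    (G.loopAt b x).IsUnbalancedCircuit S ↔ G.IsUnbalancedCircuit S := by
  rw [unbalanced_iff, unbalanced_iff, isCircuit_loopAt h, par_loopAt h]

theorem isPath_loopAt (h : b ∉ S) {u v : G.V} :
    (G.loopAt b x).IsPath S u v ↔ G.IsPath S u v := by
  simp only [IsPath, ConnOn, support_loopAt h, reach_loopAt h, degIn_loopAt h]

theorem IsSignedCircuit.of_loopAt (h : b ∉ S) (hS : (G.loopAt b x).IsSignedCircuit S) :
    G.IsSignedCircuit S := by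
  rcases hS with hS | ⟨A, B, hA, hB, hd, hc, rfl⟩ |
    ⟨A, B, P, u, v, hA, hB, hd, hP, h1, h2, h3, h4, rfl⟩
  · rw [balanced_iff, isCircuit_loopAt h, par_loopAt h] at hS
    exact Or.inl (balanced_iff.2 hS)
  · simp only [Finset.mem_union, not_or] at h
    rw [support_loopAt (G := G) h.1, support_loopAt (G := G) h.2] at hc
    exact Or.inr (Or.inl ⟨A, B, (isUnbalancedCircuit_loopAt (G := G) (x := x) h.1).1 hA,
      (isUnbalancedCircuit_loopAt (G := G) (x := x) h.2).1 hB, hd, hc, rfl⟩)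
  · simp only [Finset.mem_union, not_or] at h
    rw [support_loopAt (G := G) h.1.1] at h1 hd
    rw [support_loopAt (G := G) h.1.2] at h2 hd
    rw [support_loopAt (G := G) h.2] at h1 h2
    exact Or.inr (Or.inr ⟨A, B, P, u, v, (isUnbalancedCircuit_loopAt (G := G) (x := x) h.1.1).1 hA,
      (isUnbalancedCircuit_loopAt (G := G) (x := x) h.1.2).1 hB,
      hd, (isPath_loopAt (G := G) (x := x) h.2).1 hP, h1, h2, h3, h4, rfl⟩)

end LoopAt

section Lollipop

variable {G : SignedMultigraph} {S T : Finset G.E} {U : Finset G.V} {b : G.E} {x y : G.V}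

/-- An unbalanced circuit together with a path from `x` to it. -/
def Lollipop (G : SignedMultigraph) (x : G.V) (S : Finset G.E) : Prop :=
  ∃ A P p, S = A ∪ P ∧ G.IsUnbalancedCircuit A ∧ p ∈ G.support A ∧ G.Acyc P ∧
    G.bd P = G.pt p + G.pt x ∧ (∀ z ∈ G.support P, z ∈ G.support A → z = p) ∧
    (x ∈ G.support A → x = p)

theorem Lollipop.of_short {A B : Finset G.E} (hx : G.ends b = s(x, x)) (hb : b ∈ A)
    (hA : G.IsUnbalancedCircuit A) (hB : G.IsUnbalancedCircuit B) (hd : Disjoint A B)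
    (hc : (G.support A ∩ G.support B).card = 1) : G.Lollipop x ((A ∪ B).erase b) := by
  have hbB := Finset.disjoint_left.1 hd hb
  obtain rfl := hA.1.loop_eq hb hx
  have hxB : x ∈ G.support B := by
    obtain ⟨z, hz⟩ := Finset.card_eq_one.1 hc
    have h1 : z ∈ G.support {b} ∩ G.support B := by rw [hz]; simp
    rw [support_singleton hx] at h1
    simp only [Finset.mem_inter, Finset.mem_insert, Finset.mem_singleton, or_self] at h1
    exact h1.1 ▸ h1.2
  refine ⟨B, ∅, x, ?_, hB, hxB, acyc_empty, by rw [bd_empty, pi_add_self], by simp, fun _ => rfl⟩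
  rw [Finset.union_empty, Finset.singleton_union, Finset.erase_insert hbB]

theorem Lollipop.of_long {A B P : Finset G.E} {u v : G.V} (hx : G.ends b = s(x, x)) (hb : b ∈ A)
    (hA : G.IsUnbalancedCircuit A) (hB : G.IsUnbalancedCircuit B)
    (hd : Disjoint (G.support A) (G.support B)) (hP : G.IsPath P u v)
    (h1 : G.support P ∩ G.support A = {u}) (h2 : G.support P ∩ G.support B = {v})
    (h3 : Disjoint P A) : G.Lollipop x ((A ∪ B ∪ P).erase b) := by
  have hbP := Finset.disjoint_right.1 h3 hb
  have hxA : x ∈ G.support A := mem_support.2 ⟨b, hb, mem_ends_left hx⟩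
  have hxB := Finset.disjoint_left.1 hd hxA
  obtain rfl := hA.1.loop_eq hb hx
  have hbB : b ∉ B := fun h => hxB (mem_support.2 ⟨b, h, mem_ends_left hx⟩)
  have hux : u = x := by
    have : u ∈ G.support P ∩ G.support {b} := by rw [h1]; simp
    rw [support_singleton hx] at this
    simpa using (Finset.mem_inter.1 this).2
  have hv : v ∈ G.support P ∩ G.support B := by rw [h2]; simp
  refine ⟨B, P, v, ?_, hB, (Finset.mem_inter.1 hv).2, hP.acyc, by rw [hP.bd, hux, add_comm],
    fun z hzP hzB => ?_, fun h => absurd h hxB⟩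
  · rw [Finset.union_assoc, Finset.singleton_union, Finset.erase_insert (by simp [hbB, hbP])]
  · have : z ∈ G.support P ∩ G.support B := Finset.mem_inter.2 ⟨hzP, hzB⟩
    simpa [h2] using this

/-- Removing a negative loop from a signed circuit leaves a circuit and a path. -/
theorem IsSignedCircuit.lollipop (hS : G.IsSignedCircuit S) (hn : G.sgn b = 1)
    (hx : G.ends b = s(x, x)) (hb : b ∈ S) : G.Lollipop x (S.erase b) := by
  rcases hS with hS | ⟨A, B, hA, hB, hd, hc, rfl⟩ |
    ⟨A, B, P, u, v, hA, hB, hd, hP, h1, h2, h3, h4, rfl⟩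
  · rw [balanced_iff] at hS
    have := hS.2
    rw [hS.1.loop_eq hb hx, par_singleton, hn] at this
    exact absurd this (by decide)
  · rcases Finset.mem_union.1 hb with hb | hb
    · exact .of_short hx hb hA hB hd hc
    · rw [Finset.union_comm]
      rw [Finset.inter_comm] at hc
      exact .of_short hx hb hB hA hd.symm hc
  · rcases Finset.mem_union.1 hb with hb | hb
    · rcases Finset.mem_union.1 hb with hb | hb
      · exact .of_long hx hb hA hB hd hP h1 h2 h3
      · rw [Finset.union_comm A]
        exact .of_long hx hb hB hA hd.symm hP.symm h2 h1 h4
    · exact absurd hx (hP.acyc.not_loop hb x)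

theorem Lollipop.of_loopAt (h : b ∉ S) (hS : (G.loopAt b x).Lollipop x S) : G.Lollipop x S := by
  obtain ⟨A, P, p, rfl, hA, hp, hPa, hPb, h1, h2⟩ := hS
  simp only [Finset.mem_union, not_or] at h
  rw [support_loopAt (G := G) h.1] at hp h1 h2
  rw [support_loopAt (G := G) h.2] at h1
  rw [bd_loopAt (G := G) h.2] at hPb
  refine ⟨A, P, p, rfl, (isUnbalancedCircuit_loopAt (G := G) (x := x) h.1).1 hA, hp, ?_, hPb, h1,
    h2⟩
  intro X hX hXb
  refine hPa X hX ?_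
  rw [bd_loopAt (G := G) fun hb => h.2 (hX hb)]
  exact hXb

theorem Lollipop.join (hb : G.ends b = s(x, y)) (hx : x ∈ U) (hy : y ∉ U) (hS : G.Lollipop x S)
    (hT : G.Lollipop y T) (hSU : G.support S ⊆ U) (hTU : G.support T ⊆ Uᶜ) :
    G.IsSignedCircuit (insert b (S ∪ T)) := by
  obtain ⟨A, P, p, rfl, hA, hp, hPa, hPb, hPA, hxA⟩ := hS
  obtain ⟨B, Q, q, rfl, hB, hq, hQa, hQb, hQB, hyB⟩ := hT
  rw [support_union] at hSU hTU
  have hAU := Finset.subset_union_left.trans hSU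
  have hPU := Finset.subset_union_right.trans hSU
  have hBU : ∀ z ∈ G.support B, z ∉ U := fun z hz =>
    Finset.mem_compl.1 ((Finset.subset_union_left.trans hTU) hz)
  have hQU : ∀ z ∈ G.support Q, z ∉ U := fun z hz =>
    Finset.mem_compl.1 ((Finset.subset_union_right.trans hTU) hz)
  have hdis : ∀ {X Y : Finset G.E}, G.support X ⊆ U → (∀ z ∈ G.support Y, z ∉ U) →
      Disjoint X Y := by
    intro X Y hX hY
    rw [Finset.disjoint_left]
    intro e he he'
    obtain ⟨v, w, hvw⟩ := exists_ends e
    exact hY v (mem_support.2 ⟨e, he', mem_ends_left hvw⟩)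
      (hX (mem_support.2 ⟨e, he, mem_ends_left hvw⟩))
  have hPQ := hdis hPU hQU
  have hbPQ : b ∉ P ∪ Q := by
    rw [Finset.mem_union, not_or]
    exact ⟨fun h => hy (hPU (mem_support.2 ⟨b, h, mem_ends_right hb⟩)),
      fun h => hQU x (mem_support.2 ⟨b, h, mem_ends_left hb⟩) hx⟩
  have hsup : ∀ z ∈ G.support (insert b (P ∪ Q)), z = x ∨ z = y ∨ z ∈ G.support P ∨
      z ∈ G.support Q := by
    intro z hz
    rw [← Finset.singleton_union, support_union, support_union, support_singleton hb] at hz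
    simpa [or_assoc] using hz
  have main := isSignedCircuit_of_path (P := insert b (P ∪ Q)) hA hB (hdis hAU hBU) hp hq ?_ ?_
    (fun z hz hzA => ?_) (fun z hz hzB => ?_) fun z hzA hzB => absurd (hAU hzA) (hBU z hzB)
  · convert main using 1
    ext e; simp only [Finset.mem_insert, Finset.mem_union]; tauto
  · intro X hX hXb
    have hbd : G.boundary X U ⊆ {b} := by
      intro e he
      obtain ⟨v, w, hvw⟩ := exists_ends e
      obtain ⟨heX, hne⟩ := (mem_boundary hvw).1 he
      rcases Finset.mem_insert.1 (hX heX) with rfl | h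
      · simp
      · exfalso
        rcases Finset.mem_union.1 h with h | h
        · exact hne ⟨fun _ => hPU (mem_support.2 ⟨e, h, mem_ends_right hvw⟩),
            fun _ => hPU (mem_support.2 ⟨e, h, mem_ends_left hvw⟩)⟩
        · exact hne ⟨fun h' => absurd h' (hQU _ (mem_support.2 ⟨e, h, mem_ends_left hvw⟩)),
            fun h' => absurd h' (hQU _ (mem_support.2 ⟨e, h, mem_ends_right hvw⟩))⟩
    have hsum := sum_bd X U
    rw [hXb] at hsum
    have hbX : b ∉ X := by
      intro hbX
      have h1 : G.boundary X U = {b} := Finset.Subset.antisymm hbd (by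
        rw [Finset.singleton_subset_iff, mem_boundary hb]
        exact ⟨hbX, fun h => hy (h.1 hx)⟩)
      rw [h1] at hsum
      simp at hsum
    have hXPQ : X ⊆ P ∪ Q := fun e he => (Finset.mem_insert.1 (hX he)).resolve_left
      (ne_of_mem_of_not_mem he hbX)
    have h1 : (X ∩ P) ∪ (X ∩ Q) = X := by
      rw [← Finset.inter_union_distrib_left, Finset.inter_eq_left.2 hXPQ]
    have h2 : G.bd (X ∩ P) + G.bd (X ∩ Q) = 0 := by
      rw [← bd_union (hPQ.mono Finset.inter_subset_right Finset.inter_subset_right), h1, hXb]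
    have h3 : G.bd (X ∩ P) = 0 := by
      funext z
      by_cases hz : z ∈ U
      · have h4 : G.bd (X ∩ Q) z = 0 := by
          by_contra hc
          exact hQU z (support_mono Finset.inter_subset_right (bd_ne_zero_mem hc)) hz
        simpa [h4] using congrFun h2 z
      · by_contra hc
        exact hz (hPU (support_mono Finset.inter_subset_right (bd_ne_zero_mem hc)))
    rw [h3, zero_add] at h2
    rw [← h1, hPa _ Finset.inter_subset_right h3, hQa _ Finset.inter_subset_right h2,
      Finset.union_empty]
  · rw [bd_insert hbPQ hb, bd_union hPQ, hPb, hQb]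
    have e1 := pi_add_self (G.pt x)
    have e2 := pi_add_self (G.pt y)
    calc _ = G.pt q + G.pt p + (G.pt x + G.pt x) + (G.pt y + G.pt y) := by abel
      _ = _ := by rw [e1, e2, add_zero, add_zero]
  · rcases hsup z hz with rfl | rfl | h | h
    · exact hxA hzA
    · exact absurd (hAU hzA) hy
    · exact hPA z h hzA
    · exact absurd (hAU hzA) (hQU z h)
  · rcases hsup z hz with rfl | rfl | h | h
    · exact absurd hx (hBU z hzB)
    · exact hyB hzB
    · exact absurd (hPU h) (hBU z hzB)
    · exact hQB z h hzB

theorem exists_two_of_coverCount {F : Multiset (Finset G.E)} {e : G.E} (h : G.coverCount F e = 2) :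
    ∃ S T R, F = S ::ₘ T ::ₘ R ∧ e ∈ S ∧ e ∈ T ∧ ∀ X ∈ R, e ∉ X := by
  have key : ∀ F : Multiset (Finset G.E), 1 ≤ G.coverCount F e → ∃ S R, F = S ::ₘ R ∧ e ∈ S ∧
      G.coverCount F e = G.coverCount R e + 1 := by
    intro F hF
    obtain ⟨S, hS, heS⟩ := coverCount_pos.1 hF
    obtain ⟨R, rfl⟩ := Multiset.exists_cons_of_mem hS
    exact ⟨S, R, rfl, heS, by rw [coverCount_cons', ind_true heS, add_comm]⟩
  obtain ⟨S, R, rfl, hS, h1⟩ := key F (by omega)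
  obtain ⟨T, R, rfl, hT, h2⟩ := key R (by omega)
  refine ⟨S, T, R, rfl, hS, hT, fun X hX he => ?_⟩
  have := coverCount_pos.2 ⟨X, hX, he⟩
  omega

end Lollipop

section Half

variable {G : SignedMultigraph} {H N L : Finset G.E} {U W : Finset G.V} {b c : G.E} {x y : G.V}

theorem Setup.not_mem_of_boundary (h : G.Setup H N L) (hU : G.boundary H U = {b})
    (hb : G.ends b = s(x, y)) : b ∉ N := by
  intro hN
  have hbU : b ∈ G.boundary H U := by simp [hU]
  rw [mem_boundary hb] at hbU
  have h1 : G.boundary (H \ N) U = ∅ := by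
    refine Finset.eq_empty_of_forall_notMem fun e he => ?_
    have h2 := boundary_mono Finset.sdiff_subset he
    rw [hU, Finset.mem_singleton] at h2
    subst h2
    exact (Finset.mem_sdiff.1 (Finset.filter_subset _ _ he)).2 hN
  exact hbU.2 (reach_mem_iff h1 (h.conn x (mem_support.2 ⟨b, hbU.1, mem_ends_left hb⟩) y
    (mem_support.2 ⟨b, hbU.1, mem_ends_right hb⟩)))

theorem Setup.reach_inside (h : G.Setup H N L) (hU : G.boundary H U = {b}) {u v : G.V}
    (hu : u ∈ G.support H) (hv : v ∈ G.support H) (huU : u ∈ U) (hvU : v ∈ U) :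
    G.Reach (G.inside (H \ N) U) u v :=
  SignedMultigraph.reach_inside ((boundary_mono Finset.sdiff_subset).trans hU.subset) huU hvU
    (h.conn u hu v hv)

theorem not_mem_inside (hb : G.ends b = s(x, y)) (hy : y ∉ U) : b ∉ G.inside H U := by
  rw [mem_inside hb]
  exact fun h => hy h.2.2

theorem Setup.loopAt (h : G.Setup H N L) (hU : G.boundary H U = {b}) (hb : G.ends b = s(x, y))
    (hx : x ∈ U) (hy : y ∉ U) (hN : (G.inside N U).Nonempty) :
    (G.loopAt b x).Setup (insert b (G.inside H U)) (insert b (G.inside N U))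
      (insert b (G.inside L U)) := by
  have hbH : b ∈ H := Finset.filter_subset _ _ (hU ▸ Finset.mem_singleton_self b)
  have hbN := h.not_mem_of_boundary hU hb
  have hbi : ∀ K : Finset G.E, b ∉ G.inside K U := fun K => not_mem_inside hb hy
  have key : ∀ u ∈ (G.loopAt b x).support (insert b (G.inside H U)), u ∈ U ∧ u ∈ G.support H := by
    intro u hu
    obtain ⟨(e : G.E), he, hue⟩ := mem_support.1 hu
    rcases Finset.mem_insert.1 he with rfl | he
    · rw [ends_loopAt_self (G := G)] at hue
      have hux : u = x := by simpa using hue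
      rw [hux]
      exact ⟨hx, mem_support.2 ⟨e, hbH, mem_ends_left hb⟩⟩
    · rw [ends_loopAt (G := G) (ne_of_mem_of_not_mem he (hbi H))] at hue
      exact ⟨(Finset.mem_filter.1 he).2 u hue, mem_support.2 ⟨e, inside_subset he, hue⟩⟩
  refine ⟨Finset.insert_subset_insert _ (Finset.filter_subset_filter _ h.hN),
    Finset.insert_subset_insert _ (Finset.filter_subset_filter _ h.hL), ?_, ?_, ?_, ?_⟩
  · intro (e : G.E) he
    rcases Finset.mem_insert.1 he with rfl | he
    · simp only [sgn_loopAt_self, Finset.mem_insert_self]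
    · have hne : e ≠ b := ne_of_mem_of_not_mem he (hbi H)
      rw [sgn_loopAt (G := G) hne, h.neg e (inside_subset he), Finset.mem_insert]
      refine ⟨fun hn => Or.inr (Finset.mem_filter.2 ⟨hn, (Finset.mem_filter.1 he).2⟩), ?_⟩
      rintro (he' | he')
      exacts [absurd he' hne, inside_subset he']
  · intro (e : G.E) he
    rcases Finset.mem_insert.1 he with rfl | he
    · exact ⟨x, ends_loopAt_self⟩
    · rw [ends_loopAt (G := G) (ne_of_mem_of_not_mem he (hbi L))]
      exact h.loop e (inside_subset he)
  · intro u hu v hv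
    obtain ⟨huU, huH⟩ := key u hu
    obtain ⟨hvU, hvH⟩ := key v hv
    have h1 := h.reach_inside hU huH hvH huU hvU
    rw [← reach_loopAt (x := x) (hbi (H \ N))] at h1
    refine h1.mono fun e he => ?_
    have hne : e ≠ b := ne_of_mem_of_not_mem he (hbi _)
    have he' := Finset.mem_sdiff.1 (inside_subset he)
    refine Finset.mem_sdiff.2 ⟨Finset.mem_insert_of_mem
      (Finset.mem_filter.2 ⟨he'.1, (Finset.mem_filter.1 he).2⟩), fun hc => ?_⟩
    rcases Finset.mem_insert.1 hc with hc | hc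
    exacts [hne hc, he'.2 (inside_subset hc)]
  · rw [Finset.card_insert_of_notMem (hbi N)]
    have := hN.card_pos
    omega

theorem Setup.inside_loopAt_nonempty (h : G.Setup H N L) (hU : G.boundary H U = {b})
    (hb : G.ends b = s(x, y)) (hy : y ∉ U) (hc : c ∈ G.inside H U)
    (hW : G.boundary H W = {c}) (hN : (G.inside N W).Nonempty) :
    ((G.loopAt b x).inside (insert b (G.inside N U)) W).Nonempty := by
  have hbH : b ∈ H := Finset.filter_subset _ _ (hU ▸ Finset.mem_singleton_self b)
  have hbN := h.not_mem_of_boundary hU hb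
  have hbc : b ≠ c := fun hbc => not_mem_inside hb hy (hbc ▸ hc)
  obtain ⟨f, hf⟩ := hN
  obtain ⟨p, q, hpq⟩ := exists_ends f
  have hfN : f ∈ N := inside_subset hf
  have hfb : f ≠ b := ne_of_mem_of_not_mem hfN hbN
  rw [mem_inside hpq] at hf
  rcases mem_inside_or (U := U) (h.hN hfN) with h1 | h1 | h1
  · have hpq' : (G.loopAt b x).ends f = s(p, q) := by rw [ends_loopAt (G := G) hfb, hpq]
    have hfi : f ∈ insert b (G.inside N U) :=
      Finset.mem_insert_of_mem (Finset.mem_filter.2 ⟨hfN, (Finset.mem_filter.1 h1).2⟩)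
    exact ⟨f, (mem_inside (G := G.loopAt b x) hpq').2 ⟨hfi, hf.2⟩⟩
  · have h1' := (mem_inside hpq).1 h1
    have hr := h.reach_inside (U := Uᶜ) (boundary_compl.trans hU)
      (mem_support.2 ⟨f, h.hN hfN, mem_ends_left hpq⟩)
      (mem_support.2 ⟨b, hbH, mem_ends_right hb⟩) h1'.2.1 (Finset.mem_compl.2 hy)
    have h2 : G.boundary (G.inside (H \ N) Uᶜ) W = ∅ := by
      refine Finset.eq_empty_of_forall_notMem fun e he => ?_
      have he1 := Finset.filter_subset _ _ he
      have h3 := boundary_mono (inside_subset.trans Finset.sdiff_subset) he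
      rw [hW, Finset.mem_singleton] at h3
      subst h3
      exact Finset.disjoint_left.1 disjoint_inside_compl hc
        (Finset.filter_subset_filter _ Finset.sdiff_subset he1)
    have hyW : y ∈ W := (reach_mem_iff h2 hr).1 hf.2.1
    have hbW : b ∉ G.boundary H W := by rw [hW]; simpa using hbc
    rw [mem_boundary hb] at hbW
    have hxW : x ∈ W := by
      by_contra hxW
      exact hbW ⟨hbH, fun hi => hxW (hi.2 hyW)⟩
    exact ⟨b, (mem_inside (G := G.loopAt b x) ends_loopAt_self).2
      ⟨Finset.mem_insert_self _ _, hxW, hxW⟩⟩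
  · rw [hU, Finset.mem_singleton] at h1
    exact absurd h1 hfb

theorem Setup.splits_loopAt (h : G.Setup H N L) (hU : G.boundary H U = {b})
    (hb : G.ends b = s(x, y)) (hy : y ∉ U) (hc : c ∈ G.inside H U) (hs : G.Splits H N c) :
    (G.loopAt b x).Splits (insert b (G.inside H U)) (insert b (G.inside N U)) c := by
  obtain ⟨W, hW, h1, h2⟩ := hs
  have hbc : b ≠ c := fun hbc => not_mem_inside hb hy (hbc ▸ hc)
  refine ⟨W, ?_, h.inside_loopAt_nonempty hU hb hy hc hW h1,
    h.inside_loopAt_nonempty hU hb hy hc (boundary_compl.trans hW) h2⟩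
  ext (e : G.E)
  rw [Finset.mem_singleton]
  by_cases heb : e = b
  · subst heb
    rw [mem_boundary (ends_loopAt_self (G := G))]
    simp [hbc]
  · obtain ⟨p, q, hpq⟩ := exists_ends e
    have hpq' : (G.loopAt b x).ends e = s(p, q) := by rw [ends_loopAt (G := G) heb, hpq]
    have h3 : e ∈ G.boundary H W ↔ e = c := by rw [hW, Finset.mem_singleton]
    rw [mem_boundary hpq] at h3
    rw [mem_boundary hpq', Finset.mem_insert, or_iff_right heb, ← h3]
    refine and_congr_left fun hn => ⟨fun he => inside_subset he, fun he => ?_⟩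
    rwa [h3.1 ⟨he, hn⟩]

/-- A cover of one side of a cut edge at `x`, two of whose members are lollipops at `x`. -/
structure HalfCover (G : SignedMultigraph) (H N L : Finset G.E) (U : Finset G.V) (x : G.V)
    (S S' : Finset G.E) (F : Multiset (Finset G.E)) : Prop where
  signed : ∀ X ∈ F, G.IsSignedCircuit X
  fst : G.Lollipop x S
  snd : G.Lollipop x S'
  out : ∀ e ∉ G.inside H U, G.coverCount (S ::ₘ S' ::ₘ F) e = 0
  le : ∀ e, G.coverCount (S ::ₘ S' ::ₘ F) e ≤ 2
  loops : ∀ e ∈ G.inside L U, G.coverCount (S ::ₘ S' ::ₘ F) e = 2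
  cov : ∀ e ∈ G.inside N U, ∃ X, e ∈ X ∧ G.bd X = 0 ∧
    ∀ z ∈ X, 1 ≤ G.coverCount (S ::ₘ S' ::ₘ F) z
  splits : ∀ c ∈ G.inside H U, G.Splits H N c → 1 ≤ G.coverCount (S ::ₘ S' ::ₘ F) c

theorem coverCount_loopAt (F : Multiset (Finset G.E)) (e : G.E) :
    (G.loopAt b x).coverCount F e = G.coverCount F e := rfl

theorem bd_erase_loopAt (X : Finset G.E) : (G.loopAt b x).bd X = G.bd (X.erase b) := by
  rw [← bd_loopAt (x := x) (Finset.notMem_erase b X)]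
  by_cases hb : b ∈ X
  · rw [← Finset.sdiff_singleton_eq_erase, bd_sdiff (by simpa using hb),
      bd_singleton (ends_loopAt_self (G := G)), pi_add_self, add_zero]
  · rw [Finset.erase_eq_of_notMem hb]

theorem Setup.halfCover (h : G.Setup H N L) (hU : G.boundary H U = {b}) (hb : G.ends b = s(x, y))
    (hy : y ∉ U) {F : Multiset (Finset G.E)}
    (hF : (G.loopAt b x).Good (insert b (G.inside H U)) (insert b (G.inside N U))
      (insert b (G.inside L U)) F)
    (hs : ∀ c, (G.loopAt b x).Splits (insert b (G.inside H U)) (insert b (G.inside N U)) c →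
      1 ≤ (G.loopAt b x).coverCount F c) :
    ∃ S S' R, G.HalfCover H N L U x S S' R := by
  have hbi : ∀ K : Finset G.E, b ∉ G.inside K U := fun K => not_mem_inside hb hy
  obtain ⟨S, S', R, rfl, hbS, hbS', hR⟩ :=
    exists_two_of_coverCount (hF.loops b (Finset.mem_insert_self _ _))
  have hcount : ∀ e ≠ b, G.coverCount (S.erase b ::ₘ S'.erase b ::ₘ R) e =
      (G.loopAt b x).coverCount (S ::ₘ S' ::ₘ R) e := by
    intro e he
    rw [coverCount_loopAt]
    simp only [coverCount_cons', Finset.mem_erase, he, ne_eq, not_false_eq_true, true_and]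
  have hcb : G.coverCount (S.erase b ::ₘ S'.erase b ::ₘ R) b = 0 := by
    refine coverCount_eq_zero fun X hX => ?_
    rcases Multiset.mem_cons.1 hX with rfl | hX
    · exact Finset.notMem_erase _ _
    · rcases Multiset.mem_cons.1 hX with rfl | hX
      exacts [Finset.notMem_erase _ _, hR X hX]
  have hlol : ∀ X ∈ S ::ₘ S' ::ₘ R, b ∈ X → G.Lollipop x (X.erase b) := fun X hX hbX =>
    Lollipop.of_loopAt (Finset.notMem_erase _ _)
      ((hF.signed X hX).lollipop sgn_loopAt_self ends_loopAt_self hbX)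
  refine ⟨S.erase b, S'.erase b, R, fun X hX => ?_, hlol S (by simp) hbS, hlol S' (by simp) hbS',
    fun e he => ?_, fun e => ?_, fun e he => ?_, fun e he => ?_, fun c hc hcs => ?_⟩
  · exact IsSignedCircuit.of_loopAt (hR X hX) (hF.signed X (by simp [hX]))
  · by_cases heb : e = b
    · rw [heb, hcb]
    · rw [hcount e heb]
      exact hF.out e (by simp [heb, he])
  · by_cases heb : e = b
    · rw [heb, hcb]; omega
    · rw [hcount e heb]
      exact hF.le e
  · rw [hcount e (ne_of_mem_of_not_mem he (hbi L))]
    exact hF.loops e (Finset.mem_insert_of_mem he)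
  · obtain ⟨X, heX, hX, hXc⟩ := hF.cov e (Finset.mem_insert_of_mem he)
    refine ⟨X.erase b, Finset.mem_erase.2 ⟨ne_of_mem_of_not_mem he (hbi N), heX⟩, ?_, ?_⟩
    · rw [← bd_erase_loopAt (x := x)]; exact hX
    · intro z hz
      obtain ⟨hzb, hz⟩ := Finset.mem_erase.1 hz
      rw [hcount z hzb]
      exact hXc z hz
  · rw [hcount c (ne_of_mem_of_not_mem hc (hbi H))]
    exact hs c (h.splits_loopAt hU hb hy hc hcs)

end Half

section Glue

variable {G : SignedMultigraph} {H N L S S' T T' : Finset G.E} {U : Finset G.V} {b : G.E}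
  {x y : G.V} {F K : Multiset (Finset G.E)}

theorem HalfCover.subset (h : G.HalfCover H N L U x S S' F) {X : Finset G.E}
    (hX : X ∈ S ::ₘ S' ::ₘ F) : X ⊆ G.inside H U := by
  intro e he
  by_contra hc
  have h1 := coverCount_pos.2 ⟨X, hX, he⟩
  rw [h.out e hc] at h1
  exact lt_irrefl 0 h1

theorem coverCount_glue (hS : b ∉ S) (hS' : b ∉ S') (hT : b ∉ T) (hT' : b ∉ T')
    (hd : Disjoint S T) (hd' : Disjoint S' T') (e : G.E) :
    G.coverCount (insert b (S ∪ T) ::ₘ insert b (S' ∪ T') ::ₘ (F + K)) e =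
      2 * ind (e = b) + (G.coverCount (S ::ₘ S' ::ₘ F) e + G.coverCount (T ::ₘ T' ::ₘ K) e) := by
  have key : ∀ A B : Finset G.E, b ∉ A → b ∉ B → Disjoint A B →
      ind (e ∈ insert b (A ∪ B)) = ind (e = b) + (ind (e ∈ A) + ind (e ∈ B)) := by
    intro A B hA hB hAB
    rw [Finset.insert_eq, ind_union (by simp [hA, hB]), ind_union hAB, Finset.mem_singleton]
  simp only [coverCount_cons', coverCount_add, key S T hS hT hd, key S' T' hS' hT' hd']
  ring

theorem Setup.glue (h : G.Setup H N L) (hU : G.boundary H U = {b}) (hb : G.ends b = s(x, y))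
    (hx : x ∈ U) (hy : y ∉ U) (h1 : G.HalfCover H N L U x S S' F)
    (h2 : G.HalfCover H N L Uᶜ y T T' K) :
    ∃ M, G.Good H N L M ∧ ∀ c, G.Splits H N c → 1 ≤ G.coverCount M c := by
  have hbN := h.not_mem_of_boundary hU hb
  have hb1 : b ∉ G.inside H U := not_mem_inside hb hy
  have hb2 : b ∉ G.inside H Uᶜ :=
    not_mem_inside (hb.trans Sym2.eq_swap) (by simpa using hx)
  have hd : Disjoint (G.inside H U) (G.inside H Uᶜ) := disjoint_inside_compl
  have hS := h1.subset (X := S) (by simp)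
  have hS' := h1.subset (X := S') (by simp)
  have hT := h2.subset (X := T) (by simp)
  have hT' := h2.subset (X := T') (by simp)
  have hsup : ∀ {X W}, X ⊆ G.inside H W → G.support X ⊆ W := fun hX v hv =>
    support_inside (support_mono hX hv)
  have hc := coverCount_glue (F := F) (K := K) (fun hm => hb1 (hS hm)) (fun hm => hb1 (hS' hm))
    (fun hm => hb2 (hT hm)) (fun hm => hb2 (hT' hm))
    (Finset.disjoint_of_subset_left hS (Finset.disjoint_of_subset_right hT hd))
    (Finset.disjoint_of_subset_left hS' (Finset.disjoint_of_subset_right hT' hd))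
  have hcase : ∀ e ∈ H, e ∈ G.inside H U ∨ e ∈ G.inside H Uᶜ ∨ e = b := fun e he => by
    have := mem_inside_or (U := U) he
    rwa [hU, Finset.mem_singleton] at this
  have hle1 : ∀ e, G.coverCount (S ::ₘ S' ::ₘ F) e ≤
      G.coverCount (insert b (S ∪ T) ::ₘ insert b (S' ∪ T') ::ₘ (F + K)) e := fun e => by
    rw [hc]; omega
  have hle2 : ∀ e, G.coverCount (T ::ₘ T' ::ₘ K) e ≤
      G.coverCount (insert b (S ∪ T) ::ₘ insert b (S' ∪ T') ::ₘ (F + K)) e := fun e => by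
    rw [hc]; omega
  have hle : ∀ e, G.coverCount (insert b (S ∪ T) ::ₘ insert b (S' ∪ T') ::ₘ (F + K)) e ≤ 2 := by
    intro e
    rw [hc]
    have h3 := h1.le e
    have h4 := h2.le e
    by_cases he1 : e ∈ G.inside H U
    · rw [h2.out e (Finset.disjoint_left.1 hd he1), ind_false (ne_of_mem_of_not_mem he1 hb1)]
      omega
    · rw [h1.out e he1]
      by_cases he2 : e ∈ G.inside H Uᶜ
      · rw [ind_false (ne_of_mem_of_not_mem he2 hb2)]
        omega
      · rw [h2.out e he2]
        have := ind_le_one (e = b)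
        omega
  refine ⟨insert b (S ∪ T) ::ₘ insert b (S' ∪ T') ::ₘ (F + K),
    ⟨fun X hX => ?_, fun e he => ?_, hle, fun e he => ?_, fun e he => ?_⟩, ?_⟩
  · simp only [Multiset.mem_cons, Multiset.mem_add] at hX
    rcases hX with rfl | rfl | hX | hX
    · exact Lollipop.join hb hx hy h1.fst h2.fst (hsup hS) (hsup hT)
    · exact Lollipop.join hb hx hy h1.snd h2.snd (hsup hS') (hsup hT')
    · exact h1.signed X hX
    · exact h2.signed X hX
  · have hbH : b ∈ H := Finset.filter_subset _ _ (hU ▸ Finset.mem_singleton_self b)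
    rw [hc, ind_false (ne_of_mem_of_not_mem hbH he).symm, h1.out e fun hm => he (inside_subset hm),
      h2.out e fun hm => he (inside_subset hm)]
  · have heH := h.hN (h.hL he)
    refine le_antisymm (hle e) ?_
    rcases hcase e heH with h3 | h3 | rfl
    · rw [← h1.loops e (Finset.mem_filter.2 ⟨he, (Finset.mem_filter.1 h3).2⟩)]
      exact hle1 e
    · rw [← h2.loops e (Finset.mem_filter.2 ⟨he, (Finset.mem_filter.1 h3).2⟩)]
      exact hle2 e
    · exact absurd (h.hL he) hbN
  · rcases hcase e (h.hN he) with h3 | h3 | rfl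
    · obtain ⟨X, heX, hX, hXc⟩ := h1.cov e (Finset.mem_filter.2 ⟨he, (Finset.mem_filter.1 h3).2⟩)
      exact ⟨X, heX, hX, fun z hz => (hXc z hz).trans (hle1 z)⟩
    · obtain ⟨X, heX, hX, hXc⟩ := h2.cov e (Finset.mem_filter.2 ⟨he, (Finset.mem_filter.1 h3).2⟩)
      exact ⟨X, heX, hX, fun z hz => (hXc z hz).trans (hle2 z)⟩
    · exact absurd he hbN
  · intro c hs
    have hcH : c ∈ H := by
      obtain ⟨W, hW, -⟩ := hs
      exact Finset.filter_subset _ _ (hW ▸ Finset.mem_singleton_self c)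
    rcases hcase c hcH with h3 | h3 | rfl
    · exact (h1.splits c h3 hs).trans (hle1 c)
    · exact (h2.splits c h3 hs).trans (hle2 c)
    · rw [hc, ind_true rfl]
      omega

theorem card_insert_inside_lt {b : G.E} (hbH : b ∈ H) (hb : b ∉ G.inside H Uᶜ)
    (hne : (G.inside H Uᶜ).Nonempty) : (insert b (G.inside H U)).card < H.card := by
  refine Finset.card_lt_card ⟨Finset.insert_subset hbH inside_subset, fun hc => ?_⟩
  obtain ⟨e, he⟩ := hne
  rcases Finset.mem_insert.1 (hc (inside_subset he)) with rfl | h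
  exacts [hb he, Finset.disjoint_left.1 disjoint_inside_compl h he]

/-- A good family which also covers every cut edge separating two negative edges. -/
theorem exists_good_splits (n : ℕ) : ∀ (G : SignedMultigraph) (H N L : Finset G.E), H.card = n →
    G.Setup H N L → ∃ F, G.Good H N L F ∧ ∀ c, G.Splits H N c → 1 ≤ G.coverCount F c := by
  induction n using Nat.strong_induction_on with
  | _ n ih =>
    intro G H N L hn h
    by_cases hs : ∃ b, G.Splits H N b
    · obtain ⟨b, U, hU, hN1, hN2⟩ := hs
      have side : ∀ (W : Finset G.V) (x y : G.V), G.boundary H W = {b} → G.ends b = s(x, y) →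
          x ∈ W → y ∉ W → (G.inside N W).Nonempty → (G.inside N Wᶜ).Nonempty →
          ∃ S S' F, G.HalfCover H N L W x S S' F := by
        intro W x y hW hb hx hy h1 h2
        have hbH : b ∈ H := Finset.filter_subset _ _ (hW ▸ Finset.mem_singleton_self b)
        have h3 := card_insert_inside_lt hbH
          (not_mem_inside (hb.trans Sym2.eq_swap) (by simpa using hx))
          (h2.mono (Finset.filter_subset_filter _ h.hN))
        obtain ⟨F, hF, hFs⟩ := ih _ (hn ▸ h3) (G.loopAt b x) _ _ _ rfl (h.loopAt hW hb hx hy h1)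
        exact h.halfCover hW hb hy hF hFs
      have main : ∀ (W : Finset G.V) (x y : G.V), G.boundary H W = {b} → G.ends b = s(x, y) →
          x ∈ W → y ∉ W → (G.inside N W).Nonempty → (G.inside N Wᶜ).Nonempty →
          ∃ F, G.Good H N L F ∧ ∀ c, G.Splits H N c → 1 ≤ G.coverCount F c := by
        intro W x y hW hb hx hy h1 h2
        obtain ⟨S, S', F, hF⟩ := side W x y hW hb hx hy h1 h2
        obtain ⟨T, T', K, hK⟩ := side Wᶜ y x (boundary_compl.trans hW) (hb.trans Sym2.eq_swap)
          (Finset.mem_compl.2 hy) (by simpa using hx) h2 (by rwa [compl_compl])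
        exact h.glue hW hb hx hy hF hK
      obtain ⟨x, y, hb⟩ := exists_ends b
      have hbU : b ∈ G.boundary H U := by simp [hU]
      rw [mem_boundary hb] at hbU
      by_cases hx : x ∈ U
      · exact main U x y hU hb hx (fun hy => hbU.2 (by simp [hx, hy])) hN1 hN2
      · exact main U y x hU (hb.trans Sym2.eq_swap) (by_contra fun hy => hbU.2 (by simp [hx, hy]))
          hx hN1 hN2
    · obtain ⟨F, hF⟩ := h.exists_good
      exact ⟨F, hF, fun c hc => absurd ⟨c, hc⟩ hs⟩

end Glue

section Cuts

variable {G : SignedMultigraph} {S T X : Finset G.E} {U W : Finset G.V} {b c e : G.E} {x y : G.V}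

theorem Acyc.acyclicSet (h : G.Acyc T) : G.AcyclicSet T := by
  intro F hF hne
  obtain ⟨e, he⟩ := hne
  obtain ⟨x, y, hxy⟩ := exists_ends e
  obtain ⟨X, hX, hmax⟩ := Finset.exists_max_image
    (F.powerset.filter fun X => ∃ u v, G.bd X = G.pt u + G.pt v) Finset.card
    ⟨{e}, by simpa [he] using ⟨x, y, bd_singleton hxy⟩⟩
  obtain ⟨hXF, u, v, huv⟩ := Finset.mem_filter.1 hX
  rw [Finset.mem_powerset] at hXF
  have hcard := hmax {e} (by simpa [he] using ⟨x, y, bd_singleton hxy⟩)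
  have hne : u ≠ v := by
    rintro rfl
    rw [pi_add_self] at huv
    rw [h X (hXF.trans hF) huv] at hcard
    simp at hcard
  have h1 := ((h.mono (hXF.trans hF)).isPath huv hne).2.2.2.2.2.1
  refine ⟨u, ?_⟩
  have h2 := degIn_union (G := G) (Finset.disjoint_sdiff (s := X) (t := F)) u
  rw [Finset.union_sdiff_of_subset hXF, h1] at h2
  by_contra hc
  obtain ⟨f, hf, huf⟩ := mem_support.1 (degIn_pos.1 (by omega : 0 < G.degIn (F \ X) u))
  obtain ⟨hfF, hfX⟩ := Finset.mem_sdiff.1 hf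
  obtain ⟨w, hw⟩ := Sym2.mem_iff_exists.1 huf
  have h3 := hmax (insert f X) (Finset.mem_filter.2
    ⟨Finset.mem_powerset.2 (Finset.insert_subset hfF hXF), w, v, by
      rw [bd_insert hfX hw, huv, show G.pt u + G.pt w + (G.pt u + G.pt v) =
        (G.pt u + G.pt u) + (G.pt w + G.pt v) by abel, pi_add_self, zero_add]⟩)
  rw [Finset.card_insert_of_notMem hfX] at h3
  omega

theorem boundary_ne_singleton (hX : G.bd X = 0) : G.boundary X W ≠ {b} := by
  intro h
  have := sum_bd X W
  rw [h, hX] at this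
  simp at this

theorem boundary_eq_singleton (hX : X ⊆ S) (hb : b ∈ X) (hW : G.boundary S W = {b}) :
    G.boundary X W = {b} := by
  refine ((boundary_mono hX).trans hW.subset).antisymm (Finset.singleton_subset_iff.2 ?_)
  have : b ∈ G.boundary S W := by simp [hW]
  exact Finset.mem_filter.2 ⟨hb, (Finset.mem_filter.1 this).2⟩

theorem not_isBridge_of_bd (hXS : X ⊆ S) (hb : b ∈ X) (hX : G.bd X = 0) : ¬ G.IsBridge S b :=
  fun ⟨_, hW⟩ => boundary_ne_singleton hX (boundary_eq_singleton hXS hb hW)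

theorem exists_bd_of_not_isBridge (hb : b ∈ S) (h : ¬ G.IsBridge S b) :
    ∃ X ⊆ S, b ∈ X ∧ G.bd X = 0 := by
  obtain ⟨x, y, hxy⟩ := exists_ends b
  have hr : G.Reach (S.erase b) x y := by
    by_contra hr
    refine h ⟨Finset.univ.filter fun w => G.Reach (S.erase b) x w, ?_⟩
    ext e
    obtain ⟨p, q, hpq⟩ := exists_ends e
    rw [Finset.mem_singleton]
    refine ⟨fun he => ?_, ?_⟩
    · rw [mem_boundary hpq] at he
      by_contra hne
      have h1 := reach_edge (Finset.mem_erase.2 ⟨hne, he.1⟩) hpq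
      refine he.2 ?_
      simp only [Finset.mem_filter, Finset.mem_univ, true_and]
      exact ⟨fun h2 => h2.trans' h1, fun h2 => h2.trans' h1.symm'⟩
    · rintro rfl
      rw [mem_boundary hxy]
      refine ⟨hb, fun h1 => hr ?_⟩
      simp only [Finset.mem_filter, Finset.mem_univ, true_and] at h1
      exact h1.1 (Reach.refl' _ _)
  obtain ⟨P, hP, hPb⟩ := exists_bd_of_reach hr
  refine ⟨insert b P, Finset.insert_subset hb (hP.trans (Finset.erase_subset _ _)),
    Finset.mem_insert_self _ _, ?_⟩
  rw [bd_insert (fun hc => Finset.notMem_erase _ _ (hP hc)) hxy, hPb, pi_add_self]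

theorem bridgeless_filter : G.Bridgeless (S.filter fun e => ¬ G.IsBridge S e) := by
  intro b hb
  obtain ⟨hbS, hb⟩ := Finset.mem_filter.1 hb
  obtain ⟨X, hXS, hbX, hX⟩ := exists_bd_of_not_isBridge hbS hb
  exact not_isBridge_of_bd (fun e he => Finset.mem_filter.2
    ⟨hXS he, not_isBridge_of_bd hXS he hX⟩) hbX hX

theorem IsUnbalancedCircuit.exists_neg {A : Finset G.E} (hA : G.IsUnbalancedCircuit A) :
    (G.negEdges A).Nonempty :=
  Finset.nonempty_iff_ne_empty.2 fun h => hA.2 (by simp [h])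

theorem IsSignedCircuit.connOn (hS : G.IsSignedCircuit S) : G.ConnOn S := by
  rcases hS with hS | ⟨A, B, hA, hB, hd, hc, rfl⟩ |
    ⟨A, B, P, u, v, hA, hB, hd, hP, h1, h2, h3, h4, rfl⟩
  · exact hS.1.2.1
  · obtain ⟨z, hz⟩ := Finset.card_eq_one.1 hc
    have h1 : z ∈ G.support A ∩ G.support B := by simp [hz]
    exact hA.1.2.1.union hB.1.2.1 (Finset.mem_inter.1 h1).1 (Finset.mem_inter.1 h1).2
  · have hu : u ∈ G.support P ∩ G.support A := by simp [h1]
    have hv : v ∈ G.support P ∩ G.support B := by simp [h2]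
    rw [Finset.mem_inter] at hu hv
    have h5 := (hA.1.2.1.union hP.2.1 hu.2 hu.1).union hB.1.2.1 (x := v)
      (by rw [support_union]; exact Finset.mem_union_right _ hv.1) hv.2
    rwa [Finset.union_right_comm] at h5

theorem negEdges_mono (h : S ⊆ T) : G.negEdges S ⊆ G.negEdges T := Finset.filter_subset_filter _ h

/-- A signed circuit through a negative edge contains another negative edge. -/
theorem IsSignedCircuit.exists_neg_ne (hS : G.IsSignedCircuit S) (he : e ∈ G.negEdges S) :
    ∃ f ∈ G.negEdges S, f ≠ e := by
  have key : ∀ A B : Finset G.E, A ⊆ S → B ⊆ S → Disjoint A B → G.IsUnbalancedCircuit A →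
      G.IsUnbalancedCircuit B → ∃ f ∈ G.negEdges S, f ≠ e := by
    intro A B hAS hBS hd hA hB
    obtain ⟨f, hf⟩ := hA.exists_neg
    obtain ⟨g, hg⟩ := hB.exists_neg
    by_cases hfe : f = e
    · refine ⟨g, negEdges_mono hBS hg, fun hge => ?_⟩
      exact Finset.disjoint_left.1 hd (Finset.filter_subset _ _ hf)
        ((hfe.trans hge.symm) ▸ Finset.filter_subset _ _ hg)
    · exact ⟨f, negEdges_mono hAS hf, hfe⟩
  rcases hS with hS | ⟨A, B, hA, hB, hd, hc, rfl⟩ |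
    ⟨A, B, P, u, v, hA, hB, hd, hP, h1, h2, h3, h4, rfl⟩
  · by_contra! hc
    have h1 : G.negEdges S = {e} := Finset.eq_singleton_iff_unique_mem.2 ⟨he, hc⟩
    have h2 := hS.2
    rw [h1] at h2
    simp at h2
  · exact key A B Finset.subset_union_left Finset.subset_union_right hd hA hB
  · refine key A B (Finset.subset_union_left.trans Finset.subset_union_left)
      (Finset.subset_union_right.trans Finset.subset_union_left) ?_ hA hB
    rw [Finset.disjoint_left]
    intro f hf hf'
    obtain ⟨x, y, hxy⟩ := exists_ends f
    exact Finset.disjoint_left.1 hd (mem_support.2 ⟨f, hf, mem_ends_left hxy⟩)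
      (mem_support.2 ⟨f, hf', mem_ends_left hxy⟩)

theorem IsUnbalancedCircuit.inside_nonempty {A : Finset G.E} (hA : G.IsUnbalancedCircuit A)
    (hW : G.boundary A W = ∅) {u : G.V} (hu : u ∈ G.support A) (huW : u ∈ W) :
    (G.inside (G.negEdges A) W).Nonempty := by
  obtain ⟨f, hf⟩ := hA.exists_neg
  exact ⟨f, Finset.mem_filter.2 ⟨hf, fun v hv => (reach_mem_iff hW
    (hA.1.2.1 u hu v (mem_support.2 ⟨f, Finset.filter_subset _ _ hf, hv⟩))).1 huW⟩⟩

theorem inside_mono (h : S ⊆ T) : G.inside S U ⊆ G.inside T U := Finset.filter_subset_filter _ h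

/-- A signed circuit crossing a cut exactly once has negative edges on both sides of it. -/
theorem IsSignedCircuit.inside_nonempty (hS : G.IsSignedCircuit S) (hW : G.boundary S W = {c}) :
    (G.inside (G.negEdges S) W).Nonempty ∧ (G.inside (G.negEdges S) Wᶜ).Nonempty := by
  rcases hS with hS | ⟨A, B, hA, hB, hd, hc, rfl⟩ |
    ⟨A, B, P, u, v, hA, hB, hd, hP, h1, h2, h3, h4, rfl⟩
  · exact absurd hW (boundary_ne_singleton hS.1.bd)
  · refine absurd hW (boundary_ne_singleton ?_)
    rw [bd_union hd, hA.1.bd, hB.1.bd, add_zero]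
  · have hu : u ∈ G.support P ∩ G.support A := by simp [h1]
    have hv : v ∈ G.support P ∩ G.support B := by simp [h2]
    rw [Finset.mem_inter] at hu hv
    have hAS : A ⊆ A ∪ B ∪ P := Finset.subset_union_left.trans Finset.subset_union_left
    have hBS : B ⊆ A ∪ B ∪ P := Finset.subset_union_right.trans Finset.subset_union_left
    have hempty : ∀ C ⊆ A ∪ B ∪ P, G.IsUnbalancedCircuit C → G.boundary C W = ∅ := by
      intro C hC hCc
      rcases Finset.subset_singleton_iff.1 ((boundary_mono hC).trans hW.subset) with h | h
      exacts [h, absurd h (boundary_ne_singleton hCc.1.bd)]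
    have hbA := hempty A hAS hA
    have hbB := hempty B hBS hB
    have hcP : G.boundary P W = {c} := by
      refine boundary_eq_singleton Finset.subset_union_right ?_ hW
      have hc : c ∈ G.boundary (A ∪ B ∪ P) W := hW ▸ Finset.mem_singleton_self c
      obtain ⟨hc, hcW⟩ := Finset.mem_filter.1 hc
      rcases Finset.mem_union.1 hc with hc | hc
      · rcases Finset.mem_union.1 hc with hc | hc
        · exact absurd (Finset.mem_filter.2 ⟨hc, hcW⟩) (hbA ▸ Finset.notMem_empty c)
        · exact absurd (Finset.mem_filter.2 ⟨hc, hcW⟩) (hbB ▸ Finset.notMem_empty c)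
      · exact hc
    have hsum := sum_bd P W
    simp only [hP.bd, hcP, Pi.add_apply, Finset.sum_add_distrib, sum_pt, Finset.card_singleton]
      at hsum
    have hA1 := inside_mono (U := W) (negEdges_mono hAS)
    have hA2 := inside_mono (U := Wᶜ) (negEdges_mono hAS)
    have hB1 := inside_mono (U := W) (negEdges_mono hBS)
    have hB2 := inside_mono (U := Wᶜ) (negEdges_mono hBS)
    by_cases huW : u ∈ W
    · have hvW : v ∉ W := fun hvW => by
        rw [if_pos huW, if_pos hvW] at hsum
        exact absurd hsum (by decide)
      exact ⟨(hA.inside_nonempty hbA hu.2 huW).mono hA1, (hB.inside_nonempty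
        (boundary_compl.trans hbB) hv.2 (Finset.mem_compl.2 hvW)).mono hB2⟩
    · have hvW : v ∈ W := by_contra fun hvW => by
        rw [if_neg huW, if_neg hvW] at hsum
        exact absurd hsum (by decide)
      exact ⟨(hB.inside_nonempty hbB hv.2 hvW).mono hB1, (hA.inside_nonempty
        (boundary_compl.trans hbA) hu.2 (Finset.mem_compl.2 huW)).mono hA2⟩

end Cuts

section Frame

variable {G : SignedMultigraph} {T : Finset G.E} {A U W : Finset G.V} {b c e : G.E} {x y : G.V}
  {F K : Multiset (Finset G.E)}

/-- The set of positive edges. -/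
def posEdges (G : SignedMultigraph) : Finset G.E := Finset.univ.filter fun e => ¬ G.neg e = true

theorem mem_negEdges_univ : e ∈ G.negEdges Finset.univ ↔ G.neg e = true := by simp [negEdges]

theorem mem_posEdges : e ∈ G.posEdges ↔ ¬ G.neg e = true := by simp [posEdges]

theorem disjoint_posEdges : Disjoint G.posEdges (G.negEdges Finset.univ) := by
  rw [Finset.disjoint_left]
  intro e h1 h2
  exact mem_posEdges.1 h1 (mem_negEdges_univ.1 h2)

theorem card_boundary_le (h : (G.negEdges Finset.univ).card = G.negativeness)
    (U : Finset G.V) :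
    (G.boundary (G.negEdges Finset.univ) U).card ≤ (G.boundary G.posEdges U).card := by
  have h1 : G.negativeness ≤ (Finset.univ.filter fun e => G.negAfter U e = true).card :=
    Nat.sInf_le ⟨U, rfl⟩
  have h2 : (Finset.univ.filter fun e => G.negAfter U e = true) =
      ((G.negEdges Finset.univ).filter fun e => ¬ G.crossesB U e = true) ∪
        G.boundary G.posEdges U := by
    ext e
    simp only [Finset.mem_filter, Finset.mem_union, boundary, negEdges, posEdges, negAfter,
      Finset.mem_univ, true_and]
    cases h2 : G.neg e <;> cases h3 : G.crossesB U e <;> simp [h2, h3]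
  have h3 := Finset.card_filter_add_card_filter_not (s := G.negEdges Finset.univ)
    (fun e => G.crossesB U e = true)
  have h4 := Finset.card_union_le
    ((G.negEdges Finset.univ).filter fun e => ¬ G.crossesB U e = true) (G.boundary G.posEdges U)
  rw [← h2] at h4
  have h5 : G.boundary (G.negEdges Finset.univ) U =
    (G.negEdges Finset.univ).filter fun e => G.crossesB U e = true := rfl
  rw [h5]
  omega

/-- A spanning forest of positive edges, when switching cannot reduce the number of negative
edges. -/
structure Frame (G : SignedMultigraph) (T : Finset G.E) : Prop where
  pos : T ⊆ G.posEdges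
  acyc : G.Acyc T
  reach : ∀ e x y, G.ends e = s(x, y) → G.Reach T x y
  cut : ∀ U, (G.boundary (G.negEdges Finset.univ) U).card ≤ (G.boundary G.posEdges U).card

theorem exists_maximal_acyc (S : Finset G.E) :
    ∃ T ⊆ S, G.Acyc T ∧ ∀ e ∈ S, ∀ x y, G.ends e = s(x, y) → G.Reach T x y := by
  obtain ⟨T, hT, hmax⟩ := Finset.exists_max_image (S.powerset.filter G.Acyc) Finset.card
    ⟨∅, by simp [acyc_empty]⟩
  obtain ⟨hTS, hTa⟩ := Finset.mem_filter.1 hT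
  rw [Finset.mem_powerset] at hTS
  refine ⟨T, hTS, hTa, fun e he x y hxy => ?_⟩
  by_cases heT : e ∈ T
  · exact reach_edge heT hxy
  · have h1 : ¬ G.Acyc (insert e T) := fun hc => by
      have := hmax (insert e T) (Finset.mem_filter.2
        ⟨Finset.mem_powerset.2 (Finset.insert_subset he hTS), hc⟩)
      rw [Finset.card_insert_of_notMem heT] at this
      omega
    unfold Acyc at h1
    push Not at h1
    obtain ⟨X, hX, hXb, hne⟩ := h1
    have heX : e ∈ X := by
      by_contra heX
      exact hne.ne_empty (hTa X ((Finset.subset_insert_iff_of_notMem heX).1 hX) hXb)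
    refine (reach_of_bd (P := X.erase e) ?_).mono (Finset.subset_insert_iff.1 hX)
    rw [← Finset.sdiff_singleton_eq_erase, bd_sdiff (by simpa using heX), hXb, bd_singleton hxy,
      zero_add]

theorem exists_frame (h : (G.negEdges Finset.univ).card = G.negativeness) :
    ∃ T, G.Frame T := by
  obtain ⟨T, hTS, hTa, hT⟩ := exists_maximal_acyc G.posEdges
  refine ⟨T, hTS, hTa, fun e x y hxy => ?_, card_boundary_le h⟩
  by_contra hc
  have h1 : G.boundary G.posEdges (Finset.univ.filter fun w => G.Reach T x w) = ∅ := by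
    refine Finset.eq_empty_of_forall_notMem fun f hf => ?_
    obtain ⟨p, q, hpq⟩ := exists_ends f
    rw [mem_boundary hpq] at hf
    have h2 := hT f hf.1 p q hpq
    refine hf.2 ?_
    simp only [Finset.mem_filter, Finset.mem_univ, true_and]
    exact ⟨fun h => h.trans' h2, fun h => h.trans' h2.symm'⟩
  have h2 := card_boundary_le h (Finset.univ.filter fun w => G.Reach T x w)
  rw [h1, Finset.card_empty, Nat.le_zero, Finset.card_eq_zero] at h2
  have h3 : e ∈ G.boundary (G.negEdges Finset.univ)
      (Finset.univ.filter fun w => G.Reach T x w) := by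
    rw [mem_boundary hxy]
    refine ⟨by_contra fun hn => hc (hT e ?_ x y hxy), fun hi => hc ?_⟩
    · exact mem_posEdges.2 fun hn' => hn (mem_negEdges_univ.2 hn')
    · simp only [Finset.mem_filter, Finset.mem_univ, true_and] at hi
      exact hi.1 (Reach.refl' _ _)
  rw [h2] at h3
  exact Finset.notMem_empty e h3

theorem Frame.mem_of_boundary (h : G.Frame T) (hW : G.boundary G.posEdges W = {c}) : c ∈ T := by
  by_contra hc
  have h1 : G.boundary T W = ∅ := by
    refine Finset.eq_empty_of_forall_notMem fun e he => ?_
    have h2 := boundary_mono h.pos he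
    rw [hW, Finset.mem_singleton] at h2
    exact hc (h2 ▸ Finset.filter_subset _ _ he)
  obtain ⟨x, y, hxy⟩ := exists_ends c
  have h2 : c ∈ G.boundary G.posEdges W := by simp [hW]
  rw [mem_boundary hxy] at h2
  exact h2.2 (reach_mem_iff h1 (h.reach c x y hxy))

/-- A family of signed circuits covering, within a union `A` of components, all negative edges
and all bridges of the positive subgraph. -/
structure PartCover (G : SignedMultigraph) (T : Finset G.E) (A : Finset G.V)
    (F : Multiset (Finset G.E)) : Prop where
  signed : ∀ S ∈ F, G.IsSignedCircuit S
  out : ∀ e ∉ G.inside (T ∪ G.negEdges Finset.univ) A, G.coverCount F e = 0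
  le : ∀ e, G.coverCount F e ≤ 2
  cov : ∀ e ∈ G.inside (G.negEdges Finset.univ) A, 1 ≤ G.coverCount F e
  bridge : ∀ e ∈ G.inside G.posEdges A, G.IsBridge G.posEdges e → 1 ≤ G.coverCount F e

theorem mem_inside_union {S : Finset G.E} (hA : G.boundary Finset.univ A = ∅)
    (he : e ∈ G.inside S (A ∪ U)) : e ∈ G.inside S A ∨ e ∈ G.inside S U := by
  obtain ⟨x, y, hxy⟩ := exists_ends e
  have h1 : e ∉ G.boundary Finset.univ A := by simp [hA]
  simp only [mem_boundary hxy, mem_inside hxy, Finset.mem_union, Finset.mem_univ, true_and,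
    not_not] at *
  tauto

theorem PartCover.union (hA : G.boundary Finset.univ A = ∅) (hd : Disjoint A U)
    (hF : G.PartCover T A F) (hK : G.PartCover T U K) : G.PartCover T (A ∪ U) (F + K) := by
  refine ⟨fun S hS => ?_, fun e he => ?_, fun e => ?_, fun e he => ?_, fun e he hb => ?_⟩
  · rcases Multiset.mem_add.1 hS with hS | hS
    exacts [hF.signed S hS, hK.signed S hS]
  · rw [coverCount_add, hF.out e fun h => he ?_, hK.out e fun h => he ?_]
    · exact Finset.mem_filter.2 ⟨(Finset.mem_filter.1 h).1, fun v hv =>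
        Finset.mem_union_right _ ((Finset.mem_filter.1 h).2 v hv)⟩
    · exact Finset.mem_filter.2 ⟨(Finset.mem_filter.1 h).1, fun v hv =>
        Finset.mem_union_left _ ((Finset.mem_filter.1 h).2 v hv)⟩
  · rw [coverCount_add]
    by_cases he : e ∈ G.inside (T ∪ G.negEdges Finset.univ) A
    · have := hF.le e
      rw [hK.out e fun h => ?_]
      · omega
      · obtain ⟨x, y, hxy⟩ := exists_ends e
        exact Finset.disjoint_left.1 hd ((mem_inside hxy).1 he).2.1 ((mem_inside hxy).1 h).2.1
    · rw [hF.out e he, zero_add]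
      exact hK.le e
  · rw [coverCount_add]
    rcases mem_inside_union hA he with h | h
    · have := hF.cov e h
      omega
    · have := hK.cov e h
      omega
  · rw [coverCount_add]
    rcases mem_inside_union hA he with h | h
    · have := hF.bridge e h hb
      omega
    · have := hK.bridge e h hb
      omega

end Frame

section Top

variable {G : SignedMultigraph} {S T : Finset G.E} {A U W : Finset G.V} {c e f : G.E} {v : G.V}

theorem boundary_inter (hU : G.boundary Finset.univ U = ∅) :
    G.boundary S (W ∩ U) = G.inside (G.boundary S W) U := by
  ext e
  obtain ⟨x, y, hxy⟩ := exists_ends e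
  have h1 : e ∉ G.boundary Finset.univ U := by simp [hU]
  simp only [mem_boundary hxy, mem_inside hxy, Finset.mem_inter, Finset.mem_univ, true_and,
    not_not] at *
  tauto

theorem ConnOn.mem_inside (hS : G.ConnOn S) (hU : G.boundary Finset.univ U = ∅) (he : e ∈ S)
    (heU : e ∈ G.inside Finset.univ U) (hf : f ∈ S) : f ∈ G.inside Finset.univ U := by
  obtain ⟨x, y, hxy⟩ := exists_ends e
  have h1 : G.boundary S U = ∅ :=
    Finset.subset_empty.1 ((boundary_mono (Finset.subset_univ S)).trans hU.subset)
  refine Finset.mem_filter.2 ⟨Finset.mem_univ _, fun v hv => (reach_mem_iff h1 (hS x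
    (mem_support.2 ⟨e, he, mem_ends_left hxy⟩) v (mem_support.2 ⟨f, hf, hv⟩))).1 ?_⟩
  exact ((SignedMultigraph.mem_inside hxy).1 heU).2.1

theorem mem_inside_of {S' : Finset G.E} (he : e ∈ G.inside S U) (hS : e ∈ S') :
    e ∈ G.inside S' U := Finset.mem_filter.2 ⟨hS, (Finset.mem_filter.1 he).2⟩

/-- A bridge of the positive subgraph either forms a cut with a single negative edge, or separates
two negative edges. -/
theorem Frame.bridge_cases (h : G.Frame T) (hG : G.SBridgeless)
    (hU : G.boundary Finset.univ U = ∅) (hc : c ∈ G.inside G.posEdges U)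
    (hb : G.IsBridge G.posEdges c) :
    (∃ e ∈ G.inside (G.negEdges Finset.univ) U, ∀ X, e ∈ X → G.bd X = 0 → c ∈ X) ∨
      G.Splits (G.inside (T ∪ G.negEdges Finset.univ) U)
        (G.inside (G.negEdges Finset.univ) U) c := by
  obtain ⟨W₀, hW₀⟩ := hb
  obtain ⟨W, hW, hWN⟩ : ∃ W, G.boundary G.posEdges W = {c} ∧
      G.boundary (G.negEdges Finset.univ) W ⊆ G.inside (G.negEdges Finset.univ) U := by
    refine ⟨W₀ ∩ U, ?_, ?_⟩
    · rw [boundary_inter hU, hW₀]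
      ext e
      refine ⟨fun he => inside_subset he, fun he => ?_⟩
      rw [Finset.mem_singleton] at he
      subst he
      exact mem_inside_of hc (Finset.mem_singleton_self _)
    · rw [boundary_inter hU]
      exact inside_mono (Finset.filter_subset _ _)
  have hcW : c ∈ G.boundary G.posEdges W := hW ▸ Finset.mem_singleton_self c
  have hcard := h.cut W
  rw [hW, Finset.card_singleton] at hcard
  have hor : ∀ e ∈ G.boundary Finset.univ W, e = c ∨ e ∈ G.boundary (G.negEdges Finset.univ) W := by
    intro e he
    by_cases hn : G.neg e = true
    · exact Or.inr (Finset.mem_filter.2 ⟨mem_negEdges_univ.2 hn, (Finset.mem_filter.1 he).2⟩)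
    · refine Or.inl (Finset.mem_singleton.1 (hW ▸ ?_))
      exact Finset.mem_filter.2 ⟨mem_posEdges.2 hn, (Finset.mem_filter.1 he).2⟩
  rcases Nat.le_one_iff_eq_zero_or_eq_one.1 hcard with h0 | h1
  · rw [Finset.card_eq_zero] at h0
    have huniv : G.boundary Finset.univ W = {c} := by
      refine Finset.eq_singleton_iff_unique_mem.2 ⟨boundary_mono (Finset.subset_univ _) hcW, ?_⟩
      intro e he
      refine (hor e he).resolve_right ?_
      rw [h0]
      exact Finset.notMem_empty e
    obtain ⟨S, hS, hcS⟩ := hG c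
    obtain ⟨⟨f, hf⟩, g, hg⟩ :=
      hS.inside_nonempty (boundary_eq_singleton (Finset.subset_univ S) hcS huniv)
    have key : ∀ f V, f ∈ G.inside (G.negEdges S) V →
        f ∈ G.inside (G.inside (G.negEdges Finset.univ) U) V := fun f V hf => by
      have h2 := inside_subset hf
      refine mem_inside_of hf (mem_inside_of (hS.connOn.mem_inside hU hcS
        (mem_inside_of hc (Finset.mem_univ _)) (Finset.filter_subset _ _ h2)) ?_)
      exact negEdges_mono (Finset.subset_univ _) h2
    refine Or.inr ⟨W, boundary_eq_singleton (Finset.subset_univ _) ?_ huniv, ⟨f, key f _ hf⟩,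
      ⟨g, key g _ hg⟩⟩
    exact mem_inside_of hc (Finset.mem_union_left _ (h.mem_of_boundary hW))
  · obtain ⟨e, he⟩ := Finset.card_eq_one.1 h1
    have heW : e ∈ G.boundary (G.negEdges Finset.univ) W := he ▸ Finset.mem_singleton_self e
    refine Or.inl ⟨e, hWN heW, fun X heX hX => by_contra fun hcX => ?_⟩
    refine boundary_ne_singleton (W := W) (b := e) hX
      (Finset.eq_singleton_iff_unique_mem.2 ⟨?_, fun z hz => ?_⟩)
    · exact Finset.mem_filter.2 ⟨heX, (Finset.mem_filter.1 heW).2⟩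
    · rcases hor z (boundary_mono (Finset.subset_univ _) hz) with rfl | h2
      · exact absurd (Finset.filter_subset _ _ hz) hcX
      · rwa [he, Finset.mem_singleton] at h2

theorem Frame.setup (h : G.Frame T) (hG : G.SBridgeless) (hU : G.boundary Finset.univ U = ∅)
    (hr : ∀ u ∈ U, ∀ v ∈ U, G.Reach T u v)
    (hne : (G.inside (G.negEdges Finset.univ) U).Nonempty) :
    G.Setup (G.inside (T ∪ G.negEdges Finset.univ) U) (G.inside (G.negEdges Finset.univ) U) ∅ := by
  refine ⟨inside_mono Finset.subset_union_right, Finset.empty_subset _, fun e he => ?_, by simp,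
    fun u hu v hv => ?_, ?_⟩
  · have h1 : G.sgn e = 1 ↔ G.neg e = true := by unfold sgn; split_ifs with h1 <;> simp [h1]
    rw [h1, ← mem_negEdges_univ]
    exact ⟨fun hn => mem_inside_of he hn, fun hn => inside_subset hn⟩
  · have h1 := hr u (support_inside hu) v (support_inside hv)
    obtain ⟨b, -, -⟩ := mem_support.1 hu
    have h2 := SignedMultigraph.reach_inside (b := b) (U := U) (S := T) (by
      rw [Finset.subset_empty.1 ((boundary_mono (Finset.subset_univ T)).trans hU.subset)]
      exact Finset.empty_subset _) (support_inside hu) (support_inside hv) h1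
    refine h2.mono fun e he => Finset.mem_sdiff.2
      ⟨mem_inside_of he (Finset.mem_union_left _ (inside_subset he)), fun hc => ?_⟩
    exact Finset.disjoint_left.1 disjoint_posEdges (h.pos (inside_subset he)) (inside_subset hc)
  · obtain ⟨e, he⟩ := hne
    obtain ⟨S, hS, heS⟩ := hG e
    have hen : e ∈ G.negEdges S :=
      Finset.mem_filter.2 ⟨heS, mem_negEdges_univ.1 (inside_subset he)⟩
    obtain ⟨f, hf, hfe⟩ := hS.exists_neg_ne hen
    have hfU := hS.connOn.mem_inside hU heS (mem_inside_of he (Finset.mem_univ _))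
      (Finset.filter_subset _ _ hf)
    exact Finset.one_lt_card.2
      ⟨f, mem_inside_of hfU (negEdges_mono (Finset.subset_univ _) hf), e, he, hfe⟩

theorem Frame.exists_partCover_component (h : G.Frame T) (hG : G.SBridgeless)
    (hU : G.boundary Finset.univ U = ∅) (hr : ∀ u ∈ U, ∀ v ∈ U, G.Reach T u v) :
    ∃ F, G.PartCover T U F := by
  rcases Finset.eq_empty_or_nonempty (G.inside (G.negEdges Finset.univ) U) with he | hne
  · refine ⟨0, by simp, fun _ _ => rfl, fun _ => Nat.zero_le _, by simp [he], fun c hc hb => ?_⟩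
    rcases h.bridge_cases hG hU hc hb with ⟨e, heN, -⟩ | ⟨W, -, hN, -⟩
    · rw [he] at heN
      exact absurd heN (Finset.notMem_empty e)
    · rw [he] at hN
      exact absurd (hN.mono inside_subset) Finset.not_nonempty_empty
  · obtain ⟨F, hF, hs⟩ := exists_good_splits _ G _ _ _ rfl (h.setup hG hU hr hne)
    refine ⟨F, hF.signed, hF.out, hF.le, fun e he => ?_, fun c hc hb => ?_⟩
    · obtain ⟨X, heX, -, hX⟩ := hF.cov e he
      exact hX e heX
    · rcases h.bridge_cases hG hU hc hb with ⟨e, heN, he⟩ | hsp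
      · obtain ⟨X, heX, hXb, hX⟩ := hF.cov e heN
        exact hX c (he X heX hXb)
      · exact hs c hsp

theorem Frame.exists_partCover (h : G.Frame T) (hG : G.SBridgeless)
    (hA : G.boundary Finset.univ A = ∅) : ∃ F, G.PartCover T A F := by
  induction A using Finset.strongInduction with
  | H A ih =>
    rcases Finset.eq_empty_or_nonempty A with rfl | ⟨v, hv⟩
    · have h0 : ∀ S : Finset G.E, G.inside S ∅ = ∅ := fun S =>
        Finset.eq_empty_of_forall_notMem fun e he => by
          obtain ⟨x, y, hxy⟩ := exists_ends e
          exact Finset.notMem_empty x ((mem_inside hxy).1 he).2.1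
      exact ⟨0, by simp, fun _ _ => rfl, fun _ => Nat.zero_le _, by simp [h0], by simp [h0]⟩
    · have hU : ∀ w, w ∈ Finset.univ.filter (G.Reach T v) ↔ G.Reach T v w := by simp
      have hUb : G.boundary Finset.univ (Finset.univ.filter (G.Reach T v)) = ∅ := by
        refine Finset.eq_empty_of_forall_notMem fun e he => ?_
        obtain ⟨x, y, hxy⟩ := exists_ends e
        rw [mem_boundary hxy, hU, hU] at he
        have := h.reach e x y hxy
        exact he.2 ⟨fun h1 => h1.trans' this, fun h1 => h1.trans' this.symm'⟩
      generalize Finset.univ.filter (G.Reach T v) = U at hU hUb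
      have hAT : G.boundary T A = ∅ :=
        Finset.subset_empty.1 ((boundary_mono (Finset.subset_univ T)).trans hA.subset)
      have hUA : U ⊆ A := fun w hw => (reach_mem_iff hAT ((hU w).1 hw)).1 hv
      have hvU : v ∈ U := (hU v).2 (Reach.refl' _ _)
      have hAU : G.boundary Finset.univ (A \ U) = ∅ := by
        rw [Finset.sdiff_eq_inter_compl, boundary_inter (boundary_compl.trans hUb), hA]
        exact Finset.subset_empty.1 inside_subset
      obtain ⟨F, hF⟩ := h.exists_partCover_component hG hUb fun u hu w hw =>
        ((hU u).1 hu).symm'.trans' ((hU w).1 hw)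
      obtain ⟨K, hK⟩ := ih (A \ U) ⟨Finset.sdiff_subset, fun hc =>
        (Finset.mem_sdiff.1 (hc hv)).2 hvU⟩ hAU
      have := hF.union hUb Finset.disjoint_sdiff hK
      rw [Finset.union_sdiff_of_subset hUA] at this
      exact ⟨_, this⟩

end Top

theorem boundary_univ {G : SignedMultigraph} (S : Finset G.E) : G.boundary S Finset.univ = ∅ := by
  refine Finset.eq_empty_of_forall_notMem fun e he => ?_
  obtain ⟨x, y, hxy⟩ := exists_ends e
  rw [mem_boundary hxy] at he
  simp at he

end SignedMultigraph

/-- Let `G` be an s-bridgeless signed graph with `|E_N(G)| = ε_N(G)`.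
Then `G` has subgraphs `G₁, G₂` with (1) `E(G₁) ∪ E(G₂) = E(G)`, (2) `G₁` has no
negative edge and is bridgeless, (3) `G₂ − E_N(G)` is acyclic and `G₂` has a
signed circuit `{1, …, k}`-cover, with `k = 2` if `G` is g-bridgeless with even
negativeness and `k = 3` otherwise. -/
theorem pair_of_subgraphs (G : SignedMultigraph) (hG : G.SBridgeless)
    (hmin : (G.negEdges Finset.univ).card = G.negativeness) :
    ∃ G₁ G₂ : Finset G.E,
      G₁ ∪ G₂ = Finset.univ ∧
      (∀ e ∈ G₁, G.neg e = false) ∧ G.Bridgeless G₁ ∧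
      G.AcyclicSet (G₂ \ G.negEdges Finset.univ) ∧
      ∃ F : Multiset (Finset G.E),
        (∀ S ∈ F, G.IsSignedCircuit S ∧ S ⊆ G₂) ∧
        ∀ e ∈ G₂, 1 ≤ G.coverCount F e ∧
          G.coverCount F e ≤
            (if G.GBridgeless ∧ Even G.negativeness then 2 else 3) := by
  obtain ⟨T, hT⟩ := SignedMultigraph.exists_frame hmin
  obtain ⟨F, hF⟩ := hT.exists_partCover hG (A := Finset.univ)
    (SignedMultigraph.boundary_univ Finset.univ)
  have hin : ∀ S : Finset G.E, G.inside S Finset.univ = S := fun S =>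
    Finset.filter_true_of_mem fun _ _ _ _ => Finset.mem_univ _
  have hcov := hF.cov
  have hbr := hF.bridge
  have hout := hF.out
  rw [hin] at hcov hbr hout
  refine ⟨G.posEdges.filter fun e => ¬ G.IsBridge G.posEdges e,
    Finset.univ.filter fun e => 1 ≤ G.coverCount F e, ?_, fun e he => ?_,
    SignedMultigraph.bridgeless_filter, (hT.acyc.mono fun e he => ?_).acyclicSet, F,
    fun S hS => ⟨hF.signed S hS, fun e he => ?_⟩, fun e he => ⟨(Finset.mem_filter.1 he).2, ?_⟩⟩
  · refine Finset.eq_univ_iff_forall.2 fun e => Finset.mem_union.2 ?_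
    by_cases hn : G.neg e = true
    · exact Or.inr (Finset.mem_filter.2
        ⟨Finset.mem_univ e, hcov e (SignedMultigraph.mem_negEdges_univ.2 hn)⟩)
    · have hp := SignedMultigraph.mem_posEdges.2 hn
      by_cases hb : G.IsBridge G.posEdges e
      · exact Or.inr (Finset.mem_filter.2 ⟨Finset.mem_univ e, hbr e hp hb⟩)
      · exact Or.inl (Finset.mem_filter.2 ⟨hp, hb⟩)
  · exact Bool.eq_false_iff.2 (SignedMultigraph.mem_posEdges.1 (Finset.mem_filter.1 he).1)
  · obtain ⟨he, hn⟩ := Finset.mem_sdiff.1 he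
    by_contra heT
    have := (Finset.mem_filter.1 he).2
    rw [hout e (by simp [heT, hn])] at this
    exact absurd this (by decide)
  · exact Finset.mem_filter.2 ⟨Finset.mem_univ e, SignedMultigraph.coverCount_pos.2 ⟨S, hS, he⟩⟩
  · have := hF.le e
    split_ifs <;> omega
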